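/- arXiv:2111.03526 — 2 statements merged into one kernel-verified Lean document; each statement's English description precedes it below -/
import Mathlib

section
/- Let m > r be positive integers and A ∈ ℤ^{r×m} a positive, abundant and strictly balanced integer matrix such that S(A,0) ≠ ∅. For each n let p = p(n) ∈ [0,1] and let X_n = |S_1(A,0) ∩ [n]_p^m| be the number of non-trivial solutions x to Ax = 0 with all entries in the random set [n]_p. If n(1−p) → ∞ and n·p^{c(A)} → ∞ as n → ∞, then X̃_n = (X_n − E[X_n])/√(Var X_n) converges in distribution to the standard normal law 𝒩(0,1). -/
open Matrix Finset MeasureTheory ProbabilityTheory Filter Topology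
open scoped BoundedContinuousFunction NNReal ENNReal

attribute [local instance] Classical.propDecidable

noncomputable section

/-- The rank over `ℚ` of an integer matrix. -/
def rkZ {α β : Type*} [Fintype α] [Fintype β] (A : Matrix α β ℤ) : ℕ :=
  (A.map (Int.cast : ℤ → ℚ)).rank

/-- The submatrix consisting of the columns indexed by `Q`. -/
def colSub {α β : Type*} (A : Matrix α β ℤ) (Q : Finset β) : Matrix α Q ℤ :=
  A.submatrix id (fun j => (j : β))

/-- A matrix is positive if `Ax = 0` has a solution with all entries positive and,
for every pair of distinct indices, a solution whose corresponding entries differ. -/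
def IsPositiveMat {α β : Type*} [Fintype β] (A : Matrix α β ℤ) : Prop :=
  (∃ x : β → ℤ, A.mulVec x = 0 ∧ ∀ j, 0 < x j) ∧
    ∀ i j : β, i ≠ j → ∃ x : β → ℤ, A.mulVec x = 0 ∧ x i ≠ x j

/-- A matrix is abundant if it has positive rank and removing at most two columns
does not change the rank. -/
def IsAbundantMat {α β : Type*} [Fintype α] [Fintype β] (A : Matrix α β ℤ) : Prop :=
  0 < rkZ A ∧ ∀ Q : Finset β, Fintype.card β - 2 ≤ Q.card → rkZ (colSub A Q) = rkZ A

/-- `r_Q(A) = rk(A) - rk(A^{complement of Q})`. -/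
def rQ {α β : Type*} [Fintype α] [Fintype β] (A : Matrix α β ℤ) (Q : Finset β) : ℕ :=
  rkZ A - rkZ (colSub A Qᶜ)

/-- The density `c(A) = max over nonempty Q of |Q|/(|Q| - r_Q(A))`. -/
def matDensity {α β : Type*} [Fintype α] [Fintype β] (A : Matrix α β ℤ) : ℝ :=
  sSup {x : ℝ | ∃ Q : Finset β, Q.Nonempty ∧
    x = (Q.card : ℝ) / ((Q.card : ℝ) - (rQ A Q : ℝ))}

/-- The matrix `A_𝔭` obtained by summing columns over the classes of a partition
(realised as a setoid); columns are indexed by the classes. -/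
def contract {α β : Type*} [Fintype β] (A : Matrix α β ℤ) (s : Setoid β) :
    Matrix α (Quotient s) ℤ :=
  fun i c => ∑ j ∈ Finset.univ.filter (fun j => Quotient.mk s j = c), A i j

/-- `𝔓(A)`: partitions whose contracted matrix has full rank `rk(A)`. -/
def partitionFamily {α β : Type*} [Fintype α] [Fintype β] (A : Matrix α β ℤ) :
    Set (Setoid β) :=
  {s | rkZ (contract A s) = rkZ A}

/-- The partition of `β` into singletons, as a setoid. -/
def singletonSetoid (β : Type*) : Setoid β := ⟨Eq, eq_equivalence⟩

/-- Proper solutions: solutions with pairwise distinct coordinates. -/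
def properSols {α β : Type*} [Fintype β] (A : Matrix α β ℤ) (b : α → ℤ) : Set (β → ℤ) :=
  {x | A.mulVec x = b ∧ Function.Injective x}

/-- Type-`𝔓` solutions: solutions whose induced partition (the kernel setoid) lies in `𝔓`. -/
def typeSols {α β : Type*} [Fintype β] (A : Matrix α β ℤ) (b : α → ℤ)
    (P : Set (Setoid β)) : Set (β → ℤ) :=
  {x | A.mulVec x = b ∧ Setoid.ker x ∈ P}

/-- The Bernoulli measure on `Bool` with parameter `p`. -/
def bern (p : ℝ≥0) (h : p ≤ 1) : Measure Bool :=
  (PMF.bernoulli p (by exact_mod_cast h)).toMeasure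

/-- The product Bernoulli measure on `Fin n → Bool`, modelling the random set `[n]_p`. -/
def prodBern (n : ℕ) (p : ℝ≥0) (h : p ≤ 1) : Measure (Fin n → Bool) :=
  Measure.pi fun _ => bern p h

/-- An integer `a` is a selected element of `[n]_p` in outcome `ω`. -/
def selected {n : ℕ} (ω : Fin n → Bool) (a : ℤ) : Prop :=
  ∃ i : Fin n, a = (i : ℕ) + 1 ∧ ω i = true

/-- The number of solutions in `S` whose entries all lie in the random set `[n]_p`. -/
def solCount {β : Type*} (S : Set (β → ℤ)) (n : ℕ) (ω : Fin n → Bool) : ℕ :=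
  Nat.card {x : β → ℤ // x ∈ S ∧ ∀ j, selected ω (x j)}

end

/-- Non-trivial solutions `S_1(A,b)`: solutions whose induced partition lies in `𝔓(A)`. -/
noncomputable def nontrivialSols {α β : Type*} [Fintype α] [Fintype β]
    (A : Matrix α β ℤ) (b : α → ℤ) : Set (β → ℤ) :=
  typeSols A b (partitionFamily A)

/-- A positive matrix is strictly balanced if its density is `m/(m - rk A)`, attained
only at `Q = [m]`, and dominates the density of every proper positive contraction. -/
noncomputable def IsStrictlyBalanced {r m : ℕ} (A : Matrix (Fin r) (Fin m) ℤ) : Prop :=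
  matDensity A = (m : ℝ) / ((m : ℝ) - (rkZ A : ℝ)) ∧
  (∀ Q : Finset (Fin m), Q.Nonempty → Q ≠ Finset.univ →
    (Q.card : ℝ) / ((Q.card : ℝ) - (rQ A Q : ℝ)) < matDensity A) ∧
  (∀ s : Setoid (Fin m), s ∈ partitionFamily A → s ≠ singletonSetoid (Fin m) →
    IsPositiveMat (contract A s) → matDensity (contract A s) < matDensity A)

/-! ### Part 1: a Stein–Tikhomirov bound for characteristic functions -/

/-- `cexpI u = exp(i u)`. -/
noncomputable def cexpI (u : ℝ) : ℂ := Complex.exp (Complex.I * (u : ℂ))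

theorem norm_cexpI (u : ℝ) : ‖cexpI u‖ = 1 := by
  unfold cexpI
  rw [mul_comm]
  exact Complex.norm_exp_ofReal_mul_I u

theorem cexpI_add (u v : ℝ) : cexpI (u + v) = cexpI u * cexpI v := by
  unfold cexpI
  rw [← Complex.exp_add]
  congr 1
  push_cast
  ring

theorem norm_cexpI_sub_one_le (u : ℝ) : ‖cexpI u - 1‖ ≤ |u| := by
  simpa [cexpI] using Real.norm_exp_I_mul_ofReal_sub_one_le (x := u)

theorem norm_cexpI_sub_one_sub_le (u : ℝ) :
    ‖cexpI u - 1 - Complex.I * (u : ℂ)‖ ≤ 2 * u ^ 2 := by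
  by_cases hu : |u| ≤ 1
  · have h := Complex.norm_exp_sub_one_sub_id_le (x := Complex.I * (u : ℂ)) (by simpa using hu)
    have h' : ‖cexpI u - 1 - Complex.I * (u : ℂ)‖ ≤ u ^ 2 := by
      simpa [cexpI] using h
    nlinarith [sq_nonneg u]
  · have h1 := norm_sub_le (cexpI u - 1) (Complex.I * (u : ℂ))
    have h2 := norm_cexpI_sub_one_le u
    have h3 : ‖Complex.I * (u : ℂ)‖ = |u| := by simp
    have h4 : u ^ 2 = |u| ^ 2 := (sq_abs u).symm
    push Not at hu
    rw [h4]
    nlinarith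

section Tikhomirov

set_option linter.unusedSectionVars false

variable {Ω : Type*} [Finite Ω] [MeasurableSpace Ω] [MeasurableSingletonClass Ω]
  (μ : Measure Ω) [IsProbabilityMeasure μ] {ι : Type*} [Fintype ι]

theorem norm_integral_diff_le (F : Ω → ℝ) (U V : Ω → ℝ) (t : ℝ) :
    ‖∫ ω, (F ω : ℂ) * (cexpI (t * U ω) - cexpI (t * V ω)) ∂μ‖ ≤
      |t| * ∫ ω, |F ω| * |U ω - V ω| ∂μ := by
  refine (norm_integral_le_integral_norm _).trans ?_
  rw [← integral_const_mul]
  refine integral_mono Integrable.of_finite Integrable.of_finite ?_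
  intro ω
  have h1 : cexpI (t * U ω) - cexpI (t * V ω) =
      cexpI (t * V ω) * (cexpI (t * (U ω - V ω)) - 1) := by
    rw [mul_sub, ← cexpI_add, mul_one]
    congr 2
    ring
  have h2 := norm_cexpI_sub_one_le (t * (U ω - V ω))
  simp only [norm_mul, h1, norm_cexpI, one_mul, Complex.norm_real, Real.norm_eq_abs]
  rw [abs_mul] at h2
  calc _ ≤ |F ω| * (|t| * |U ω - V ω|) := by gcongr
    _ = _ := by ring

variable (Y : ι → Ω → ℝ) (N : ι → ι → Prop)

/-- The third-order error term. -/
noncomputable def tikhErr : ℝ :=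
  ∑ a, ∑ b, ∑ c, if N a b ∧ (N a c ∨ N b c) then
    ((∫ ω, |Y a ω| * |Y b ω| * |Y c ω| ∂μ) +
      (∫ ω, |Y a ω| * |Y b ω| ∂μ) * ∫ ω, |Y c ω| ∂μ) else 0

theorem sum_split (P : ι → Prop) [DecidablePred P] [DecidablePred fun b => ¬ P b] (f : ι → ℝ) :
    ∑ b, f b = ∑ b with P b, f b + ∑ b with ¬ P b, f b :=
  (Finset.sum_filter_add_sum_filter_not _ _ _).symm

/-- Second-order step. -/
theorem tikh_delta (a b : ι) (t : ℝ)
    (h2 : ∫ ω, ((Y a ω * Y b ω : ℝ) : ℂ) * cexpI (t * ∑ c with ¬ (N a c ∨ N b c), Y c ω) ∂μ =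
      (∫ ω, ((Y a ω * Y b ω : ℝ) : ℂ) ∂μ) *
        ∫ ω, cexpI (t * ∑ c with ¬ (N a c ∨ N b c), Y c ω) ∂μ) :
    ‖(∫ ω, ((Y a ω * Y b ω : ℝ) : ℂ) * cexpI (t * ∑ c, Y c ω) ∂μ) -
      (∫ ω, ((Y a ω * Y b ω : ℝ) : ℂ) ∂μ) * ∫ ω, cexpI (t * ∑ c, Y c ω) ∂μ‖ ≤
    |t| * ∑ c, if (N a c ∨ N b c) then
    ((∫ ω, |Y a ω| * |Y b ω| * |Y c ω| ∂μ) +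
      (∫ ω, |Y a ω| * |Y b ω| ∂μ) * ∫ ω, |Y c ω| ∂μ) else 0 := by
  set U : Ω → ℝ := fun ω => ∑ c, Y c ω with hU
  set V : Ω → ℝ := fun ω => ∑ c with ¬ (N a c ∨ N b c), Y c ω with hV
  have hUV : ∀ ω, |U ω - V ω| ≤ ∑ c with (N a c ∨ N b c), |Y c ω| := by
    intro ω
    have : U ω - V ω = ∑ c with (N a c ∨ N b c), Y c ω := by
      simp only [hU, hV]
      rw [sum_split (fun c => N a c ∨ N b c) (fun c => Y c ω)]
      ring
    rw [this]
    exact Finset.abs_sum_le_sum_abs _ _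
  have e1 : (∫ ω, ((Y a ω * Y b ω : ℝ) : ℂ) * cexpI (t * U ω) ∂μ) -
      (∫ ω, ((Y a ω * Y b ω : ℝ) : ℂ) ∂μ) * ∫ ω, cexpI (t * U ω) ∂μ =
      (∫ ω, ((Y a ω * Y b ω : ℝ) : ℂ) * (cexpI (t * U ω) - cexpI (t * V ω)) ∂μ) -
      (∫ ω, ((Y a ω * Y b ω : ℝ) : ℂ) ∂μ) *
        ∫ ω, ((1 : ℝ) : ℂ) * (cexpI (t * U ω) - cexpI (t * V ω)) ∂μ := by
    simp only [mul_sub, Complex.ofReal_one, one_mul]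
    rw [integral_sub Integrable.of_finite Integrable.of_finite,
      integral_sub Integrable.of_finite Integrable.of_finite, h2]
    ring
  have b1 := norm_integral_diff_le μ (fun ω => Y a ω * Y b ω) U V t
  have b2 := norm_integral_diff_le μ (fun ω => 1) U V t
  have b3 : ‖∫ ω, ((Y a ω * Y b ω : ℝ) : ℂ) ∂μ‖ ≤ ∫ ω, |Y a ω| * |Y b ω| ∂μ := by
    refine (norm_integral_le_integral_norm _).trans (le_of_eq ?_)
    simp
  have c1 : ∫ ω, |Y a ω * Y b ω| * |U ω - V ω| ∂μ ≤
      ∑ c with (N a c ∨ N b c), ∫ ω, |Y a ω| * |Y b ω| * |Y c ω| ∂μ := by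
    rw [← integral_finsetSum _ (fun _ _ => Integrable.of_finite)]
    refine integral_mono Integrable.of_finite Integrable.of_finite fun ω => ?_
    simp only [abs_mul]
    rw [← Finset.mul_sum]
    exact mul_le_mul_of_nonneg_left (hUV ω) (by positivity)
  have c2 : ∫ ω, |(1 : ℝ)| * |U ω - V ω| ∂μ ≤
      ∑ c with (N a c ∨ N b c), ∫ ω, |Y c ω| ∂μ := by
    rw [← integral_finsetSum _ (fun _ _ => Integrable.of_finite)]
    refine integral_mono Integrable.of_finite Integrable.of_finite fun ω => ?_
    simpa using hUV ω
  have hpos : 0 ≤ ∫ ω, |Y a ω| * |Y b ω| ∂μ := integral_nonneg fun ω => by positivity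
  rw [e1]
  refine (norm_sub_le _ _).trans ?_
  rw [norm_mul]
  rw [← Finset.sum_filter, Finset.sum_add_distrib, ← Finset.mul_sum, mul_add]
  refine add_le_add (b1.trans (mul_le_mul_of_nonneg_left c1 (abs_nonneg t))) ?_
  calc _ ≤ (∫ ω, |Y a ω| * |Y b ω| ∂μ) * (|t| * ∑ c with (N a c ∨ N b c), ∫ ω, |Y c ω| ∂μ) :=
        mul_le_mul b3 (b2.trans (mul_le_mul_of_nonneg_left c2 (abs_nonneg t)))
          (norm_nonneg _) hpos
    _ = _ := by ring

/-- First-order step. -/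
theorem tikh_first (a : ι) (t : ℝ)
    (h0 : ∫ ω, (Y a ω : ℂ) * cexpI (t * ∑ b with ¬ N a b, Y b ω) ∂μ = 0) :
    ‖(∫ ω, (Y a ω : ℂ) * cexpI (t * ∑ c, Y c ω) ∂μ) -
      Complex.I * t * ∑ b with N a b, ∫ ω, ((Y a ω * Y b ω : ℝ) : ℂ) * cexpI (t * ∑ c, Y c ω) ∂μ‖ ≤
    2 * t ^ 2 * ∑ b with N a b, ∑ c with N a c, ∫ ω, |Y a ω| * |Y b ω| * |Y c ω| ∂μ := by
  set U : Ω → ℝ := fun ω => ∑ c, Y c ω with hU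
  set V : Ω → ℝ := fun ω => ∑ c with ¬ N a c, Y c ω with hV
  set Z : Ω → ℝ := fun ω => ∑ c with N a c, Y c ω with hZ
  have hUV : ∀ ω, V ω = U ω + - Z ω := by
    intro ω
    simp only [hU, hV, hZ]
    rw [sum_split (fun c => N a c) (fun c => Y c ω)]
    ring
  have e1 : (∫ ω, (Y a ω : ℂ) * cexpI (t * U ω) ∂μ) -
      Complex.I * t * ∑ b with N a b, ∫ ω, ((Y a ω * Y b ω : ℝ) : ℂ) * cexpI (t * U ω) ∂μ =
      ∫ ω, (Y a ω : ℂ) * cexpI (t * U ω) *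
        (- (cexpI (- (t * Z ω)) - 1 - Complex.I * ((- (t * Z ω) : ℝ) : ℂ))) ∂μ := by
    rw [← sub_zero (∫ ω, (Y a ω : ℂ) * cexpI (t * U ω) ∂μ), ← h0,
      ← integral_finsetSum _ (fun _ _ => Integrable.of_finite), ← integral_const_mul,
      ← integral_sub Integrable.of_finite Integrable.of_finite,
      ← integral_sub Integrable.of_finite Integrable.of_finite]
    congr 1
    ext ω
    change (Y a ω : ℂ) * cexpI (t * U ω) - (Y a ω : ℂ) * cexpI (t * V ω) - _ = _
    rw [hUV ω, mul_add, cexpI_add]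
    have : ∑ b with N a b, ((Y a ω * Y b ω : ℝ) : ℂ) * cexpI (t * U ω) =
        (Y a ω : ℂ) * (Z ω : ℂ) * cexpI (t * U ω) := by
      generalize cexpI (t * U ω) = E
      simp only [hZ]
      push_cast
      rw [Finset.mul_sum, Finset.sum_mul]
    rw [this, mul_neg]
    push_cast
    ring
  rw [e1]
  refine (norm_integral_le_integral_norm _).trans ?_
  have e2 : 2 * t ^ 2 * ∑ b with N a b, ∑ c with N a c, ∫ ω, |Y a ω| * |Y b ω| * |Y c ω| ∂μ =
      ∫ ω, 2 * t ^ 2 * ∑ b with N a b, ∑ c with N a c, |Y a ω| * |Y b ω| * |Y c ω| ∂μ := by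
    rw [integral_const_mul, integral_finsetSum _ (fun _ _ => Integrable.of_finite)]
    congr 1
    refine Finset.sum_congr rfl fun b _ => ?_
    rw [integral_finsetSum _ (fun _ _ => Integrable.of_finite)]
  rw [e2]
  refine integral_mono Integrable.of_finite Integrable.of_finite fun ω => ?_
  have h3 := norm_cexpI_sub_one_sub_le (- (t * Z ω))
  simp only [norm_mul, norm_neg, norm_cexpI, mul_one, Complex.norm_real, Real.norm_eq_abs]
  have h4 : ∑ b with N a b, ∑ c with N a c, |Y a ω| * |Y b ω| * |Y c ω| =
      |Y a ω| * (∑ c with N a c, |Y c ω|) ^ 2 := by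
    rw [sq, Finset.sum_mul_sum, Finset.mul_sum]
    refine Finset.sum_congr rfl fun b _ => ?_
    rw [Finset.mul_sum]
    refine Finset.sum_congr rfl fun c _ => by ring
  rw [h4]
  have h5 : |Z ω| ≤ ∑ c with N a c, |Y c ω| := Finset.abs_sum_le_sum_abs _ _
  have h6 : (Z ω) ^ 2 ≤ (∑ c with N a c, |Y c ω|) ^ 2 := by
    rw [← sq_abs]
    gcongr
  calc _ ≤ |Y a ω| * (2 * (-(t * Z ω)) ^ 2) := by gcongr
    _ = 2 * t ^ 2 * (|Y a ω| * (Z ω) ^ 2) := by ring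
    _ ≤ _ := by gcongr

theorem tikh_bound (t : ℝ)
    (h0 : ∀ a, ∫ ω, (Y a ω : ℂ) * cexpI (t * ∑ b with ¬ N a b, Y b ω) ∂μ = 0)
    (h1 : ∀ a b, ¬ N a b → ∫ ω, Y a ω * Y b ω ∂μ = 0)
    (h2 : ∀ a b,
      ∫ ω, ((Y a ω * Y b ω : ℝ) : ℂ) * cexpI (t * ∑ c with ¬ (N a c ∨ N b c), Y c ω) ∂μ =
      (∫ ω, ((Y a ω * Y b ω : ℝ) : ℂ) ∂μ) *
        ∫ ω, cexpI (t * ∑ c with ¬ (N a c ∨ N b c), Y c ω) ∂μ)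
    (hv : ∑ a, ∑ b, ∫ ω, Y a ω * Y b ω ∂μ = 1) :
    ‖(∫ ω, Complex.I * ((∑ c, Y c ω : ℝ) : ℂ) * cexpI (t * ∑ c, Y c ω) ∂μ) +
      t * ∫ ω, cexpI (t * ∑ c, Y c ω) ∂μ‖ ≤ 3 * t ^ 2 * tikhErr μ Y N := by
  set φ : ℂ := ∫ ω, cexpI (t * ∑ c, Y c ω) ∂μ with hφ
  set G : ι → ι → ℂ := fun a b => ∫ ω, ((Y a ω * Y b ω : ℝ) : ℂ) * cexpI (t * ∑ c, Y c ω) ∂μ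
    with hG
  set H : ι → ℂ := fun a => ∫ ω, (Y a ω : ℂ) * cexpI (t * ∑ c, Y c ω) ∂μ with hH
  set K : ι → ι → ℂ := fun a b => ∫ ω, ((Y a ω * Y b ω : ℝ) : ℂ) ∂μ with hK
  have e1 : ∫ ω, Complex.I * ((∑ c, Y c ω : ℝ) : ℂ) * cexpI (t * ∑ c, Y c ω) ∂μ =
      Complex.I * ∑ a, H a := by
    rw [hH, ← integral_finsetSum _ (fun _ _ => Integrable.of_finite), ← integral_const_mul]
    congr 1
    ext ω
    push_cast
    rw [← Finset.sum_mul]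
    ring
  have e2 : ∑ a, ∑ b with N a b, K a b = 1 := by
    have : ∀ a b, K a b = ((∫ ω, Y a ω * Y b ω ∂μ : ℝ) : ℂ) := fun a b => integral_ofReal
    rw [← Complex.ofReal_one, ← hv]
    push_cast
    refine Finset.sum_congr rfl fun a _ => ?_
    rw [Finset.sum_filter]
    refine Finset.sum_congr rfl fun b _ => ?_
    by_cases hab : N a b
    · simp [hab, this]
    · simp only [hab, if_false, h1 a b hab, Complex.ofReal_zero]
  have e3 : Complex.I * ∑ a, H a + t * φ =
      Complex.I * (∑ a, (H a - Complex.I * t * ∑ b with N a b, G a b)) -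
        t * ∑ a, ∑ b with N a b, (G a b - K a b * φ) := by
    simp only [Finset.sum_sub_distrib, ← Finset.mul_sum, ← Finset.sum_mul]
    rw [e2]
    linear_combination (∑ a, ∑ b with N a b, G a b) * (t : ℂ) * (Complex.I_mul_I)
  rw [e1, e3]
  have hT : ∑ a, ∑ b with N a b, (∑ c, if (N a c ∨ N b c) then
    ((∫ ω, |Y a ω| * |Y b ω| * |Y c ω| ∂μ) +
      (∫ ω, |Y a ω| * |Y b ω| ∂μ) * ∫ ω, |Y c ω| ∂μ) else 0) = tikhErr μ Y N := by
    unfold tikhErr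
    refine Finset.sum_congr rfl fun a _ => ?_
    rw [Finset.sum_filter]
    refine Finset.sum_congr rfl fun b _ => ?_
    by_cases hab : N a b <;> simp [hab]
  have p1 : ∀ a b c, 0 ≤ ∫ ω, |Y a ω| * |Y b ω| * |Y c ω| ∂μ :=
    fun a b c => integral_nonneg fun ω => by positivity
  have p2 : ∀ a b, 0 ≤ ∫ ω, |Y a ω| * |Y b ω| ∂μ :=
    fun a b => integral_nonneg fun ω => by positivity
  have p3 : ∀ a, 0 ≤ ∫ ω, |Y a ω| ∂μ :=
    fun a => integral_nonneg fun ω => by positivity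
  have q1 : ‖∑ a, (H a - Complex.I * t * ∑ b with N a b, G a b)‖ ≤
      2 * t ^ 2 * tikhErr μ Y N := by
    refine (norm_sum_le _ _).trans ?_
    rw [← hT, Finset.mul_sum]
    refine Finset.sum_le_sum fun a _ => (tikh_first μ Y N a t (h0 a)).trans ?_
    gcongr with b hb
    rw [Finset.sum_filter]
    refine Finset.sum_le_sum fun c _ => ?_
    by_cases hac : N a c
    · simp only [hac, true_or, if_true]
      nlinarith [p1 a b c, p2 a b, p3 c, mul_nonneg (p2 a b) (p3 c)]
    · by_cases hbc : N b c
      · simp only [hac, hbc, or_true, if_true, if_false]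
        nlinarith [p1 a b c, p2 a b, p3 c, mul_nonneg (p2 a b) (p3 c)]
      · simp [hac, hbc]
  have q2 : ‖∑ a, ∑ b with N a b, (G a b - K a b * φ)‖ ≤ |t| * tikhErr μ Y N := by
    refine (norm_sum_le _ _).trans ?_
    rw [← hT, Finset.mul_sum]
    refine Finset.sum_le_sum fun a _ => (norm_sum_le _ _).trans ?_
    rw [Finset.mul_sum]
    exact Finset.sum_le_sum fun b _ => tikh_delta μ Y N a b t (h2 a b)
  refine (norm_sub_le _ _).trans ?_
  rw [norm_mul, norm_mul, Complex.norm_I, one_mul, Complex.norm_real, Real.norm_eq_abs]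
  have : |t| * (|t| * tikhErr μ Y N) = t ^ 2 * tikhErr μ Y N := by
    rw [← mul_assoc, ← sq, sq_abs]
  have := mul_le_mul_of_nonneg_left q2 (abs_nonneg t)
  linarith

theorem tikhErr_nonneg : 0 ≤ tikhErr μ Y N := by
  unfold tikhErr
  refine Finset.sum_nonneg fun a _ => Finset.sum_nonneg fun b _ => Finset.sum_nonneg fun c _ => ?_
  split_ifs
  · exact add_nonneg (integral_nonneg fun ω => by positivity)
      (mul_nonneg (integral_nonneg fun ω => by positivity) (integral_nonneg fun ω => by positivity))
  · exact le_rfl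

theorem hasDerivAt_phi (W : Ω → ℝ) (t : ℝ) :
    HasDerivAt (fun t : ℝ => ∫ ω, cexpI (t * W ω) ∂μ)
      (∫ ω, Complex.I * (W ω : ℂ) * cexpI (t * W ω) ∂μ) t := by
  have := Fintype.ofFinite Ω
  simp only [integral_fintype Integrable.of_finite]
  refine HasDerivAt.fun_sum fun ω _ => ?_
  refine HasDerivAt.fun_const_smul _ ?_
  unfold cexpI
  have h1 : HasDerivAt (fun t : ℝ => Complex.I * ((t * W ω : ℝ) : ℂ)) (Complex.I * (W ω : ℂ)) t := by
    refine HasDerivAt.const_mul _ ?_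
    have : HasDerivAt (fun t : ℝ => t * W ω) (W ω) t := by
      simpa using (hasDerivAt_id t).mul_const (W ω)
    exact this.ofReal_comp
  have h2 := h1.cexp
  rw [mul_comm] at h2
  exact h2

theorem phi_close (W : Ω → ℝ) (T : ℝ) (hT : 0 ≤ T)
    (hb : ∀ t : ℝ, ‖(∫ ω, Complex.I * (W ω : ℂ) * cexpI (t * W ω) ∂μ) +
      t * ∫ ω, cexpI (t * W ω) ∂μ‖ ≤ 3 * t ^ 2 * T) (t : ℝ) :
    ‖(∫ ω, cexpI (t * W ω) ∂μ) - Complex.exp (- (t : ℂ) ^ 2 / 2)‖ ≤ 3 * |t| ^ 3 * T := by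
  set φ : ℝ → ℂ := fun t => ∫ ω, cexpI (t * W ω) ∂μ with hφ
  set g : ℝ → ℂ := fun t => φ t * Complex.exp ((t : ℂ) ^ 2 / 2) with hg
  have hexp : ∀ s : ℝ, HasDerivAt (fun s : ℝ => Complex.exp ((s : ℂ) ^ 2 / 2))
      (Complex.exp ((s : ℂ) ^ 2 / 2) * s) s := by
    intro s
    have h1 : HasDerivAt (fun s : ℝ => ((s ^ 2 / 2 : ℝ) : ℂ)) ((s : ℝ) : ℂ) s := by
      have : HasDerivAt (fun s : ℝ => s ^ 2 / 2) s s := by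
        have := (hasDerivAt_pow 2 s).div_const 2
        simpa using this
      exact this.ofReal_comp
    have h2 := h1.cexp
    push_cast at h2
    exact h2
  have hd : ∀ s : ℝ, HasDerivAt g (((∫ ω, Complex.I * (W ω : ℂ) * cexpI (s * W ω) ∂μ) +
      s * φ s) * Complex.exp ((s : ℂ) ^ 2 / 2)) s := by
    intro s
    have := (hasDerivAt_phi μ W s).mul (hexp s)
    convert! this using 1
    simp only [hφ]
    ring
  have hnorm : ∀ s : ℝ, ‖Complex.exp ((s : ℂ) ^ 2 / 2)‖ = Real.exp (s ^ 2 / 2) := by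
    intro s
    rw [Complex.norm_exp]
    congr 1
    have : ((s : ℂ) ^ 2 / 2) = ((s ^ 2 / 2 : ℝ) : ℂ) := by push_cast; ring
    rw [this, Complex.ofReal_re]
  have key : ‖g t - g 0‖ ≤ (3 * t ^ 2 * T * Real.exp (t ^ 2 / 2)) * ‖t - 0‖ := by
    refine Convex.norm_image_sub_le_of_norm_hasDerivWithin_le (s := Set.Icc (-|t|) |t|)
      (fun s _ => (hd s).hasDerivWithinAt) ?_ (convex_Icc _ _) ?_ ?_
    · intro s hs
      have hs' : s ^ 2 ≤ t ^ 2 := sq_le_sq.mpr (abs_le.mpr ⟨hs.1, hs.2⟩)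
      rw [norm_mul, hnorm]
      refine mul_le_mul ((hb s).trans ?_) (by gcongr) (by positivity) (by positivity)
      gcongr
    · simp
    · exact ⟨neg_abs_le t, le_abs_self t⟩
  have hg0 : g 0 = 1 := by simp [hg, hφ, cexpI]
  have hE : Complex.exp (- (t : ℂ) ^ 2 / 2) * Complex.exp ((t : ℂ) ^ 2 / 2) = 1 := by
    rw [← Complex.exp_add]
    ring_nf
    simp
  have e4 : φ t - Complex.exp (- (t : ℂ) ^ 2 / 2) =
      Complex.exp (- (t : ℂ) ^ 2 / 2) * (g t - g 0) := by
    rw [hg0]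
    simp only [hg]
    linear_combination (-(φ t)) * hE
  have hn2 : ‖Complex.exp (- (t : ℂ) ^ 2 / 2)‖ * Real.exp (t ^ 2 / 2) = 1 := by
    rw [← hnorm, ← norm_mul, hE, norm_one]
  change ‖φ t - _‖ ≤ _
  rw [e4, norm_mul]
  calc _ ≤ ‖Complex.exp (- (t : ℂ) ^ 2 / 2)‖ *
        ((3 * t ^ 2 * T * Real.exp (t ^ 2 / 2)) * ‖t - 0‖) := by gcongr
    _ = (‖Complex.exp (- (t : ℂ) ^ 2 / 2)‖ * Real.exp (t ^ 2 / 2)) * (3 * t ^ 2 * T * |t|) := by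
        rw [sub_zero, Real.norm_eq_abs]; ring
    _ = 3 * |t| ^ 3 * T := by
        rw [hn2, ← sq_abs]; ring

end Tikhomirov

/-! ### Part 2: products of independent Bernoulli variables -/

instance bern_isProb (p : ℝ≥0) (h : p ≤ 1) : IsProbabilityMeasure (bern p h) := by
  unfold bern
  infer_instance

instance prodBern_isProb (n : ℕ) (p : ℝ≥0) (h : p ≤ 1) :
    IsProbabilityMeasure (prodBern n p h) := by
  unfold prodBern
  infer_instance

theorem integral_bern (p : ℝ≥0) (h : p ≤ 1) (f : Bool → ℝ) :
    ∫ b, f b ∂(bern p h) = (p : ℝ) * f true + (1 - p) * f false := by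
  unfold bern
  rw [PMF.integral_eq_sum]
  simp [PMF.bernoulli_apply, NNReal.coe_sub h]

/-- Factorisation of expectations of functions of disjoint sets of coordinates. -/
theorem integral_mul_of_dependsOn {n : ℕ} (p : ℝ≥0) (h : p ≤ 1) (S : Finset (Fin n))
    (F G : (Fin n → Bool) → ℂ)
    (hF : ∀ ω ω' : Fin n → Bool, (∀ i ∈ S, ω i = ω' i) → F ω = F ω')
    (hG : ∀ ω ω' : Fin n → Bool, (∀ i ∉ S, ω i = ω' i) → G ω = G ω') :
    ∫ ω, F ω * G ω ∂(prodBern n p h) =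
      (∫ ω, F ω ∂(prodBern n p h)) * ∫ ω, G ω ∂(prodBern n p h) := by
  have hi : iIndepFun (fun (i : Fin n) (ω : Fin n → Bool) => ω i) (prodBern n p h) := by
    unfold prodBern
    exact iIndepFun_pi (X := fun _ => id) (fun _ => aemeasurable_id)
  have hI := hi.indepFun_finset S Sᶜ disjoint_compl_right (fun i => measurable_pi_apply i)
  let F' : (S → Bool) → ℂ := fun g => F (fun i => if hi : i ∈ S then g ⟨i, hi⟩ else false)
  let G' : ((Sᶜ : Finset (Fin n)) → Bool) → ℂ :=
    fun g => G (fun i => if hi : i ∈ Sᶜ then g ⟨i, hi⟩ else false)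
  have hF' : ∀ ω, F ω = F' (fun i : S => ω i) := by
    intro ω
    refine hF _ _ fun i hi => ?_
    simp [hi]
  have hG' : ∀ ω, G ω = G' (fun i : (Sᶜ : Finset (Fin n)) => ω i) := by
    intro ω
    refine hG _ _ fun i hi => ?_
    simp [hi]
  simp_rw [hF', hG']
  exact hI.integral_fun_comp_mul_comp (f := F') (g := G')
    (Measurable.of_discrete.aemeasurable) (Measurable.of_discrete.aemeasurable)
    (Measurable.of_discrete.aestronglyMeasurable) (Measurable.of_discrete.aestronglyMeasurable)

/-- The indicator that all elements of `S` are selected. -/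
noncomputable def indS {n : ℕ} (S : Finset (Fin n)) (ω : Fin n → Bool) : ℝ :=
  if ∀ i ∈ S, ω i = true then 1 else 0

theorem indS_nonneg {n : ℕ} (S : Finset (Fin n)) (ω : Fin n → Bool) : 0 ≤ indS S ω := by
  unfold indS; split_ifs <;> norm_num

theorem indS_le_one {n : ℕ} (S : Finset (Fin n)) (ω : Fin n → Bool) : indS S ω ≤ 1 := by
  unfold indS; split_ifs <;> norm_num

theorem indS_mul {n : ℕ} (S T : Finset (Fin n)) (ω : Fin n → Bool) :
    indS S ω * indS T ω = indS (S ∪ T) ω := by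
  unfold indS
  by_cases h1 : ∀ i ∈ S, ω i = true <;> by_cases h2 : ∀ i ∈ T, ω i = true
  · rw [if_pos h1, if_pos h2, if_pos, mul_one]
    intro i hi
    rcases Finset.mem_union.mp hi with hi | hi
    · exact h1 i hi
    · exact h2 i hi
  all_goals
    rw [if_neg (c := ∀ i ∈ S ∪ T, ω i = true)]
    · simp [h1, h2]
    · intro h
      first
        | exact h1 fun i hi => h i (Finset.mem_union_left _ hi)
        | exact h2 fun i hi => h i (Finset.mem_union_right _ hi)

theorem integral_indS {n : ℕ} (p : ℝ≥0) (h : p ≤ 1) (S : Finset (Fin n)) :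
    ∫ ω, indS S ω ∂(prodBern n p h) = (p : ℝ) ^ S.card := by
  have e : ∀ ω : Fin n → Bool, indS S ω =
      ∏ i, (fun (i : Fin n) (b : Bool) => if i ∈ S then (if b = true then (1 : ℝ) else 0) else 1)
        i (ω i) := by
    intro ω
    unfold indS
    split_ifs with hS
    · symm
      refine Finset.prod_eq_one fun i _ => ?_
      by_cases hi : i ∈ S
      · simp [hi, hS i hi]
      · simp [hi]
    · push Not at hS
      obtain ⟨i, hi, hw⟩ := hS
      symm
      refine Finset.prod_eq_zero (Finset.mem_univ i) ?_
      simp [hi, hw]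
  rw [integral_congr_ae (Filter.Eventually.of_forall e)]
  unfold prodBern
  refine (integral_fintype_prod_eq_prod (𝕜 := ℝ) (E := fun _ : Fin n => Bool)
    (fun (i : Fin n) (b : Bool) => if i ∈ S then (if b = true then (1 : ℝ) else 0) else 1)
    (μ := fun _ => bern p h)).trans ?_
  simp_rw [integral_bern]
  have : ∀ i ∈ (Finset.univ : Finset (Fin n)),
      ((p : ℝ) * (if i ∈ S then (if true = true then (1 : ℝ) else 0) else 1) +
      (1 - p) * (if i ∈ S then (if false = true then (1 : ℝ) else 0) else 1)) =
      if i ∈ S then (p : ℝ) else 1 := by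
    intro i _
    by_cases hi : i ∈ S <;> simp [hi]
  refine (Finset.prod_congr rfl this).trans ?_
  rw [Finset.prod_ite_mem]
  simp

/-- Centred indicator. -/
noncomputable def cenS {n : ℕ} (p : ℝ≥0) (S : Finset (Fin n)) (ω : Fin n → Bool) : ℝ :=
  indS S ω - (p : ℝ) ^ S.card

theorem cenS_congr {n : ℕ} (p : ℝ≥0) (S : Finset (Fin n)) (ω ω' : Fin n → Bool)
    (h : ∀ i ∈ S, ω i = ω' i) : cenS p S ω = cenS p S ω' := by
  unfold cenS indS
  congr 1
  refine if_congr ?_ rfl rfl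
  refine forall_congr' fun i => forall_congr' fun hi => ?_
  rw [h i hi]

section

variable {n : ℕ} (p : ℝ≥0) (h : p ≤ 1)

theorem integral_cenS (S : Finset (Fin n)) : ∫ ω, cenS p S ω ∂(prodBern n p h) = 0 := by
  unfold cenS
  rw [integral_sub Integrable.of_finite Integrable.of_finite, integral_indS]
  simp

theorem integral_cenS_mul (S T : Finset (Fin n)) :
    ∫ ω, cenS p S ω * cenS p T ω ∂(prodBern n p h) =
      (p : ℝ) ^ (S ∪ T).card - (p : ℝ) ^ (S.card + T.card) := by
  have e : ∀ ω, cenS p S ω * cenS p T ω =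
      indS (S ∪ T) ω - (p : ℝ) ^ S.card * indS T ω - cenS p S ω * (p : ℝ) ^ T.card := by
    intro ω
    rw [← indS_mul]
    unfold cenS
    ring
  simp_rw [e]
  rw [integral_sub Integrable.of_finite Integrable.of_finite,
    integral_sub Integrable.of_finite Integrable.of_finite, integral_const_mul,
    integral_mul_const, integral_cenS, integral_indS, integral_indS, pow_add]
  ring

theorem abs_cenS_le_one (S : Finset (Fin n)) (ω : Fin n → Bool) (h : p ≤ 1) :
    |cenS p S ω| ≤ 1 := by
  have h1 : (p : ℝ) ≤ 1 := by exact_mod_cast h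
  have h2 : (p : ℝ) ^ S.card ≤ 1 := pow_le_one₀ p.coe_nonneg h1
  have h3 : 0 ≤ (p : ℝ) ^ S.card := pow_nonneg p.coe_nonneg _
  have := indS_nonneg S ω
  have := indS_le_one S ω
  unfold cenS
  rw [abs_le]
  constructor <;> linarith

theorem abs_cenS_le (S : Finset (Fin n)) (ω : Fin n → Bool) :
    |cenS p S ω| ≤ indS S ω + (p : ℝ) ^ S.card := by
  have h3 : 0 ≤ (p : ℝ) ^ S.card := pow_nonneg p.coe_nonneg _
  have := indS_nonneg S ω
  unfold cenS
  rw [abs_le]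
  constructor <;> linarith

theorem integral_abs_cenS_le (S : Finset (Fin n)) :
    ∫ ω, |cenS p S ω| ∂(prodBern n p h) ≤ 2 * S.card * (1 - p) := by
  have h1 : (p : ℝ) ≤ 1 := by exact_mod_cast h
  have h2 : (p : ℝ) ^ S.card ≤ 1 := pow_le_one₀ p.coe_nonneg h1
  have hB : 1 - (p : ℝ) ^ S.card ≤ S.card * (1 - p) := by
    have := one_add_mul_le_pow (a := (p : ℝ) - 1) (by linarith [p.coe_nonneg]) S.card
    rw [add_sub_cancel] at this
    linarith
  calc ∫ ω, |cenS p S ω| ∂(prodBern n p h)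
      ≤ ∫ ω, ((1 - indS S ω) + (1 - (p : ℝ) ^ S.card)) ∂(prodBern n p h) := by
        refine integral_mono Integrable.of_finite Integrable.of_finite fun ω => ?_
        have := indS_le_one S ω
        simp only [cenS]
        rw [abs_le]
        constructor <;> linarith
    _ = 2 * (1 - (p : ℝ) ^ S.card) := by
        rw [integral_add Integrable.of_finite Integrable.of_finite,
          integral_sub Integrable.of_finite Integrable.of_finite, integral_indS]
        simp
        ring
    _ ≤ _ := by linarith

theorem integral_abs_cenS_le' (S : Finset (Fin n)) :
    ∫ ω, |cenS p S ω| ∂(prodBern n p h) ≤ 2 * (p : ℝ) ^ S.card := by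
  calc _ ≤ ∫ ω, (indS S ω + (p : ℝ) ^ S.card) ∂(prodBern n p h) :=
        integral_mono Integrable.of_finite Integrable.of_finite (abs_cenS_le p S)
    _ = _ := by
        rw [integral_add Integrable.of_finite Integrable.of_finite, integral_indS]
        simp
        ring

theorem pow_card_union_le (S T : Finset (Fin n)) (h : p ≤ 1) :
    (p : ℝ) ^ S.card * (p : ℝ) ^ T.card ≤ (p : ℝ) ^ (S ∪ T).card := by
  rw [← pow_add]
  exact pow_le_pow_of_le_one p.coe_nonneg (by exact_mod_cast h) (Finset.card_union_le _ _)

theorem integral_ind_mul_abs_le (R S : Finset (Fin n)) (f : (Fin n → Bool) → ℝ)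
    (hf : ∀ ω, 0 ≤ f ω) (K : ℝ)
    (hfR : ∀ U : Finset (Fin n), ∫ ω, indS U ω * f ω ∂(prodBern n p h) ≤ K * (p : ℝ) ^ (U ∪ R).card) :
    ∀ U : Finset (Fin n), ∫ ω, indS U ω * (|cenS p S ω| * f ω) ∂(prodBern n p h) ≤
      2 * K * (p : ℝ) ^ (U ∪ (S ∪ R)).card := by
  intro U
  have hp1 : (p : ℝ) ≤ 1 := by exact_mod_cast h
  have hK : 0 ≤ K * (p : ℝ) ^ (U ∪ R).card :=
    (integral_nonneg fun ω => mul_nonneg (indS_nonneg _ _) (hf ω)).trans (hfR U)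
  calc _ ≤ ∫ ω, (indS (U ∪ S) ω * f ω + (p : ℝ) ^ S.card * (indS U ω * f ω)) ∂(prodBern n p h) := by
        refine integral_mono Integrable.of_finite Integrable.of_finite fun ω => ?_
        simp only
        rw [← indS_mul]
        have := abs_cenS_le p S ω
        have h5 := mul_nonneg (indS_nonneg U ω) (hf ω)
        have := mul_le_mul_of_nonneg_left this h5
        linarith
    _ ≤ K * (p : ℝ) ^ (U ∪ S ∪ R).card + (p : ℝ) ^ S.card * (K * (p : ℝ) ^ (U ∪ R).card) := by
        rw [integral_add Integrable.of_finite Integrable.of_finite, integral_const_mul]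
        refine add_le_add (hfR _) (mul_le_mul_of_nonneg_left (hfR _) (by positivity))
    _ ≤ _ := by
        have e : U ∪ S ∪ R = U ∪ (S ∪ R) := Finset.union_assoc _ _ _
        have e2 : S ∪ (U ∪ R) = U ∪ (S ∪ R) := by
          rw [← Finset.union_assoc, Finset.union_comm S U, Finset.union_assoc]
        have := pow_card_union_le p S (U ∪ R) h
        rw [e2] at this
        rw [e]
        by_cases hp0 : (p : ℝ) = 0
        · by_cases hUR : (U ∪ R).card = 0
          · have hK' : 0 ≤ K := by simpa [hUR] using hK
            have := mul_le_mul_of_nonneg_left this hK'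
            nlinarith
          · have hz : (p : ℝ) ^ (U ∪ R).card = 0 := by rw [hp0]; exact zero_pow hUR
            have hle : (U ∪ R).card ≤ (U ∪ (S ∪ R)).card := by
              rw [← e2]; exact Finset.card_le_card Finset.subset_union_right
            have hz' : (p : ℝ) ^ (U ∪ (S ∪ R)).card = 0 := by
              rw [hp0]; exact zero_pow (by omega)
            rw [hz, hz']
            simp
        · have hpp : 0 < (p : ℝ) := lt_of_le_of_ne p.coe_nonneg (Ne.symm hp0)
          have hK' : 0 ≤ K := nonneg_of_mul_nonneg_left hK (by positivity)
          have := mul_le_mul_of_nonneg_left this hK'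
          nlinarith

theorem integral_abs3 (S T R : Finset (Fin n)) :
    ∫ ω, |cenS p S ω| * |cenS p T ω| * |cenS p R ω| ∂(prodBern n p h) ≤
      8 * (p : ℝ) ^ (S ∪ T ∪ R).card := by
  have h0 : ∀ U : Finset (Fin n), ∫ ω, indS U ω * (1 : ℝ) ∂(prodBern n p h) ≤
      1 * (p : ℝ) ^ (U ∪ ∅).card := by
    intro U
    simp [integral_indS]
  have h1 := integral_ind_mul_abs_le p h _ R _ (fun _ => zero_le_one) _ h0
  have h2 := integral_ind_mul_abs_le p h _ T _ (fun _ => by positivity) _ h1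
  have h3 := integral_ind_mul_abs_le p h _ S _ (fun _ => by positivity) _ h2 ∅
  have e : (∅ : Finset (Fin n)) ∪ (S ∪ (T ∪ (R ∪ ∅))) = S ∪ T ∪ R := by
    simp [Finset.union_assoc]
  rw [e] at h3
  calc _ = ∫ ω, indS ∅ ω * (|cenS p S ω| * (|cenS p T ω| * (|cenS p R ω| * 1)))
        ∂(prodBern n p h) := by
        congr 1
        ext ω
        simp [indS, mul_assoc]
    _ ≤ _ := h3
    _ = _ := by norm_num

theorem integral_abs2 (S T : Finset (Fin n)) :
    ∫ ω, |cenS p S ω| * |cenS p T ω| ∂(prodBern n p h) ≤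
      4 * (p : ℝ) ^ (S ∪ T).card := by
  have h0 : ∀ U : Finset (Fin n), ∫ ω, indS U ω * (1 : ℝ) ∂(prodBern n p h) ≤
      1 * (p : ℝ) ^ (U ∪ ∅).card := by
    intro U
    simp [integral_indS]
  have h2 := integral_ind_mul_abs_le p h _ T _ (fun _ => zero_le_one) _ h0
  have h3 := integral_ind_mul_abs_le p h _ S _ (fun _ => by positivity) _ h2 ∅
  have e : (∅ : Finset (Fin n)) ∪ (S ∪ (T ∪ ∅)) = S ∪ T := by
    simp
  rw [e] at h3
  calc _ = ∫ ω, indS ∅ ω * (|cenS p S ω| * (|cenS p T ω| * 1))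
        ∂(prodBern n p h) := by
        congr 1
        ext ω
        simp [indS]
    _ ≤ _ := h3
    _ = _ := by norm_num

/-- The constant in the third moment bound. -/
noncomputable def cM (m : ℕ) : ℝ := 32 + 4 * m * 8 ^ m

theorem third_bound (m : ℕ) (S T R : Finset (Fin n)) (hS : S.card ≤ m) (hT : T.card ≤ m)
    (hR : R.card ≤ m) :
    (∫ ω, |cenS p S ω| * |cenS p T ω| * |cenS p R ω| ∂(prodBern n p h)) +
      (∫ ω, |cenS p S ω| * |cenS p T ω| ∂(prodBern n p h)) *
        ∫ ω, |cenS p R ω| ∂(prodBern n p h) ≤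
      cM m * (1 - p) * (p : ℝ) ^ (S ∪ T ∪ R).card := by
  have hp1 : (p : ℝ) ≤ 1 := by exact_mod_cast h
  have hp0 : 0 ≤ (p : ℝ) := p.coe_nonneg
  set P := (p : ℝ) ^ (S ∪ T ∪ R).card with hP
  have hP0 : 0 ≤ P := by positivity
  have hq : 0 ≤ 1 - (p : ℝ) := by linarith
  by_cases hp : (p : ℝ) ≤ 1 / 2
  · have a1 := integral_abs3 p h S T R
    have a2 := integral_abs2 p h S T
    have a3 := integral_abs_cenS_le' p h R
    have a4 := pow_card_union_le p (S ∪ T) R h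
    have a5 := mul_le_mul a2 a3 (integral_nonneg fun ω => abs_nonneg _) (by positivity)
    have a6 : 16 * P ≤ 32 * (1 - p) * P := by nlinarith
    have a7 : 0 ≤ 4 * m * 8 ^ m * (1 - p) * P := by positivity
    unfold cM
    nlinarith
  · push Not at hp
    have b0 : ∫ ω, |cenS p R ω| ∂(prodBern n p h) ≤ 2 * m * (1 - p) := by
      refine (integral_abs_cenS_le p h R).trans ?_
      gcongr
    have b1 : ∫ ω, |cenS p S ω| * |cenS p T ω| * |cenS p R ω| ∂(prodBern n p h) ≤
        ∫ ω, |cenS p R ω| ∂(prodBern n p h) := by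
      refine integral_mono Integrable.of_finite Integrable.of_finite fun ω => ?_
      simp only
      have := abs_cenS_le_one p S ω h
      have := abs_cenS_le_one p T ω h
      have : |cenS p S ω| * |cenS p T ω| ≤ 1 := mul_le_one₀ (by assumption) (abs_nonneg _) this
      exact mul_le_of_le_one_left (abs_nonneg _) this
    have b2 : ∫ ω, |cenS p S ω| * |cenS p T ω| ∂(prodBern n p h) ≤ 1 := by
      calc _ ≤ ∫ ω, (1 : ℝ) ∂(prodBern n p h) := by
            refine integral_mono Integrable.of_finite Integrable.of_finite fun ω => ?_
            exact mul_le_one₀ (abs_cenS_le_one p S ω h) (abs_nonneg _) (abs_cenS_le_one p T ω h)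
        _ = 1 := by simp
    have b3 : (∫ ω, |cenS p S ω| * |cenS p T ω| ∂(prodBern n p h)) *
        ∫ ω, |cenS p R ω| ∂(prodBern n p h) ≤ ∫ ω, |cenS p R ω| ∂(prodBern n p h) :=
      mul_le_of_le_one_left (integral_nonneg fun ω => abs_nonneg _) b2
    have hcard : (S ∪ T ∪ R).card ≤ 3 * m := by
      have := Finset.card_union_le (S ∪ T) R
      have := Finset.card_union_le S T
      omega
    have b4 : (1 / 2 : ℝ) ^ (3 * m) ≤ P :=
      calc (1 / 2 : ℝ) ^ (3 * m) ≤ (p : ℝ) ^ (3 * m) := by gcongr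
        _ ≤ P := pow_le_pow_of_le_one hp0 hp1 hcard
    have b5 : 1 ≤ 8 ^ m * P := by
      have : (8 : ℝ) ^ m * (1 / 2 : ℝ) ^ (3 * m) = 1 := by
        rw [pow_mul, ← mul_pow]; norm_num
      rw [← this]
      gcongr
    have b6 : 4 * m * (1 - (p : ℝ)) ≤ 4 * m * (1 - (p : ℝ)) * (8 ^ m * P) :=
      le_mul_of_one_le_right (by positivity) b5
    have b7 : 0 ≤ 32 * (1 - (p : ℝ)) * P := by positivity
    unfold cM
    nlinarith

end

/-! ### Part 3: a quantitative CLT for sums of indicators -/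

section CLT

variable {n : ℕ} (p : ℝ≥0) (h : p ≤ 1) {ι : Type*} [Fintype ι] (S : ι → Finset (Fin n))

/-- Sum over connected triples. -/
noncomputable def triSum : ℝ :=
  ∑ a, ∑ b, ∑ c, if ¬ Disjoint (S a) (S b) ∧ (¬ Disjoint (S a) (S c) ∨ ¬ Disjoint (S b) (S c)) then
    (p : ℝ) ^ (S a ∪ S b ∪ S c).card else 0

theorem expect_sum : ∫ ω, ∑ a, indS (S a) ω ∂(prodBern n p h) = ∑ a, (p : ℝ) ^ (S a).card := by
  rw [integral_finsetSum _ (fun _ _ => Integrable.of_finite)]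
  exact Finset.sum_congr rfl fun a _ => integral_indS p h (S a)

theorem sum_sub_expect (ω : Fin n → Bool) :
    ∑ a, indS (S a) ω - ∫ ω, ∑ a, indS (S a) ω ∂(prodBern n p h) = ∑ a, cenS p (S a) ω := by
  rw [expect_sum, ← Finset.sum_sub_distrib]
  rfl

theorem variance_sum : variance (fun ω => ∑ a, indS (S a) ω) (prodBern n p h) =
    ∑ a, ∑ b, ((p : ℝ) ^ (S a ∪ S b).card - (p : ℝ) ^ ((S a).card + (S b).card)) := by
  rw [variance_eq_integral Measurable.of_discrete.aemeasurable]
  simp_rw [sum_sub_expect, sq, Finset.sum_mul_sum]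
  rw [integral_finsetSum _ (fun _ _ => Integrable.of_finite)]
  refine Finset.sum_congr rfl fun a _ => ?_
  rw [integral_finsetSum _ (fun _ _ => Integrable.of_finite)]
  exact Finset.sum_congr rfl fun b _ => integral_cenS_mul p h _ _

theorem clt_bound (m : ℕ) (hS : ∀ a, (S a).card ≤ m) (σ : ℝ) (hσ : 0 < σ)
    (hv : variance (fun ω => ∑ a, indS (S a) ω) (prodBern n p h) = σ ^ 2) (t : ℝ) :
    ‖(∫ ω, cexpI (t * ((∑ a, indS (S a) ω -
        ∫ ω', ∑ a, indS (S a) ω' ∂(prodBern n p h)) / σ)) ∂(prodBern n p h)) -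
      Complex.exp (- (t : ℂ) ^ 2 / 2)‖ ≤
    3 * |t| ^ 3 * (cM m * (1 - p) * triSum p S / σ ^ 3) := by
  obtain ⟨N, hN⟩ : ∃ N : ι → ι → Prop, N = fun a b => ¬ Disjoint (S a) (S b) := ⟨_, rfl⟩
  set Y : ι → (Fin n → Bool) → ℝ := fun a ω => cenS p (S a) ω / σ with hY
  have hYc : ∀ a ω ω', (∀ i ∈ S a, ω i = ω' i) → Y a ω = Y a ω' := by
    intro a ω ω' hh
    simp only [hY, cenS_congr p (S a) ω ω' hh]
  have hYY : ∀ a b, ∫ ω, Y a ω * Y b ω ∂(prodBern n p h) =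
      ((p : ℝ) ^ (S a ∪ S b).card - (p : ℝ) ^ ((S a).card + (S b).card)) / σ ^ 2 := by
    intro a b
    rw [← integral_cenS_mul p h, ← integral_div]
    congr 1
    ext ω
    simp only [hY]
    field_simp
  have hW : ∀ ω, (∑ a, indS (S a) ω -
        ∫ ω', ∑ a, indS (S a) ω' ∂(prodBern n p h)) / σ = ∑ a, Y a ω := by
    intro ω
    rw [sum_sub_expect, Finset.sum_div]
  simp_rw [hW]
  have hE : tikhErr (prodBern n p h) Y N ≤ cM m * (1 - p) * triSum p S / σ ^ 3 := by
    unfold tikhErr triSum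
    rw [Finset.mul_sum, Finset.sum_div]
    refine Finset.sum_le_sum fun a _ => ?_
    rw [Finset.mul_sum, Finset.sum_div]
    refine Finset.sum_le_sum fun b _ => ?_
    rw [Finset.mul_sum, Finset.sum_div]
    refine Finset.sum_le_sum fun c _ => ?_
    by_cases hc : N a b ∧ (N a c ∨ N b c)
    · have hc' : ¬ Disjoint (S a) (S b) ∧ (¬ Disjoint (S a) (S c) ∨ ¬ Disjoint (S b) (S c)) := by
        rw [hN] at hc; exact hc
      rw [if_pos hc, if_pos hc']
      have := third_bound p h m (S a) (S b) (S c) (hS a) (hS b) (hS c)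
      rw [le_div_iff₀ (by positivity)]
      refine le_trans (le_of_eq ?_) this
      simp only [hY, abs_div, abs_of_pos hσ]
      have e1 : ∀ ω, |cenS p (S a) ω| / σ * (|cenS p (S b) ω| / σ) * (|cenS p (S c) ω| / σ) =
          (|cenS p (S a) ω| * |cenS p (S b) ω| * |cenS p (S c) ω|) / σ ^ 3 := by
        intro ω; field_simp
      have e2 : ∀ ω, |cenS p (S a) ω| / σ * (|cenS p (S b) ω| / σ) =
          (|cenS p (S a) ω| * |cenS p (S b) ω|) / σ ^ 2 := by
        intro ω; field_simp
      simp_rw [e1, e2, integral_div]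
      field_simp
    · have hc' : ¬ (¬ Disjoint (S a) (S b) ∧
        (¬ Disjoint (S a) (S c) ∨ ¬ Disjoint (S b) (S c))) := by
        rw [hN] at hc; exact hc
      rw [if_neg hc, if_neg hc']
      simp
  refine (phi_close (prodBern n p h) (fun ω => ∑ a, Y a ω) _ (tikhErr_nonneg _ Y N) ?_ t).trans
    (by gcongr)
  intro t
  refine tikh_bound (prodBern n p h) Y N t ?_ ?_ ?_ ?_
  · intro a
    rw [integral_mul_of_dependsOn p h (S a) (fun ω => (Y a ω : ℂ))
      (fun ω => cexpI (t * ∑ b with ¬ N a b, Y b ω))]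
    · have : ∫ ω, (Y a ω : ℂ) ∂(prodBern n p h) = ((∫ ω, Y a ω ∂(prodBern n p h) : ℝ) : ℂ) :=
        integral_ofReal
      rw [this]
      simp only [hY]
      rw [integral_div, integral_cenS]
      simp
    · intro ω ω' hh
      simp only [hYc a ω ω' hh]
    · intro ω ω' hh
      congr 2
      refine Finset.sum_congr rfl fun b hb => hYc b ω ω' fun i hi => hh i ?_
      simp only [hN, Finset.mem_filter, Finset.mem_univ, true_and, not_not] at hb
      exact Finset.disjoint_right.mp hb hi
  · intro a b hab
    simp only [hN, not_not] at hab
    rw [hYY, Finset.card_union_of_disjoint hab]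
    simp
  · intro a b
    refine integral_mul_of_dependsOn p h (S a ∪ S b) (fun ω => ((Y a ω * Y b ω : ℝ) : ℂ))
      (fun ω => cexpI (t * ∑ c with ¬ (N a c ∨ N b c), Y c ω)) ?_ ?_
    · intro ω ω' hh
      rw [hYc a ω ω' fun i hi => hh i (Finset.mem_union_left _ hi),
        hYc b ω ω' fun i hi => hh i (Finset.mem_union_right _ hi)]
    · intro ω ω' hh
      congr 2
      refine Finset.sum_congr rfl fun c hc => hYc c ω ω' fun i hi => hh i ?_
      simp only [hN, Finset.mem_filter, Finset.mem_univ, true_and, not_or, not_not] at hc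
      rw [Finset.mem_union, not_or]
      exact ⟨Finset.disjoint_right.mp hc.1 hi, Finset.disjoint_right.mp hc.2 hi⟩
  · simp_rw [hYY]
    simp_rw [← Finset.sum_div]
    rw [← variance_sum p h, hv]
    field_simp

end CLT

section LinAlg
set_option linter.unusedSectionVars false
variable {α β : Type*} [Fintype α] [Fintype β]

/-- rational columns -/
def qcol (B : Matrix α β ℤ) (j : β) : α → ℚ := fun i => (B i j : ℚ)

theorem qcol_sum (B : Matrix α β ℤ) (x : β → ℤ) (h : B.mulVec x = 0) :
    ∑ j, (x j : ℚ) • qcol B j = 0 := by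
  funext i
  have := congrFun h i
  simp only [Matrix.mulVec, dotProduct, Pi.zero_apply] at this
  simp only [Finset.sum_apply, Pi.smul_apply, qcol, smul_eq_mul, Pi.zero_apply]
  have h2 : ((∑ j, B i j * x j : ℤ) : ℚ) = 0 := by rw [this]; simp
  push_cast at h2
  rw [← h2]
  exact Finset.sum_congr rfl fun j _ => mul_comm _ _

theorem rkZ_colSub_eq (B : Matrix α β ℤ) (T : Finset β) :
    rkZ (colSub B T) = Module.finrank ℚ (Submodule.span ℚ (qcol B '' (T : Set β))) := by
  unfold rkZ
  rw [Matrix.rank_eq_finrank_span_cols]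
  have : Set.range ((colSub B T).map (Int.cast : ℤ → ℚ)).col = qcol B '' (T : Set β) := by
    ext v; constructor
    · rintro ⟨j, rfl⟩; exact ⟨j.1, j.2, rfl⟩
    · rintro ⟨j, hj, rfl⟩; exact ⟨⟨j, hj⟩, rfl⟩
  rw [this]

theorem rkZ_eq (B : Matrix α β ℤ) :
    rkZ B = Module.finrank ℚ (Submodule.span ℚ (qcol B '' (Set.univ : Set β))) := by
  unfold rkZ
  rw [Matrix.rank_eq_finrank_span_cols]
  have : Set.range (B.map (Int.cast : ℤ → ℚ)).col = qcol B '' (Set.univ : Set β) := by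
    ext v; constructor
    · rintro ⟨j, rfl⟩; exact ⟨j, trivial, rfl⟩
    · rintro ⟨j, hj, rfl⟩; exact ⟨j, rfl⟩
  rw [this]

theorem finrank_span_eq_card_aux (v : β → α → ℚ) (J : Finset β) (T : Set β) (hJT : (J : Set β) ⊆ T)
    (hs : v '' T ⊆ Submodule.span ℚ (v '' (J : Set β))) (hl : LinearIndepOn ℚ v (J : Set β)) :
    Module.finrank ℚ (Submodule.span ℚ (v '' T)) = J.card := by
  have e : Submodule.span ℚ (v '' T) = Submodule.span ℚ (v '' (J : Set β)) :=
    le_antisymm (Submodule.span_le.2 hs) (Submodule.span_mono (Set.image_mono hJT))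
  rw [e]
  rw [finrank_span_set_eq_card hl.id_image]
  rw [Set.toFinset_card, Set.card_image_of_inj_on (s := (J : Set β)) (fun a ha b hb h => hl.injOn ha hb h)]
  simp

theorem exists_basis_split (B : Matrix α β ℤ) (Q : Finset β) :
    ∃ J₀ J₁ : Finset β, J₀ ⊆ Qᶜ ∧ J₁ ⊆ Q ∧ J₀.card = rkZ (colSub B Qᶜ) ∧ J₁.card = rQ B Q ∧
      J₀.card + J₁.card = rkZ B ∧
      (∀ x : β → ℤ, B.mulVec x = 0 → (∀ j ∈ Q \ J₁, x j = 0) → ∀ j ∈ Q, x j = 0) ∧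
      (∀ x : β → ℤ, B.mulVec x = 0 → (∀ j ∈ Q, x j = 0) → (∀ j ∈ Qᶜ \ J₀, x j = 0) →
        ∀ j, x j = 0) := by
  set v := qcol B with hv
  obtain ⟨b0, hb0t, -, hb0s, hb0l⟩ := exists_linearIndepOn_extension (K := ℚ) (v := v)
    (s := ∅) (t := ((Qᶜ : Finset β) : Set β)) (linearIndepOn_empty ℚ v) (Set.empty_subset _)
  obtain ⟨b, -, hb0b, hbs, hbl⟩ := exists_linearIndepOn_extension (K := ℚ) (v := v)
    (s := b0) (t := Set.univ) hb0l (Set.subset_univ _)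
  obtain ⟨J₀, rfl⟩ : ∃ J : Finset β, (J : Set β) = b0 := ⟨b0.toFinset, by simp⟩
  obtain ⟨J, rfl⟩ : ∃ J : Finset β, (J : Set β) = b := ⟨b.toFinset, by simp⟩
  have hJ0 : J₀ ⊆ Qᶜ := by exact_mod_cast hb0t
  have hJJ : J₀ ⊆ J := by exact_mod_cast hb0b
  have hJeq : ∀ j ∈ J, j ∉ Q → j ∈ J₀ := by
    intro j hj hjQ
    by_contra hn
    have h1 : v j ∈ Submodule.span ℚ (v '' (J₀ : Set β)) :=
      hb0s ⟨j, by simpa using hjQ, rfl⟩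
    exact (hb0l.notMem_span_iff.2 ⟨hbl.mono (Set.insert_subset hj hb0b), hn⟩) h1
  have hdis : Disjoint J₀ (J ∩ Q) := by
    rw [Finset.disjoint_left]; intro a ha hb
    have := hJ0 ha
    simp at this hb; exact this hb.2
  have hun : J₀ ∪ (J ∩ Q) = J := by
    ext j
    simp only [Finset.mem_union, Finset.mem_inter]
    constructor
    · rintro (h | h); exacts [hJJ h, h.1]
    · intro h; by_cases hq : j ∈ Q
      · exact Or.inr ⟨h, hq⟩
      · exact Or.inl (hJeq j h hq)
  have c0 : J₀.card = rkZ (colSub B Qᶜ) := by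
    rw [rkZ_colSub_eq]; exact (finrank_span_eq_card_aux v J₀ _ hb0t hb0s hb0l).symm
  have c1 : J.card = rkZ B := by
    rw [rkZ_eq]; exact (finrank_span_eq_card_aux v J _ (Set.subset_univ _) hbs hbl).symm
  have c2 : J₀.card + (J ∩ Q).card = J.card := by
    rw [← Finset.card_union_of_disjoint hdis, hun]
  refine ⟨J₀, J ∩ Q, hJ0, Finset.inter_subset_right, c0, ?_, c2.trans c1, ?_, ?_⟩
  · unfold rQ; omega
  · intro x hx h0
    have hs := qcol_sum B x hx
    have e1 : ∑ j, (x j : ℚ) • qcol B j = ∑ j ∈ J ∩ Q, (x j : ℚ) • v j + ∑ j ∈ Qᶜ, (x j : ℚ) • v j := by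
      rw [← Finset.sum_add_sum_compl Q]
      congr 1
      symm
      apply Finset.sum_subset Finset.inter_subset_right
      intro j hj hj2
      rw [h0 j (by simp only [Finset.mem_sdiff]; exact ⟨hj, hj2⟩)]; simp
    rw [e1] at hs
    have m1 : ∑ j ∈ Qᶜ, (x j : ℚ) • v j ∈ Submodule.span ℚ (v '' (J₀ : Set β)) :=
      Submodule.sum_mem _ fun j hj => Submodule.smul_mem _ _ (hb0s ⟨j, hj, rfl⟩)
    have m2 : ∑ j ∈ J ∩ Q, (x j : ℚ) • v j ∈ Submodule.span ℚ (v '' ((J ∩ Q : Finset β) : Set β)) :=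
      Submodule.sum_mem _ fun j hj => Submodule.smul_mem _ _ (Submodule.subset_span ⟨j, hj, rfl⟩)
    have m3 : ∑ j ∈ J ∩ Q, (x j : ℚ) • v j ∈ Submodule.span ℚ (v '' (J₀ : Set β)) := by
      rw [eq_neg_of_add_eq_zero_left hs]; exact Submodule.neg_mem _ m1
    have hd : Disjoint (Submodule.span ℚ (v '' (J₀ : Set β)))
        (Submodule.span ℚ (v '' ((J ∩ Q : Finset β) : Set β))) := by
      have hbl' : LinearIndepOn ℚ v ((J₀ : Set β) ∪ ((J ∩ Q : Finset β) : Set β)) := by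
        rw [← Finset.coe_union, hun]; exact hbl
      exact ((linearIndepOn_union_iff (by exact_mod_cast hdis)).1 hbl').2.2
    have z : ∑ j ∈ J ∩ Q, (x j : ℚ) • v j = 0 := Submodule.disjoint_def.1 hd _ m3 m2
    have li := linearIndepOn_finset_iff.1 (hbl.mono (t := ((J ∩ Q : Finset β) : Set β)) (by simp))
      (fun j => (x j : ℚ)) z
    intro j hj
    by_cases hjJ : j ∈ J ∩ Q
    · exact_mod_cast li j hjJ
    · exact h0 j (by simp only [Finset.mem_sdiff]; exact ⟨hj, hjJ⟩)
  · intro x hx h0 h1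
    have hs := qcol_sum B x hx
    have hz : ∀ j ∉ J₀, x j = 0 := by
      intro j hj
      by_cases hq : j ∈ Q
      · exact h0 j hq
      · exact h1 j (by simp only [Finset.mem_sdiff, Finset.mem_compl]; exact ⟨hq, hj⟩)
    have e1 : ∑ j ∈ J₀, (x j : ℚ) • v j = 0 := by
      rw [← hs]
      apply Finset.sum_subset (Finset.subset_univ _)
      intro j _ hj; rw [hz j hj]; simp
    have li := linearIndepOn_finset_iff.1 hb0l (fun j => (x j : ℚ)) e1
    intro j
    by_cases hj : j ∈ J₀
    · exact_mod_cast li j hj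
    · exact hz j hj

end LinAlg

section Counting
set_option linter.unusedSectionVars false
variable {α β : Type*} [Fintype α] [Fintype β]

/-- integer vector encoded by indices -/
def valZ {n : ℕ} (y : β → Fin n) : β → ℤ := fun j => ((y j : ℕ) : ℤ) + 1

theorem valZ_sub_eq_zero {n : ℕ} {y y' : β → Fin n} {j : β} : valZ y j - valZ y' j = 0 ↔ y j = y' j := by
  unfold valZ
  constructor
  · intro h; apply Fin.ext; omega
  · intro h; rw [h]; ring

theorem ker_sub {n : ℕ} (B : Matrix α β ℤ) {y y' : β → Fin n} (h : B.mulVec (valZ y) = 0)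
    (h' : B.mulVec (valZ y') = 0) : B.mulVec (fun j => valZ y j - valZ y' j) = 0 := by
  have : (fun j => valZ y j - valZ y' j) = valZ y - valZ y' := rfl
  rw [this, Matrix.mulVec_sub, h, h', sub_zero]

theorem rk_compl_le (B : Matrix α β ℤ) (Q : Finset β) : rkZ (colSub B Qᶜ) ≤ (Qᶜ).card := by
  obtain ⟨J₀, J₁, h0, -, c0, -⟩ := exists_basis_split B Q
  rw [← c0]; exact Finset.card_le_card h0

theorem rQ_le (B : Matrix α β ℤ) (Q : Finset β) : rQ B Q ≤ Q.card := by
  obtain ⟨J₀, J₁, h0, h1, c0, c1, -⟩ := exists_basis_split B Q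
  rw [← c1]; exact Finset.card_le_card h1

theorem rk_split (B : Matrix α β ℤ) (Q : Finset β) : rkZ (colSub B Qᶜ) + rQ B Q = rkZ B := by
  obtain ⟨J₀, J₁, h0, h1, c0, c1, c2, -⟩ := exists_basis_split B Q
  omega

theorem rQ_lt (B : Matrix α β ℤ) (hB : ∃ x : β → ℤ, B.mulVec x = 0 ∧ ∀ j, 0 < x j)
    (Q : Finset β) (hQ : Q.Nonempty) : rQ B Q < Q.card := by
  obtain ⟨J₀, J₁, h0, h1, c0, c1, c2, h3, -⟩ := exists_basis_split B Q
  by_contra hc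
  have : J₁ = Q := Finset.eq_of_subset_of_card_le h1 (by omega)
  subst this
  obtain ⟨x, hx, hp⟩ := hB
  obtain ⟨j, hj⟩ := hQ
  have := h3 x hx (by simp) j hj
  have := hp j
  omega

theorem rkZ_le (B : Matrix α β ℤ) : rkZ B ≤ Fintype.card β := by
  unfold rkZ; exact Matrix.rank_le_card_width _

theorem count_U {n : ℕ} (B : Matrix α β ℤ) (Q : Finset β) (U : Finset (Fin n)) :
    (Finset.univ.filter (fun y : β → Fin n => B.mulVec (valZ y) = 0 ∧ ∀ j ∈ Q, y j ∈ U)).card ≤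
      U.card ^ Q.card * n ^ ((Qᶜ).card - rkZ (colSub B Qᶜ)) := by
  obtain ⟨J₀, J₁, h0, h1, c0, c1, c2, -, h4⟩ := exists_basis_split B Q
  have key : (Finset.univ.filter (fun y : β → Fin n => B.mulVec (valZ y) = 0 ∧ ∀ j ∈ Q, y j ∈ U)).card ≤
      ((Fintype.piFinset (fun _ : Q => U)) ×ˢ
        (Finset.univ : Finset ((↥(Qᶜ \ J₀ : Finset β)) → Fin n))).card := by
    apply Finset.card_le_card_of_injOn (fun y => (fun j => y j.1, fun j => y j.1))
    · intro y hy
      simp only [Finset.coe_filter, Finset.mem_univ, true_and, Set.mem_ofPred_eq] at hy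
      simp only [Finset.coe_product, Set.mem_prod, Finset.mem_coe, Fintype.mem_piFinset, Finset.mem_univ, and_true]
      intro j; exact hy.2 _ j.2
    · intro y hy y' hy' he
      simp only [Finset.coe_filter, Finset.mem_univ, true_and, Set.mem_ofPred_eq] at hy hy'
      simp only [Prod.mk.injEq] at he
      funext j
      have := h4 _ (ker_sub B hy.1 hy'.1)
        (fun j hj => valZ_sub_eq_zero.2 (congrFun he.1 ⟨j, hj⟩))
        (fun j hj => valZ_sub_eq_zero.2 (congrFun he.2 ⟨j, hj⟩)) j
      exact valZ_sub_eq_zero.1 this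
  refine key.trans (le_of_eq ?_)
  rw [Finset.card_product, Fintype.card_piFinset, Finset.card_univ, Fintype.card_fun]
  simp only [Finset.prod_const, Finset.card_univ, Fintype.card_coe, Fintype.card_fin]
  rw [Finset.card_sdiff_of_subset h0, c0]

theorem count_restrict {n : ℕ} (B : Matrix α β ℤ) (Q : Finset β) (T : Finset (β → Fin n))
    (hT : ∀ y ∈ T, B.mulVec (valZ y) = 0) :
    (T.image (fun y => fun j : Q => y j.1)).card ≤ n ^ (Q.card - rQ B Q) := by
  obtain ⟨J₀, J₁, h0, h1, c0, c1, c2, h3, -⟩ := exists_basis_split B Q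
  have key : (T.image (fun y => fun j : Q => y j.1)).card ≤
      (Finset.univ : Finset ((↥(Q \ J₁ : Finset β)) → Fin n)).card := by
    apply Finset.card_le_card_of_injOn
      (fun g => fun j => g ⟨j.1, (Finset.mem_sdiff.1 j.2).1⟩)
    · intro y hy; simp
    · intro g hg g' hg' he
      simp only [Finset.coe_image, Set.mem_image, Finset.mem_coe] at hg hg'
      obtain ⟨y, hy, rfl⟩ := hg
      obtain ⟨y', hy', rfl⟩ := hg'
      funext j
      have := h3 _ (ker_sub B (hT y hy) (hT y' hy'))
        (fun j hj => valZ_sub_eq_zero.2 (congrFun he ⟨j, hj⟩)) j.1 j.2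
      exact valZ_sub_eq_zero.1 this
  refine key.trans (le_of_eq ?_)
  rw [Finset.card_univ, Fintype.card_fun]
  simp only [Fintype.card_coe, Fintype.card_fin]
  rw [Finset.card_sdiff_of_subset h1, c1]

theorem pairs_agree {n : ℕ} (B : Matrix α β ℤ) (Q : Finset β) (T : Finset (β → Fin n))
    (hT : ∀ y ∈ T, B.mulVec (valZ y) = 0) :
    T.card ^ 2 ≤ n ^ (Q.card - rQ B Q) *
      ((T ×ˢ T).filter (fun z => ∀ j ∈ Q, z.1 j = z.2 j)).card := by
  obtain ⟨R, hR⟩ : ∃ R : (β → Fin n) → (Q → Fin n), R = (fun y => fun j : Q => y j.1) := ⟨_, rfl⟩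
  have h1 : T.card = ∑ g ∈ T.image R, (T.filter (fun y => R y = g)).card :=
    Finset.card_eq_sum_card_image R T
  have h2 : ((T ×ˢ T).filter (fun z => ∀ j ∈ Q, z.1 j = z.2 j)).card =
      ∑ g ∈ T.image R, (T.filter (fun y => R y = g)).card ^ 2 := by
    rw [Finset.card_eq_sum_card_fiberwise (f := fun z => R z.1) (t := T.image R)]
    · apply Finset.sum_congr rfl
      intro g hg
      rw [sq, ← Finset.card_product]
      congr 1
      ext ⟨y, y'⟩
      simp only [Finset.mem_filter, Finset.mem_product, hR, funext_iff, Subtype.forall]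
      constructor
      · rintro ⟨⟨⟨a, b⟩, c⟩, d⟩
        exact ⟨⟨a, d⟩, b, fun j hj => by rw [← c j hj]; exact d j hj⟩
      · rintro ⟨⟨a, d⟩, b, c⟩
        exact ⟨⟨⟨a, b⟩, fun j hj => by rw [d j hj, c j hj]⟩, d⟩
    · intro z hz
      simp only [Finset.coe_filter, Finset.mem_product, Set.mem_ofPred_eq] at hz
      exact Finset.mem_coe.2 (Finset.mem_image_of_mem _ hz.1.1)
  rw [h2]
  calc T.card ^ 2 = (∑ g ∈ T.image R, (T.filter (fun y => R y = g)).card) ^ 2 := by rw [← h1]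
    _ ≤ (T.image R).card * ∑ g ∈ T.image R, (T.filter (fun y => R y = g)).card ^ 2 :=
        sq_sum_le_card_mul_sum_sq
    _ ≤ _ := Nat.mul_le_mul_right _ (by rw [hR]; exact count_restrict B Q T hT)

theorem exists_inj_pos (B : Matrix α β ℤ) (hB : IsPositiveMat B) :
    ∃ x : β → ℤ, B.mulVec x = 0 ∧ (∀ j, 0 < x j) ∧ Function.Injective x := by
  have key : ∀ P : Finset (β × β), (∀ z ∈ P, z.1 ≠ z.2) → ∃ x : β → ℤ, B.mulVec x = 0 ∧
      (∀ j, 0 < x j) ∧ ∀ z ∈ P, x z.1 ≠ x z.2 := by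
    intro P
    induction P using Finset.induction_on with
    | empty => 
      intro _
      obtain ⟨x, hx, hp⟩ := hB.1
      exact ⟨x, hx, hp, by simp⟩
    | insert z P hz ih =>
      intro hP
      obtain ⟨x, hx, hp, hd⟩ := ih (fun w hw => hP w (Finset.mem_insert_of_mem hw))
      by_cases hxz : x z.1 = x z.2
      swap
      · refine ⟨x, hx, hp, fun w hw => ?_⟩
        rcases Finset.mem_insert.1 hw with rfl | hw
        exacts [hxz, hd w hw]
      obtain ⟨u, hu, hud⟩ := hB.2 z.1 z.2 (hP z (Finset.mem_insert_self _ _))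
      obtain ⟨K, hK⟩ : ∃ K : ℤ, ∀ j, |u j| ≤ K :=
        ⟨∑ j, |u j|, fun j => Finset.single_le_sum (f := fun j => |u j|) (fun _ _ => abs_nonneg _) (Finset.mem_univ j)⟩
      refine ⟨fun j => (2*K+1) * x j + u j, ?_, ?_, ?_⟩
      · have : (fun j => (2*K+1) * x j + u j) = (2*K+1) • x + u := by funext j; simp
        rw [this, Matrix.mulVec_add, Matrix.mulVec_smul, hx, hu]; simp
      · intro j
        have h1 := hp j
        have h2 := abs_le.1 (hK j)
        have h3 : 0 ≤ K := (abs_nonneg _).trans (hK j)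
        show 0 < (2*K+1) * x j + u j
        nlinarith
      · intro w hw
        rcases Finset.mem_insert.1 hw with rfl | hw
        · show (2*K+1) * x w.1 + u w.1 ≠ (2*K+1) * x w.2 + u w.2
          rw [hxz]; intro h; exact hud (by linarith)
        · show (2*K+1) * x w.1 + u w.1 ≠ (2*K+1) * x w.2 + u w.2
          have h2 := abs_le.1 (hK w.1)
          have h2' := abs_le.1 (hK w.2)
          have h3 : 0 ≤ K := (abs_nonneg _).trans (hK w.1)
          intro h
          rcases lt_or_gt_of_ne (hd w hw) with h4 | h4
          · nlinarith
          · nlinarith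
  obtain ⟨x, hx, hp, hd⟩ := key (Finset.univ.filter (fun z => z.1 ≠ z.2)) (by simp)
  refine ⟨x, hx, hp, fun i j hij => ?_⟩
  by_contra hne
  exact hd (i, j) (by simp [hne]) hij

theorem exists_row_basis (B : Matrix α β ℤ) : ∃ I : Finset α, I.card = rkZ B ∧
    ∀ x : β → ℤ, (∀ i ∈ I, B.mulVec x i = 0) → B.mulVec x = 0 := by
  obtain ⟨b, -, -, hbs, hbl⟩ := exists_linearIndepOn_extension (K := ℚ) (v := qcol Bᵀ)
    (s := ∅) (t := Set.univ) (linearIndepOn_empty ℚ _) (Set.empty_subset _)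
  obtain ⟨I, rfl⟩ : ∃ J : Finset α, (J : Set α) = b := ⟨b.toFinset, by simp⟩
  refine ⟨I, ?_, ?_⟩
  · have : rkZ Bᵀ = rkZ B := by
      unfold rkZ
      rw [← Matrix.rank_transpose (B.map _)]; rfl
    rw [← this, rkZ_eq]
    exact (finrank_span_eq_card_aux _ I _ (Set.subset_univ _) hbs hbl).symm
  · intro x hx
    let φ : (β → ℚ) →ₗ[ℚ] ℚ := 
      { toFun := fun r => ∑ j, r j * (x j : ℚ)
        map_add' := fun r s => by simp [add_mul, Finset.sum_add_distrib]
        map_smul' := fun c r => by simp [Finset.mul_sum, mul_assoc] }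
    have hφ : ∀ i, φ (qcol Bᵀ i) = ((B.mulVec x i : ℤ) : ℚ) := by
      intro i; simp [φ, qcol, Matrix.mulVec, dotProduct]
    have hle : Submodule.span ℚ (qcol Bᵀ '' (I : Set α)) ≤ LinearMap.ker φ := by
      rw [Submodule.span_le]
      rintro _ ⟨i, hi, rfl⟩
      simp only [SetLike.mem_coe, LinearMap.mem_ker]
      rw [hφ, hx i hi]; simp
    funext i
    have : φ (qcol Bᵀ i) = 0 := hle (hbs ⟨i, trivial, rfl⟩)
    rw [hφ] at this
    exact_mod_cast this

end Counting

section Lower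
set_option linter.unusedSectionVars false
variable {α β : Type*} [Fintype α] [Fintype β]

/-- injective solutions in the box -/
noncomputable def solF (B : Matrix α β ℤ) (n : ℕ) : Finset (β → Fin n) :=
  Finset.univ.filter (fun y => B.mulVec (valZ y) = 0 ∧ Function.Injective y)

theorem fiber_le (B : Matrix α β ℤ) (x0 : β → ℤ) (hx0 : B.mulVec x0 = 0) (hp : ∀ j, 0 < x0 j)
    (hinj : Function.Injective x0) (X : ℕ) (hX : ∀ j, x0 j ≤ X) (n k : ℕ)
    (hk : (2 * X + 1) * k ≤ n) (T : Finset (β → Fin k)) 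
    (hT : ∀ w ∈ T, ∀ w' ∈ T, B.mulVec (fun j => ((w j : ℕ) : ℤ) - ((w' j : ℕ) : ℤ)) = 0) :
    T.card ≤ (solF B n).card := by
  rcases T.eq_empty_or_nonempty with rfl | ⟨w0, hw0⟩
  · simp
  have low : ∀ (w : β → Fin k) j, 1 ≤ 2 * (k : ℤ) * x0 j + (w j : ℕ) - (w0 j : ℕ) := by
    intro w j
    have h1 := (w0 j).2
    have h2 := hp j
    have h3 : (0 : ℤ) ≤ k := by positivity
    nlinarith
  have high : ∀ (w : β → Fin k) j, 2 * (k : ℤ) * x0 j + (w j : ℕ) - (w0 j : ℕ) ≤ n := by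
    intro w j
    have h1 := (w j).2
    have h2 := hX j
    have h3 : (0 : ℤ) ≤ k := by positivity
    have h4 : (2 * (X : ℤ) + 1) * k ≤ n := by exact_mod_cast hk
    nlinarith
  let F : (β → Fin k) → (β → Fin n) := fun w j =>
    ⟨(2 * (k : ℤ) * x0 j + (w j : ℕ) - (w0 j : ℕ) - 1).toNat, by
      have := low w j; have := high w j; omega⟩
  have hF : ∀ w j, valZ (F w) j = 2 * (k : ℤ) * x0 j + (w j : ℕ) - (w0 j : ℕ) := by
    intro w j
    have := low w j
    simp only [valZ, F]
    omega
  apply Finset.card_le_card_of_injOn F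
  · intro w hw
    simp only [solF, Finset.coe_filter, Finset.mem_univ, true_and, Set.mem_ofPred_eq]
    constructor
    · have : valZ (F w) = (2 * (k : ℤ)) • x0 + (fun j => ((w j : ℕ) : ℤ) - ((w0 j : ℕ) : ℤ)) := by
        funext j; rw [hF]; simp; ring
      rw [this, Matrix.mulVec_add, Matrix.mulVec_smul, hx0, hT w hw w0 hw0]; simp
    · intro i j hij
      have h1 : valZ (F w) i = valZ (F w) j := by simp only [valZ, hij]
      rw [hF, hF] at h1
      by_contra hne
      have a1 := (w i).2
      have a2 := (w j).2
      have a3 := (w0 i).2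
      have a4 := (w0 j).2
      rcases lt_or_gt_of_ne (fun h => hne (hinj h)) with h4 | h4
      · have : (2 * (k : ℤ)) * (x0 j - x0 i - 1) ≥ 0 := by
          apply mul_nonneg <;> omega
        nlinarith
      · have : (2 * (k : ℤ)) * (x0 i - x0 j - 1) ≥ 0 := by
          apply mul_nonneg <;> omega
        nlinarith
  · intro w hw w' hw' he
    funext j
    have h1 : valZ (F w) j = valZ (F w') j := by rw [he]
    rw [hF, hF] at h1
    apply Fin.ext
    omega

theorem sol_lower_aux (B : Matrix α β ℤ) (hB : IsPositiveMat B) :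
    ∃ X C : ℕ, 0 < C ∧ ∀ n k : ℕ, 0 < k → (2 * X + 1) * k ≤ n →
      k ^ Fintype.card β ≤ (solF B n).card * (C * k) ^ rkZ B := by
  obtain ⟨x0, hx0, hp, hinj⟩ := exists_inj_pos B hB
  obtain ⟨I, hI, hIB⟩ := exists_row_basis B
  obtain ⟨X, hX⟩ : ∃ X : ℕ, ∀ j, x0 j ≤ X := by
    refine ⟨(∑ j, x0 j).toNat, fun j => ?_⟩
    have := Finset.single_le_sum (f := x0) (fun j _ => (hp j).le) (Finset.mem_univ j)
    have h2 := Int.self_le_toNat (∑ j, x0 j)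
    exact this.trans h2
  obtain ⟨C, hC⟩ : ∃ C : ℕ, ∀ i, ∑ j, |B i j| ≤ C := by
    refine ⟨(∑ i, ∑ j, |B i j|).toNat, fun i => ?_⟩
    have := Finset.single_le_sum (f := fun i => ∑ j, |B i j|)
      (fun i _ => Finset.sum_nonneg fun j _ => abs_nonneg _) (Finset.mem_univ i)
    exact this.trans (Int.self_le_toNat _)
  refine ⟨X, 2 * C + 1, by omega, fun n k hk0 hk => ?_⟩
  obtain ⟨F, hF⟩ : ∃ F : (β → Fin k) → (I → ℤ),
    F = fun w i => B.mulVec (fun j => ((w j : ℕ) : ℤ)) i.1 := ⟨_, rfl⟩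
  have h1 : (Finset.univ : Finset (β → Fin k)).card ≤
      (solF B n).card * ((Finset.univ : Finset (β → Fin k)).image F).card := by
    apply Finset.card_le_mul_card_image
    intro a _
    apply fiber_le B x0 hx0 hp hinj X hX n k hk
    intro w hw w' hw'
    simp only [Finset.mem_filter, Finset.mem_univ, true_and] at hw hw'
    apply hIB
    intro i hi
    have e : (fun j => ((w j : ℕ) : ℤ) - ((w' j : ℕ) : ℤ)) = 
      (fun j => ((w j : ℕ) : ℤ)) - (fun j => ((w' j : ℕ) : ℤ)) := rfl
    rw [e, Matrix.mulVec_sub]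
    have := congrFun (hw.trans hw'.symm) ⟨i, hi⟩
    simp only [hF] at this
    simp [this]
  have h2 : ((Finset.univ : Finset (β → Fin k)).image F).card ≤ ((2 * C + 1) * k) ^ rkZ B := by
    calc _ ≤ (Fintype.piFinset (fun _ : I => Finset.Icc (-((C * k : ℕ) : ℤ)) ((C * k : ℕ) : ℤ))).card := by
          apply Finset.card_le_card
          intro g hg
          obtain ⟨w, -, rfl⟩ := Finset.mem_image.1 hg
          rw [Fintype.mem_piFinset]
          intro i
          rw [Finset.mem_Icc, ← abs_le, hF]
          simp only [Matrix.mulVec, dotProduct]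
          calc _ ≤ ∑ j, |B i.1 j * ((w j : ℕ) : ℤ)| := Finset.abs_sum_le_sum_abs _ _
            _ ≤ ∑ j, |B i.1 j| * (k : ℤ) := by
                apply Finset.sum_le_sum; intro j _
                rw [abs_mul]
                apply mul_le_mul_of_nonneg_left _ (abs_nonneg _)
                have := (w j).2
                rw [abs_of_nonneg (by positivity)]; omega
            _ ≤ _ := by
                rw [← Finset.sum_mul]; push_cast
                exact mul_le_mul_of_nonneg_right (hC _) (by positivity)
      _ = (2 * (C * k) + 1) ^ rkZ B := by
          rw [Fintype.card_piFinset]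
          simp only [Int.card_Icc, Finset.prod_const, Finset.card_univ, Fintype.card_coe, hI]
          congr 1; omega
      _ ≤ _ := by
          apply Nat.pow_le_pow_left
          nlinarith
  calc k ^ Fintype.card β = (Finset.univ : Finset (β → Fin k)).card := by
        rw [Finset.card_univ, Fintype.card_fun, Fintype.card_fin]
    _ ≤ _ := h1.trans (Nat.mul_le_mul_left _ h2)

theorem sol_lower (B : Matrix α β ℤ) (hB : IsPositiveMat B) :
    ∃ c : ℝ, 0 < c ∧ ∃ n0 : ℕ, ∀ n ≥ n0,
      c * (n : ℝ) ^ (Fintype.card β - rkZ B) ≤ ((solF B n).card : ℝ) := by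
  obtain ⟨X, C, hC, h⟩ := sol_lower_aux B hB
  set d := Fintype.card β - rkZ B with hd
  have hrk := rkZ_le B
  refine ⟨1 / ((C : ℝ) ^ rkZ B * (2 * (2 * X + 1)) ^ d), by positivity, 2 * X + 1, fun n hn => ?_⟩
  obtain ⟨k, hk⟩ : ∃ k, k = n / (2 * X + 1) := ⟨_, rfl⟩
  have hk1 : (2 * X + 1) * k ≤ n := by rw [hk]; exact Nat.mul_div_le _ _
  have hk0 : 0 < k := by rw [hk]; exact Nat.div_pos hn (by omega)
  have hk2 : n ≤ 2 * (2 * X + 1) * k := by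
    have : n < (2 * X + 1) * (k + 1) := by
      rw [hk]; exact Nat.lt_mul_div_succ n (by omega)
    nlinarith
  have h1 := h n k hk0 hk1
  have h2 : (k : ℝ) ^ d ≤ (solF B n).card * (C : ℝ) ^ rkZ B := by
    have h3 : (k : ℝ) ^ (d + rkZ B) ≤ (solF B n).card * ((C : ℝ) * k) ^ rkZ B := by
      have : d + rkZ B = Fintype.card β := by omega
      rw [this]; exact_mod_cast h1
    rw [pow_add, mul_pow, ← mul_assoc] at h3
    exact le_of_mul_le_mul_right h3 (by positivity)
  have h4 : (n : ℝ) ^ d ≤ (2 * (2 * X + 1)) ^ d * (k : ℝ) ^ d := by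
    rw [← mul_pow]
    apply pow_le_pow_left₀ (by positivity)
    exact_mod_cast hk2
  rw [div_mul_eq_mul_div, one_mul, div_le_iff₀ (by positivity)]
  calc (n : ℝ) ^ d ≤ (2 * (2 * X + 1)) ^ d * (k : ℝ) ^ d := h4
    _ ≤ (2 * (2 * X + 1)) ^ d * ((solF B n).card * (C : ℝ) ^ rkZ B) := by gcongr
    _ = _ := by ring

end Lower

section Upper
set_option linter.unusedSectionVars false
variable {α β : Type*} [Fintype α] [Fintype β]

/-- exponent of the complement -/
noncomputable def fQ (B : Matrix α β ℤ) (Q : Finset β) : ℕ := (Qᶜ).card - rkZ (colSub B Qᶜ)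
/-- exponent of `Q` -/
noncomputable def eQ (B : Matrix α β ℤ) (Q : Finset β) : ℕ := Q.card - rQ B Q
/-- kernel dimension -/
noncomputable def dd (B : Matrix α β ℤ) : ℕ := Fintype.card β - rkZ B

theorem eQ_add_fQ (B : Matrix α β ℤ) (Q : Finset β) : eQ B Q + fQ B Q = dd B := by
  have h1 := rk_compl_le B Q
  have h2 := rQ_le B Q
  have h3 := rk_split B Q
  have h4 := Finset.card_add_card_compl Q
  unfold eQ fQ dd
  omega

theorem eQ_pos (B : Matrix α β ℤ) (hB : IsPositiveMat B) (Q : Finset β) (hQ : Q.Nonempty) :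
    1 ≤ eQ B Q := by
  have := rQ_lt B hB.1 Q hQ
  unfold eQ; omega

theorem fQ_empty (B : Matrix α β ℤ) : fQ B ∅ = dd B := by
  have h := eQ_add_fQ B ∅
  have : eQ B ∅ = 0 := by simp [eQ]
  omega

theorem density_ge (B : Matrix α β ℤ) (Q : Finset β) (hQ : Q.Nonempty) :
    (Q.card : ℝ) / (eQ B Q : ℝ) ≤ matDensity B := by
  unfold matDensity
  apply le_csSup
  · apply Set.Finite.bddAbove
    apply Set.Finite.subset (Set.finite_range (fun Q : Finset β => (Q.card : ℝ) / ((Q.card : ℝ) - (rQ B Q : ℝ))))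
    rintro x ⟨Q, -, rfl⟩
    exact ⟨Q, rfl⟩
  · refine ⟨Q, hQ, ?_⟩
    unfold eQ
    rw [Nat.cast_sub (rQ_le B Q)]

theorem scale_ge (n p c : ℝ) (hn : 0 ≤ n) (hp : 0 < p) (hp1 : p ≤ 1) (e q : ℕ) (he : 1 ≤ e)
    (hq : (q : ℝ) / e ≤ c) (h : 1 ≤ n * p ^ c) : n * p ^ c ≤ n ^ e * p ^ q := by
  have he' : (0 : ℝ) < e := by exact_mod_cast he
  have h1 : (q : ℝ) ≤ c * e := by rwa [div_le_iff₀ he'] at hq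
  calc n * p ^ c ≤ (n * p ^ c) ^ e := le_self_pow₀ h (by omega)
    _ = n ^ e * p ^ (c * e) := by
        rw [mul_pow, Real.rpow_mul hp.le, Real.rpow_natCast]
    _ ≤ n ^ e * p ^ (q : ℝ) := by
        apply mul_le_mul_of_nonneg_left _ (by positivity)
        exact Real.rpow_le_rpow_of_exponent_ge hp hp1 h1
    _ = _ := by rw [Real.rpow_natCast]

/-- the sum controlling degrees -/
noncomputable def Dsum (B : Matrix α β ℤ) (n : ℕ) (p : ℝ) : ℝ :=
  ∑ Q ∈ (Finset.univ : Finset (Finset β)).filter (fun Q => Q.Nonempty), (n : ℝ) ^ fQ B Q * p ^ (Qᶜ).card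

theorem Dterm_le {B : Matrix α β ℤ} {n : ℕ} {p : ℝ} (hp : 0 ≤ p) {Q : Finset β} (hQ : Q.Nonempty) :
    (n : ℝ) ^ fQ B Q * p ^ (Qᶜ).card ≤ Dsum B n p := by
  unfold Dsum
  exact Finset.single_le_sum (f := fun Q => (n : ℝ) ^ fQ B Q * p ^ (Qᶜ).card)
    (fun Q _ => by positivity) (by simp [hQ])

theorem Dsum_nonneg {B : Matrix α β ℤ} {n : ℕ} {p : ℝ} (hp : 0 ≤ p) : 0 ≤ Dsum B n p :=
  Finset.sum_nonneg fun _ _ => by positivity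

theorem inj_sum_U (B : Matrix α β ℤ) (n : ℕ) (p : ℝ) (hp : 0 ≤ p) (U : Finset (Fin n)) (K : ℕ)
    (hK : 1 ≤ K) (hU : U.card ≤ K) (Q : Finset β) :
    ∑ y ∈ (solF B n).filter (fun y => Finset.univ.filter (fun j => y j ∈ U) = Q),
      p ^ (Finset.univ.image y \ U).card ≤ (K : ℝ) ^ Fintype.card β * ((n : ℝ) ^ fQ B Q * p ^ (Qᶜ).card) := by
  have h1 : ∀ y ∈ (solF B n).filter (fun y => Finset.univ.filter (fun j => y j ∈ U) = Q),
      p ^ (Finset.univ.image y \ U).card = p ^ (Qᶜ).card := by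
    intro y hy
    simp only [solF, Finset.mem_filter, Finset.mem_univ, true_and] at hy
    obtain ⟨⟨-, hy2⟩, rfl⟩ := hy
    congr 1
    rw [← Finset.card_image_of_injective _ hy2]
    congr 1
    ext a
    simp only [Finset.mem_sdiff, Finset.mem_image, Finset.mem_univ, true_and, Finset.mem_compl,
      Finset.mem_filter]
    constructor
    · rintro ⟨⟨j, rfl⟩, h⟩; exact ⟨j, h, rfl⟩
    · rintro ⟨j, h, rfl⟩; exact ⟨⟨j, rfl⟩, h⟩
  rw [Finset.sum_congr rfl h1, Finset.sum_const, nsmul_eq_mul]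
  have h2 : (((solF B n).filter (fun y => Finset.univ.filter (fun j => y j ∈ U) = Q)).card : ℝ) ≤
      (K : ℝ) ^ Fintype.card β * (n : ℝ) ^ fQ B Q := by
    have h3 : ((solF B n).filter (fun y => Finset.univ.filter (fun j => y j ∈ U) = Q)).card ≤
        U.card ^ Q.card * n ^ fQ B Q := by
      refine le_trans (Finset.card_le_card ?_) (count_U B Q U)
      intro y hy
      simp only [solF, Finset.mem_filter, Finset.mem_univ, true_and] at hy ⊢
      obtain ⟨⟨hy1, hy2⟩, rfl⟩ := hy
      exact ⟨hy1, fun j hj => by simpa using hj⟩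
    have h4 : U.card ^ Q.card ≤ K ^ Fintype.card β :=
      (Nat.pow_le_pow_left hU _).trans (Nat.pow_le_pow_right hK (Finset.card_le_univ _))
    calc _ ≤ ((U.card ^ Q.card * n ^ fQ B Q : ℕ) : ℝ) := by exact_mod_cast h3
      _ ≤ ((K ^ Fintype.card β * n ^ fQ B Q : ℕ) : ℝ) := by exact_mod_cast Nat.mul_le_mul_right _ h4
      _ = _ := by push_cast; ring
  calc _ ≤ ((K : ℝ) ^ Fintype.card β * (n : ℝ) ^ fQ B Q) * p ^ (Qᶜ).card := by gcongr
    _ = _ := by ring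

theorem inj_sum_D (B : Matrix α β ℤ) (n : ℕ) (p : ℝ) (hp : 0 ≤ p) (U : Finset (Fin n)) (K : ℕ)
    (hK : 1 ≤ K) (hU : U.card ≤ K) :
    ∑ y ∈ solF B n, (if ¬ Disjoint (Finset.univ.image y) U then p ^ (Finset.univ.image y \ U).card else 0)
      ≤ (K : ℝ) ^ Fintype.card β * Dsum B n p := by
  rw [← Finset.sum_filter]
  unfold Dsum
  rw [Finset.mul_sum]
  rw [← Finset.sum_fiberwise_of_maps_to (t := (Finset.univ : Finset (Finset β)).filter (fun Q => Q.Nonempty))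
    (g := fun y : β → Fin n => Finset.univ.filter (fun j => y j ∈ U))]
  · apply Finset.sum_le_sum
    intro Q _
    refine le_trans ?_ (inj_sum_U B n p hp U K hK hU Q)
    apply Finset.sum_le_sum_of_subset_of_nonneg
    · intro y hy
      simp only [Finset.mem_filter] at hy ⊢
      exact ⟨hy.1.1, hy.2⟩
    · intros; positivity
  · intro y hy
    simp only [Finset.mem_filter, Finset.mem_univ, true_and] at hy ⊢
    obtain ⟨-, hy⟩ := hy
    rw [Finset.not_disjoint_iff] at hy
    obtain ⟨a, ha, haU⟩ := hy
    obtain ⟨j, -, rfl⟩ := Finset.mem_image.1 ha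
    exact ⟨j, by simpa using haU⟩

theorem inj_sum_M (B : Matrix α β ℤ) (n : ℕ) (p : ℝ) (hp : 0 ≤ p) :
    ∑ y ∈ solF B n, p ^ (Finset.univ.image y).card ≤ (n : ℝ) ^ dd B * p ^ Fintype.card β := by
  have h := inj_sum_U B n p hp ∅ 1 le_rfl (by simp) ∅
  simpa [fQ_empty] using h

end Upper

section Split
set_option linter.unusedSectionVars false
variable {r m : ℕ}

theorem finite_setoid_fin (m : ℕ) : Finite (Setoid (Fin m)) := by
  apply Finite.of_injective (β := Fin m → Fin m → Prop) (fun s => fun a b => s.r a b)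
  intro s t h
  ext a b
  exact iff_of_eq (congrFun (congrFun h a) b)

noncomputable local instance instFintypeSetoidFin (m : ℕ) : Fintype (Setoid (Fin m)) :=
  @Fintype.ofFinite _ (finite_setoid_fin m)

/-- number of setoids -/
noncomputable def nS (m : ℕ) : ℕ := Fintype.card (Setoid (Fin m))

/-- nontrivial solutions in the box -/
noncomputable def ntF (A : Matrix (Fin r) (Fin m) ℤ) (n : ℕ) : Finset (Fin m → Fin n) :=
  Finset.univ.filter (fun y => A.mulVec (valZ y) = 0 ∧ Setoid.ker y ∈ partitionFamily A)

/-- relevant proper contractions -/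
noncomputable def relS (A : Matrix (Fin r) (Fin m) ℤ) : Finset (Setoid (Fin m)) :=
  Finset.univ.filter (fun s => s ∈ partitionFamily A ∧ s ≠ singletonSetoid (Fin m) ∧
    IsPositiveMat (contract A s))

theorem contract_mulVec (A : Matrix (Fin r) (Fin m) ℤ) (s : Setoid (Fin m)) (x : Quotient s → ℤ) :
    (contract A s).mulVec x = A.mulVec (fun j => x (Quotient.mk s j)) := by
  funext i
  simp only [Matrix.mulVec, dotProduct, contract]
  simp_rw [Finset.sum_mul]
  rw [← Finset.sum_fiberwise (s := Finset.univ) (g := fun j => Quotient.mk s j)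
    (f := fun j => A i j * x (Quotient.mk s j))]
  apply Finset.sum_congr rfl
  intro c _
  apply Finset.sum_congr rfl
  intro j hj
  rw [(Finset.mem_filter.1 hj).2]

theorem nt_split (A : Matrix (Fin r) (Fin m) ℤ) (n : ℕ) (F : Finset (Fin n) → ℝ) (hF : ∀ T, 0 ≤ F T) :
    ∑ z ∈ ntF A n, F (Finset.univ.image z) ≤ ∑ y ∈ solF A n, F (Finset.univ.image y) +
      ∑ s ∈ relS A, ∑ y ∈ solF (contract A s) n, F (Finset.univ.image y) := by
  have h1 : ∑ z ∈ ntF A n, F (Finset.univ.image z) =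
      ∑ z ∈ (ntF A n).filter (fun z => Function.Injective z), F (Finset.univ.image z) +
      ∑ z ∈ (ntF A n).filter (fun z => ¬ Function.Injective z), F (Finset.univ.image z) :=
    (Finset.sum_filter_add_sum_filter_not _ _ _).symm
  rw [h1]
  apply add_le_add
  · apply Finset.sum_le_sum_of_subset_of_nonneg
    · intro z hz
      simp only [ntF, solF, Finset.mem_filter, Finset.mem_univ, true_and] at hz ⊢
      exact ⟨hz.1.1, hz.2⟩
    · intros; exact hF _
  · rw [← Finset.sum_fiberwise_of_maps_to (t := relS A) (g := fun z : Fin m → Fin n => Setoid.ker z)]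
    · apply Finset.sum_le_sum
      intro s hs
      let G : (Quotient s → Fin n) → (Fin m → Fin n) := fun y j => y (Quotient.mk s j)
      have hG : Function.Injective G := by
        intro y y' h
        funext c
        induction c using Quotient.inductionOn with
        | h j => exact congrFun h j
      have hGi : ∀ y, Finset.univ.image (G y) = Finset.univ.image y := by
        intro y
        ext a
        simp only [Finset.mem_image, Finset.mem_univ, true_and, G]
        constructor
        · rintro ⟨j, rfl⟩; exact ⟨_, rfl⟩
        · rintro ⟨c, rfl⟩
          induction c using Quotient.inductionOn with
          | h j => exact ⟨j, rfl⟩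
      calc _ ≤ ∑ z ∈ (solF (contract A s) n).image G, F (Finset.univ.image z) := by
            apply Finset.sum_le_sum_of_subset_of_nonneg
            · intro z hz
              simp only [ntF, Finset.mem_filter, Finset.mem_univ, true_and] at hz
              obtain ⟨⟨⟨hz1, hz2⟩, hz3⟩, rfl⟩ := hz
              rw [Finset.mem_image]
              refine ⟨Quotient.lift z (fun a b h => h), ?_, ?_⟩
              · simp only [solF, Finset.mem_filter, Finset.mem_univ, true_and]
                constructor
                · rw [contract_mulVec]; exact hz1
                · intro c c' h
                  induction c using Quotient.inductionOn with
                  | h j =>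
                    induction c' using Quotient.inductionOn with
                    | h j' => exact Quotient.sound h
              · rfl
            · intros; exact hF _
        _ = _ := by
            rw [Finset.sum_image (fun a _ b _ h => hG h)]
            exact Finset.sum_congr rfl fun y _ => by rw [hGi]
    · intro z hz
      simp only [ntF, relS, Finset.mem_filter, Finset.mem_univ, true_and] at hz ⊢
      obtain ⟨⟨hz1, hz2⟩, hz3⟩ := hz
      refine ⟨hz2, ?_, ?_⟩
      · intro h
        apply hz3
        intro a b hab
        have : (Setoid.ker z).r a b := hab
        rw [h] at this
        exact this
      · have e : (contract A (Setoid.ker z)).mulVec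
            (valZ (Quotient.lift z (fun a b h => h) : Quotient (Setoid.ker z) → Fin n)) = 0 := by
          rw [contract_mulVec]; exact hz1
        refine ⟨⟨_, e, fun j => by unfold valZ; positivity⟩, fun i j hij => ⟨_, e, fun h => hij ?_⟩⟩
        have h' : (Quotient.lift z (fun a b h => h) : Quotient (Setoid.ker z) → Fin n) i =
            (Quotient.lift z (fun a b h => h) : Quotient (Setoid.ker z) → Fin n) j := by
          apply Fin.ext
          simp only [valZ] at h
          omega
        induction i using Quotient.inductionOn with
        | h i =>
          induction j using Quotient.inductionOn with
          | h j => exact Quotient.sound h'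

theorem card_quot_lt (s : Setoid (Fin m)) (hs : s ≠ singletonSetoid (Fin m)) :
    Fintype.card (Quotient s) < m := by
  have h1 : Fintype.card (Quotient s) ≤ m := by
    simpa using Fintype.card_le_of_surjective (Quotient.mk s) Quotient.mk_surjective
  rcases h1.lt_or_eq with h | h
  · exact h
  exfalso
  apply hs
  have hb : Function.Bijective (Quotient.mk s) := by
    rw [Fintype.bijective_iff_surjective_and_card]
    exact ⟨Quotient.mk_surjective, by simp [h]⟩
  ext a b
  constructor
  · intro hab; exact hb.1 (Quotient.sound hab)
  · intro hab
    have : a = b := hab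
    subst this; exact s.refl a

section main
variable (A : Matrix (Fin r) (Fin m) ℤ) (hm : 0 < m) (hA : IsPositiveMat A) (hS : IsStrictlyBalanced A)
  (n : ℕ) (p : ℝ) (hp : 0 < p) (hp1 : p ≤ 1) (hnp : 1 ≤ (n : ℝ) * p)
  (hnc : 1 ≤ (n : ℝ) * p ^ matDensity A)
include hm hA hS hp hp1 hnp hnc

theorem Ms_le (s : Setoid (Fin m)) (hs : s ∈ relS A) :
    (n : ℝ) ^ dd (contract A s) * p ^ Fintype.card (Quotient s) ≤ Dsum A n p ∧
    (n : ℝ) ^ dd (contract A s) * p ^ Fintype.card (Quotient s) ≤ (n : ℝ) ^ dd A * p ^ m := by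
  simp only [relS, Finset.mem_filter, Finset.mem_univ, true_and] at hs
  obtain ⟨hs1, hs2, hs3⟩ := hs
  have hlt := card_quot_lt s hs2
  have hr1 : rkZ (contract A s) = rkZ A := hs1
  have hle := rkZ_le (contract A s)
  obtain ⟨t, ht⟩ : ∃ t, m = Fintype.card (Quotient s) + t + 1 :=
    ⟨m - 1 - Fintype.card (Quotient s), by omega⟩
  have hd : dd A = dd (contract A s) + t + 1 := by
    unfold dd; rw [hr1, Fintype.card_fin]; rw [hr1] at hle; omega
  let j0 : Fin m := ⟨0, hm⟩
  have hne : ({j0} : Finset (Fin m)).Nonempty := by simp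
  have he1 := eQ_pos A hA {j0} hne
  have he2 : eQ A {j0} ≤ 1 := by unfold eQ; simp
  have hef := eQ_add_fQ A {j0}
  have hf : fQ A {j0} = dd (contract A s) + t := by omega
  have hc : (({j0} : Finset (Fin m))ᶜ).card = Fintype.card (Quotient s) + t := by
    have := Finset.card_add_card_compl ({j0} : Finset (Fin m))
    rw [Finset.card_singleton, Fintype.card_fin] at this
    omega
  have h0 : 0 ≤ (n : ℝ) ^ dd (contract A s) * p ^ Fintype.card (Quotient s) := by positivity
  have hD := Dterm_le (B := A) (n := n) hp.le hne
  have hD : (n : ℝ) ^ (dd (contract A s) + t) * p ^ (Fintype.card (Quotient s) + t) ≤ Dsum A n p := by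
    rw [← hf, ← hc]; convert! hD
  constructor
  · refine le_trans ?_ hD
    rw [pow_add, pow_add]
    calc _ ≤ (n : ℝ) ^ dd (contract A s) * p ^ Fintype.card (Quotient s) * (n * p) ^ t :=
          le_mul_of_one_le_right h0 (one_le_pow₀ hnp)
      _ = _ := by rw [mul_pow]; ring
  · have e : (n : ℝ) ^ dd A * p ^ m = (n : ℝ) ^ dd (contract A s) * p ^ Fintype.card (Quotient s) * (n * p) ^ (t+1) := by
      have hpm : p ^ m = p ^ (Fintype.card (Quotient s) + t + 1) := congrArg (fun k => p ^ k) ht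
      rw [hd, hpm, mul_pow]; ring
    rw [e]
    exact le_mul_of_one_le_right h0 (one_le_pow₀ hnp)

theorem Ds_le (s : Setoid (Fin m)) (hs : s ∈ relS A) :
    Dsum (contract A s) n p ≤ 2 ^ m * Dsum A n p := by
  have hM := (Ms_le A hm hA hS n p hp hp1 hnp hnc s hs).1
  simp only [relS, Finset.mem_filter, Finset.mem_univ, true_and] at hs
  obtain ⟨hs1, hs2, hs3⟩ := hs
  have hlt := card_quot_lt s hs2
  have hcd := hS.2.2 s hs1 hs2 hs3
  have hterm : ∀ Q : Finset (Quotient s), Q.Nonempty →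
      (n : ℝ) ^ fQ (contract A s) Q * p ^ (Qᶜ).card ≤ Dsum A n p := by
    intro Q hQ
    refine le_trans ?_ hM
    have h1 := scale_ge n p (matDensity A) (by positivity) hp hp1 (eQ (contract A s) Q) Q.card
      (eQ_pos _ hs3 Q hQ) ((density_ge _ Q hQ).trans hcd.le) hnc
    have h2 : 1 ≤ (n : ℝ) ^ eQ (contract A s) Q * p ^ Q.card := hnc.trans h1
    rw [← eQ_add_fQ (contract A s) Q, ← Finset.card_add_card_compl Q, pow_add, pow_add]
    calc _ ≤ (n : ℝ) ^ fQ (contract A s) Q * p ^ (Qᶜ).card * ((n : ℝ) ^ eQ (contract A s) Q * p ^ Q.card) :=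
          le_mul_of_one_le_right (by positivity) h2
      _ = _ := by ring
  have hD0 : 0 ≤ Dsum A n p := Dsum_nonneg hp.le
  calc Dsum (contract A s) n p ≤ ∑ Q ∈ (Finset.univ : Finset (Finset (Quotient s))).filter (fun Q => Q.Nonempty), Dsum A n p := by
        apply Finset.sum_le_sum
        intro Q hQ
        convert! hterm Q (Finset.mem_filter.1 hQ).2
    _ ≤ ∑ Q : Finset (Quotient s), Dsum A n p :=
        Finset.sum_le_sum_of_subset_of_nonneg (Finset.filter_subset _ _) (fun _ _ _ => hD0)
    _ = 2 ^ Fintype.card (Quotient s) * Dsum A n p := by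
        rw [Finset.sum_const, Finset.card_univ, Fintype.card_finset, nsmul_eq_mul]; push_cast; rfl
    _ ≤ _ := by
        apply mul_le_mul_of_nonneg_right _ hD0
        exact pow_le_pow_right₀ (by norm_num) hlt.le

theorem relS_card_le : ((relS A).card : ℝ) ≤ nS m := by
  exact_mod_cast Finset.card_le_univ _

theorem nt_sum_M : ∑ z ∈ ntF A n, p ^ (Finset.univ.image z).card ≤ (1 + nS m) * ((n : ℝ) ^ dd A * p ^ m) := by
  refine (nt_split A n (fun T => p ^ T.card) (fun T => by positivity)).trans ?_
  rw [add_mul, one_mul]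
  apply add_le_add
  · simpa using inj_sum_M A n p hp.le
  · calc _ ≤ ∑ s ∈ relS A, (n : ℝ) ^ dd A * p ^ m := by
          apply Finset.sum_le_sum
          intro s hs
          exact (inj_sum_M _ n p hp.le).trans (Ms_le A hm hA hS n p hp hp1 hnp hnc s hs).2
      _ ≤ _ := by
          rw [Finset.sum_const, nsmul_eq_mul]
          exact mul_le_mul_of_nonneg_right (relS_card_le A hm hA hS n p hp hp1 hnp hnc) (by positivity)

theorem nt_sum_D (U : Finset (Fin n)) (K : ℕ) (hK : 1 ≤ K) (hU : U.card ≤ K) :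
    ∑ z ∈ ntF A n, (if ¬ Disjoint (Finset.univ.image z) U then p ^ (Finset.univ.image z \ U).card else 0) ≤
      ((K : ℝ) ^ m * (1 + nS m * 2 ^ m)) * Dsum A n p := by
  refine (nt_split A n (fun T => if ¬ Disjoint T U then p ^ (T \ U).card else 0)
    (fun T => by split_ifs <;> positivity)).trans ?_
  have hD0 : 0 ≤ Dsum A n p := Dsum_nonneg hp.le
  have e : ((K : ℝ) ^ m * (1 + nS m * 2 ^ m)) * Dsum A n p = (K : ℝ) ^ m * Dsum A n p +
    nS m * ((K : ℝ) ^ m * (2 ^ m * Dsum A n p)) := by ring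
  rw [e]
  apply add_le_add
  · simpa using inj_sum_D A n p hp.le U K hK hU
  · calc _ ≤ ∑ s ∈ relS A, (K : ℝ) ^ m * (2 ^ m * Dsum A n p) := by
          apply Finset.sum_le_sum
          intro s hs
          refine (inj_sum_D (contract A s) n p hp.le U K hK hU).trans ?_
          have hlt : Fintype.card (Quotient s) ≤ m :=
            (card_quot_lt s (Finset.mem_filter.1 hs).2.2.1).le
          have hK' : (1 : ℝ) ≤ K := by exact_mod_cast hK
          have := Ds_le A hm hA hS n p hp hp1 hnp hnc s hs
          have h0 : 0 ≤ Dsum (contract A s) n p := Dsum_nonneg hp.le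
          gcongr
      _ ≤ _ := by
          rw [Finset.sum_const, nsmul_eq_mul]
          exact mul_le_mul_of_nonneg_right (relS_card_le A hm hA hS n p hp hp1 hnp hnc) (by positivity)

end main
end Split

section Est
set_option linter.unusedSectionVars false
variable {r m : ℕ}

theorem Dsum_eq {α β : Type*} [Fintype α] [Fintype β] (B : Matrix α β ℤ) (n : ℕ) (p : ℝ) :
    Dsum B n p = ∑ Q ∈ (Finset.univ : Finset (Finset β)).filter (fun Q => Q.Nonempty),
      (n : ℝ) ^ fQ B Q * p ^ (Fintype.card β - Q.card) := by
  unfold Dsum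
  exact Finset.sum_congr rfl fun Q _ => by rw [Finset.card_compl]

/-- image of a solution -/
noncomputable def imS (A : Matrix (Fin r) (Fin m) ℤ) (n : ℕ) (a : {y // y ∈ ntF A n}) : Finset (Fin n) :=
  Finset.univ.image a.1

theorem imS_card_le (A : Matrix (Fin r) (Fin m) ℤ) (n : ℕ) (a : {y // y ∈ ntF A n}) :
    (imS A n a).card ≤ m := by
  refine Finset.card_image_le.trans ?_
  simp

theorem solF_subset_ntF (A : Matrix (Fin r) (Fin m) ℤ) (n : ℕ) : solF A n ⊆ ntF A n := by
  intro y hy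
  simp only [solF, ntF, Finset.mem_filter, Finset.mem_univ, true_and] at hy ⊢
  refine ⟨hy.1, ?_⟩
  show rkZ (contract A (Setoid.ker y)) = rkZ A
  have hc : ∀ i j, contract A (Setoid.ker y) i (Quotient.mk _ j) = A i j := by
    intro i j
    unfold contract
    have : Finset.univ.filter (fun j' => Quotient.mk (Setoid.ker y) j' = Quotient.mk (Setoid.ker y) j) = {j} := by
      ext j'
      simp only [Finset.mem_filter, Finset.mem_univ, true_and, Finset.mem_singleton]
      constructor
      · intro h; exact hy.2 (Quotient.exact h)
      · rintro rfl; rfl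
    rw [this, Finset.sum_singleton]
  rw [rkZ_eq, rkZ_eq]
  have : qcol (contract A (Setoid.ker y)) '' Set.univ = qcol A '' Set.univ := by
    ext v
    constructor
    · rintro ⟨c, -, rfl⟩
      induction c using Quotient.inductionOn with
      | h j => exact ⟨j, trivial, by funext i; simp only [qcol, hc]⟩
    · rintro ⟨j, -, rfl⟩
      exact ⟨Quotient.mk _ j, trivial, by funext i; simp only [qcol, hc]⟩
  rw [this]

/-- constant -/
noncomputable def cK (m : ℕ) : ℝ := (((2 * m : ℕ) : ℝ)) ^ m * (1 + nS m * 2 ^ m)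

theorem triSum_le (A : Matrix (Fin r) (Fin m) ℤ) (hm : 0 < m) (hA : IsPositiveMat A)
    (hS : IsStrictlyBalanced A) (n : ℕ) (p : ℝ≥0) (hp : 0 < (p : ℝ)) (hp1 : (p : ℝ) ≤ 1)
    (hnp : 1 ≤ (n : ℝ) * p) (hnc : 1 ≤ (n : ℝ) * (p : ℝ) ^ matDensity A) :
    triSum p (imS A n) ≤ ((1 + nS m) * cK m ^ 2) * ((n : ℝ) ^ dd A * (p : ℝ) ^ m) * Dsum A n p ^ 2 := by
  have hD0 : 0 ≤ Dsum A n p := Dsum_nonneg hp.le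
  have hcK : 0 ≤ cK m := by unfold cK; positivity
  have key : ∀ U : Finset (Fin n), U.card ≤ 2 * m →
      ∑ c : {y // y ∈ ntF A n}, (if ¬ Disjoint (imS A n c) U then (p : ℝ) ^ (imS A n c \ U).card else 0)
        ≤ cK m * Dsum A n p := by
    intro U hU
    have := nt_sum_D A hm hA hS n p hp hp1 hnp hnc U (2 * m) (by omega) hU
    rw [← Finset.sum_coe_sort] at this
    exact this
  have keyM : ∑ a : {y // y ∈ ntF A n}, (p : ℝ) ^ (imS A n a).card ≤
      (1 + nS m) * ((n : ℝ) ^ dd A * (p : ℝ) ^ m) := by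
    have := nt_sum_M A hm hA hS n p hp hp1 hnp hnc
    rw [← Finset.sum_coe_sort] at this
    exact this
  have h1 : ∀ a b, ∑ c, (if ¬Disjoint (imS A n a) (imS A n b) ∧ (¬Disjoint (imS A n a) (imS A n c) ∨ ¬Disjoint (imS A n b) (imS A n c))
      then (p : ℝ) ^ (imS A n a ∪ imS A n b ∪ imS A n c).card else 0) ≤
      (p : ℝ) ^ (imS A n a).card * ((if ¬ Disjoint (imS A n b) (imS A n a) then (p : ℝ) ^ (imS A n b \ imS A n a).card else 0)
        * (cK m * Dsum A n p)) := by
    intro a b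
    have hU : (imS A n a ∪ imS A n b).card ≤ 2 * m := by
      refine (Finset.card_union_le _ _).trans ?_
      have := imS_card_le A n a
      have := imS_card_le A n b
      omega
    by_cases hab : Disjoint (imS A n a) (imS A n b)
    · have hba := hab.symm
      simp [hab, hba]
    · have hba : ¬ Disjoint (imS A n b) (imS A n a) := fun h => hab h.symm
      rw [if_pos hba]
      have h2 := mul_le_mul_of_nonneg_left (key _ hU)
        (show 0 ≤ (p : ℝ) ^ (imS A n a).card * (p : ℝ) ^ (imS A n b \ imS A n a).card by positivity)
      rw [← mul_assoc]
      refine le_trans (le_of_eq ?_) h2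
      rw [Finset.mul_sum]
      apply Finset.sum_congr rfl
      intro c _
      have e1 : (¬Disjoint (imS A n a) (imS A n b) ∧ (¬Disjoint (imS A n a) (imS A n c) ∨ ¬Disjoint (imS A n b) (imS A n c))) ↔
          ¬ Disjoint (imS A n c) (imS A n a ∪ imS A n b) := by
        rw [Finset.disjoint_union_right, disjoint_comm (a := imS A n a) (b := imS A n c),
          disjoint_comm (a := imS A n b) (b := imS A n c)]
        tauto
      have e2 : (imS A n a ∪ imS A n b ∪ imS A n c).card = (imS A n a).card + (imS A n b \ imS A n a).card +
          (imS A n c \ (imS A n a ∪ imS A n b)).card := by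
        have q1 := Finset.card_sdiff_add_card (imS A n c) (imS A n a ∪ imS A n b)
        have q2 := Finset.card_sdiff_add_card (imS A n b) (imS A n a)
        rw [Finset.union_comm (imS A n c)] at q1
        rw [Finset.union_comm (imS A n b)] at q2
        omega
      by_cases h3 : Disjoint (imS A n c) (imS A n a ∪ imS A n b)
      · rw [if_neg (by rw [e1]; exact fun h => h h3), if_neg (fun h => h h3), mul_zero]
      · rw [if_pos (e1.2 h3), if_pos h3, e2, pow_add, pow_add]
  unfold triSum
  calc _ ≤ ∑ a, ∑ b, (p : ℝ) ^ (imS A n a).card * ((if ¬ Disjoint (imS A n b) (imS A n a) then (p : ℝ) ^ (imS A n b \ imS A n a).card else 0)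
        * (cK m * Dsum A n p)) := Finset.sum_le_sum fun a _ => Finset.sum_le_sum fun b _ => h1 a b
    _ ≤ ∑ a, (p : ℝ) ^ (imS A n a).card * ((cK m * Dsum A n p) * (cK m * Dsum A n p)) := by
        apply Finset.sum_le_sum; intro a _
        rw [← Finset.mul_sum, ← Finset.sum_mul]
        have := key (imS A n a) ((imS_card_le A n a).trans (by omega))
        gcongr
    _ ≤ ((1 + nS m) * ((n : ℝ) ^ dd A * (p : ℝ) ^ m)) * ((cK m * Dsum A n p) * (cK m * Dsum A n p)) := by
        rw [← Finset.sum_mul]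
        gcongr
    _ = _ := by ring

theorem variance_lower (A : Matrix (Fin r) (Fin m) ℤ) (n : ℕ) (hn : 0 < n) (p : ℝ≥0) (hp : 0 < (p : ℝ)) (h : p ≤ 1)
    (c : ℝ) (hc : 0 < c) (hlow : c * (n : ℝ) ^ dd A ≤ ((solF A n).card : ℝ)) :
    c ^ 2 * (1 - (p : ℝ)) * ((n : ℝ) ^ dd A * (p : ℝ) ^ m) * Dsum A n p ≤
      2 ^ m * variance (fun ω => ∑ a, indS (imS A n a) ω) (prodBern n p h) := by
  have hp1 : (p : ℝ) ≤ 1 := by exact_mod_cast h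
  have hn' : (0 : ℝ) < n := by exact_mod_cast hn
  obtain ⟨V, hV⟩ : ∃ V, V = variance (fun ω => ∑ a, indS (imS A n a) ω) (prodBern n p h) := ⟨_, rfl⟩
  rw [← hV]
  rw [variance_sum] at hV
  have hterm : ∀ a b, 0 ≤ (p : ℝ) ^ (imS A n a ∪ imS A n b).card - (p : ℝ) ^ ((imS A n a).card + (imS A n b).card) :=
    fun a b => sub_nonneg.2 (pow_le_pow_of_le_one hp.le hp1 (Finset.card_union_le _ _))
  have hV0 : 0 ≤ V := by
    rw [hV]; exact Finset.sum_nonneg fun a _ => Finset.sum_nonneg fun b _ => hterm a b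
  have hQ : ∀ Q : Finset (Fin m), Q.Nonempty →
      c ^ 2 * (1 - (p : ℝ)) * ((n : ℝ) ^ dd A * (p : ℝ) ^ m) * ((n : ℝ) ^ fQ A Q * (p : ℝ) ^ (m - Q.card)) ≤ V := by
    intro Q hQ
    have hQm : Q.card ≤ m := by simpa using Finset.card_le_univ Q
    have hQ1 : 1 ≤ Q.card := hQ.card_pos
    obtain ⟨T, hT⟩ : ∃ T, T = ((solF A n) ×ˢ (solF A n)).filter (fun z => ∀ j ∈ Q, z.1 j = z.2 j) := ⟨_, rfl⟩
    have hpair : (solF A n).card ^ 2 ≤ n ^ (Q.card - rQ A Q) * T.card := by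
      rw [hT]
      convert! pairs_agree A Q (solF A n) (fun y hy => (Finset.mem_filter.1 hy).2.1)
    have hTV : (T.card : ℝ) * ((p : ℝ) ^ (2 * m - Q.card) * (1 - p)) ≤ V := by
      have e : V = ∑ z ∈ (ntF A n) ×ˢ (ntF A n), ((p : ℝ) ^ (Finset.univ.image z.1 ∪ Finset.univ.image z.2).card
          - (p : ℝ) ^ ((Finset.univ.image z.1).card + (Finset.univ.image z.2).card)) := by
        rw [hV, Finset.sum_product, ← Finset.sum_coe_sort (ntF A n)]
        apply Finset.sum_congr rfl
        intro a _
        exact Finset.sum_coe_sort (ntF A n) (fun y => (p : ℝ) ^ (Finset.univ.image a.1 ∪ Finset.univ.image y).card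
          - (p : ℝ) ^ ((Finset.univ.image a.1).card + (Finset.univ.image y).card))
      rw [e]
      calc _ = ∑ z ∈ T, ((p : ℝ) ^ (2 * m - Q.card) * (1 - p)) := by rw [Finset.sum_const, nsmul_eq_mul]
        _ ≤ ∑ z ∈ T, ((p : ℝ) ^ (Finset.univ.image z.1 ∪ Finset.univ.image z.2).card
          - (p : ℝ) ^ ((Finset.univ.image z.1).card + (Finset.univ.image z.2).card)) := by
            apply Finset.sum_le_sum
            rintro ⟨y, y'⟩ hz
            rw [hT] at hz
            simp only [Finset.mem_filter, Finset.mem_product, solF, Finset.mem_univ, true_and] at hz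
            obtain ⟨⟨⟨-, hy⟩, ⟨-, hy'⟩⟩, hag⟩ := hz
            have c1 : (Finset.univ.image y).card = m := by
              rw [Finset.card_image_of_injective _ hy]; simp
            have c2 : (Finset.univ.image y').card = m := by
              rw [Finset.card_image_of_injective _ hy']; simp
            have c3 : Q.card ≤ (Finset.univ.image y ∩ Finset.univ.image y').card := by
              rw [← Finset.card_image_of_injective Q hy]
              apply Finset.card_le_card
              intro a ha
              obtain ⟨j, hj, rfl⟩ := Finset.mem_image.1 ha
              rw [Finset.mem_inter]
              exact ⟨Finset.mem_image_of_mem _ (Finset.mem_univ _), by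
                rw [hag j hj]; exact Finset.mem_image_of_mem _ (Finset.mem_univ _)⟩
            have c4 := Finset.card_union_add_card_inter (Finset.univ.image y) (Finset.univ.image y')
            simp only
            rw [c1, c2]
            obtain ⟨u, hu⟩ : ∃ u, u = (Finset.univ.image y ∪ Finset.univ.image y').card := ⟨_, rfl⟩
            rw [← hu] at c4 ⊢
            have hu2 : u ≤ 2 * m - Q.card := by omega
            obtain ⟨k, hk⟩ : ∃ k, m + m = u + (k + 1) := ⟨2 * m - u - 1, by omega⟩
            rw [hk, pow_add, ← mul_one_sub]
            apply mul_le_mul (pow_le_pow_of_le_one hp.le hp1 hu2) _ (by linarith) (by positivity)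
            have : (p : ℝ) ^ (k + 1) ≤ p := pow_le_of_le_one hp.le hp1 (by omega)
            linarith
        _ ≤ _ := by
            apply Finset.sum_le_sum_of_subset_of_nonneg
            · rw [hT]
              exact (Finset.filter_subset _ _).trans
                (Finset.product_subset_product (solF_subset_ntF A n) (solF_subset_ntF A n))
            · intro z _ _
              exact sub_nonneg.2 (pow_le_pow_of_le_one hp.le hp1 (Finset.card_union_le _ _))
    have hef := eQ_add_fQ A Q
    have hT2 : c ^ 2 * ((n : ℝ) ^ dd A * (n : ℝ) ^ fQ A Q) ≤ T.card := by
      have h3 : ((solF A n).card : ℝ) ^ 2 ≤ (n : ℝ) ^ eQ A Q * T.card := by exact_mod_cast hpair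
      have h4 : (c * (n : ℝ) ^ dd A) ^ 2 ≤ ((solF A n).card : ℝ) ^ 2 :=
        pow_le_pow_left₀ (by positivity) hlow 2
      have h5 : (n : ℝ) ^ eQ A Q * (c ^ 2 * ((n : ℝ) ^ dd A * (n : ℝ) ^ fQ A Q)) = (c * (n : ℝ) ^ dd A) ^ 2 := by
        have : (n : ℝ) ^ dd A = (n : ℝ) ^ eQ A Q * (n : ℝ) ^ fQ A Q := by rw [← pow_add, hef]
        rw [this]; ring
      exact le_of_mul_le_mul_left (h5.le.trans (h4.trans h3)) (by positivity)
    refine le_trans ?_ hTV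
    have e6 : (p : ℝ) ^ (2 * m - Q.card) = (p : ℝ) ^ m * (p : ℝ) ^ (m - Q.card) := by
      rw [← pow_add]; congr 1; omega
    rw [e6]
    calc _ = (c ^ 2 * ((n : ℝ) ^ dd A * (n : ℝ) ^ fQ A Q)) * ((p : ℝ) ^ m * (p : ℝ) ^ (m - Q.card) * (1 - p)) := by ring
      _ ≤ _ := by
        apply mul_le_mul_of_nonneg_right hT2
        have : 0 ≤ 1 - (p : ℝ) := by linarith
        positivity
  rw [Dsum_eq, Finset.mul_sum]
  calc _ ≤ ∑ Q ∈ (Finset.univ : Finset (Finset (Fin m))).filter (fun Q => Q.Nonempty), V := by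
        apply Finset.sum_le_sum
        intro Q hQ'
        rw [Fintype.card_fin]
        exact hQ Q (Finset.mem_filter.1 hQ').2
    _ ≤ ∑ Q : Finset (Fin m), V := 
        Finset.sum_le_sum_of_subset_of_nonneg (Finset.filter_subset _ _) (fun _ _ _ => hV0)
    _ = _ := by
        rw [Finset.sum_const, Finset.card_univ, Fintype.card_finset, nsmul_eq_mul, Fintype.card_fin]; push_cast; rfl

end Est

section Fin1
set_option linter.unusedSectionVars false
variable {r m : ℕ}

theorem solCount_eq (A : Matrix (Fin r) (Fin m) ℤ) (n : ℕ) (ω : Fin n → Bool) :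
    (solCount (nontrivialSols A 0) n ω : ℝ) = ∑ a, indS (imS A n a) ω := by
  unfold solCount indS
  rw [Finset.sum_boole]
  congr 1
  have h1 : (Finset.univ.filter (fun a : {y // y ∈ ntF A n} => ∀ i ∈ imS A n a, ω i = true)).card =
      Nat.card {a : {y // y ∈ ntF A n} // ∀ i ∈ imS A n a, ω i = true} := by
    rw [Nat.card_eq_fintype_card, Fintype.card_subtype]
  have hker : ∀ y : Fin m → Fin n, Setoid.ker (valZ y) = Setoid.ker y := by
    intro y
    ext a b
    simp only [Setoid.ker_def, valZ]
    constructor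
    · intro h; apply Fin.ext; omega
    · intro h; rw [h]
  have h2 : Nat.card {a : {y // y ∈ ntF A n} // ∀ i ∈ imS A n a, ω i = true} =
      Nat.card {x : Fin m → ℤ // x ∈ nontrivialSols A 0 ∧ ∀ j, selected ω (x j)} := by
    let F : {a : {y // y ∈ ntF A n} // ∀ i ∈ imS A n a, ω i = true} →
        {x : Fin m → ℤ // x ∈ nontrivialSols A 0 ∧ ∀ j, selected ω (x j)} := fun a =>
      ⟨valZ a.1.1, by
        have h := a.1.2
        simp only [ntF, Finset.mem_filter, Finset.mem_univ, true_and] at h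
        refine ⟨⟨h.1, ?_⟩, fun j => ⟨a.1.1 j, rfl, a.2 _ (Finset.mem_image_of_mem _ (Finset.mem_univ _))⟩⟩
        rw [hker]; exact h.2⟩
    apply Nat.card_eq_of_bijective F
    constructor
    · intro a b hab
      have h : valZ a.1.1 = valZ b.1.1 := congrArg Subtype.val hab
      apply Subtype.ext
      apply Subtype.ext
      funext j
      exact valZ_sub_eq_zero.1 (sub_eq_zero.2 (congrFun h j))
    · rintro ⟨x, hx, hs⟩
      have hs' := hs
      choose y hy hω using hs'
      have hxy : valZ y = x := by funext j; rw [hy j]; rfl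
      subst hxy
      refine ⟨⟨⟨y, ?_⟩, ?_⟩, rfl⟩
      · simp only [ntF, Finset.mem_filter, Finset.mem_univ, true_and]
        refine ⟨hx.1, ?_⟩
        have := hx.2
        rw [hker] at this; exact this
      · intro i hi
        obtain ⟨j, -, rfl⟩ := Finset.mem_image.1 hi
        exact hω j
  rw [← h2, ← h1]

theorem D_mul_L_le (A : Matrix (Fin r) (Fin m) ℤ) (hA : IsPositiveMat A) (n : ℕ) (hn : 0 < n) (p : ℝ)
    (hp : 0 < p) (hp1 : p ≤ 1) (hnc : 1 ≤ (n : ℝ) * p ^ matDensity A) (L : ℝ) 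
    (hL1 : L ≤ (n : ℝ) * (1 - p) / 2 ^ m) (hL2 : L ≤ (n : ℝ) * p ^ matDensity A / 2) :
    Dsum A n p * L ≤ 2 ^ m * ((1 - p) * ((n : ℝ) ^ dd A * p ^ m)) := by
  have hn1 : (1 : ℝ) ≤ n := by exact_mod_cast hn
  have hq : 0 ≤ 1 - p := by linarith
  have h0 : 0 ≤ (1 - p) * ((n : ℝ) ^ dd A * p ^ m) := by positivity
  have hQ : ∀ Q : Finset (Fin m), Q.Nonempty → ((n : ℝ) ^ fQ A Q * p ^ (m - Q.card)) * L ≤ 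
      (1 - p) * ((n : ℝ) ^ dd A * p ^ m) := by
    intro Q hQ
    have hQm : Q.card ≤ m := by simpa using Finset.card_le_univ Q
    have he := eQ_pos A hA Q hQ
    have hLb : L ≤ (1 - p) * ((n : ℝ) ^ eQ A Q * p ^ Q.card) := by
      rcases le_or_gt (1/2) p with h | h
      · refine hL1.trans ?_
        have a1 : (n : ℝ) ≤ (n : ℝ) ^ eQ A Q := le_self_pow₀ hn1 (by omega)
        have a2 : (1 / 2 : ℝ) ^ m ≤ p ^ Q.card := by
          calc (1 / 2 : ℝ) ^ m ≤ (1 / 2) ^ Q.card := pow_le_pow_of_le_one (by norm_num) (by norm_num) hQm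
            _ ≤ _ := pow_le_pow_left₀ (by norm_num) h _
        calc (n : ℝ) * (1 - p) / 2 ^ m = (1 - p) * ((n : ℝ) * (1 / 2) ^ m) := by
              rw [one_div, inv_pow]; ring
          _ ≤ _ := by gcongr
      · refine hL2.trans ?_
        have a1 := scale_ge n p (matDensity A) (by positivity) hp hp1 (eQ A Q) Q.card he (density_ge A Q hQ) hnc
        calc (n : ℝ) * p ^ matDensity A / 2 = (1 / 2) * ((n : ℝ) * p ^ matDensity A) := by ring
          _ ≤ _ := by
            apply mul_le_mul (by linarith) a1 (by linarith) hq
    have hef := eQ_add_fQ A Q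
    calc _ ≤ ((n : ℝ) ^ fQ A Q * p ^ (m - Q.card)) * ((1 - p) * ((n : ℝ) ^ eQ A Q * p ^ Q.card)) := by gcongr
      _ = (1 - p) * ((n : ℝ) ^ (eQ A Q + fQ A Q) * p ^ (Q.card + (m - Q.card))) := by rw [pow_add, pow_add]; ring
      _ = _ := by rw [hef, Nat.add_sub_cancel' hQm]
  rw [Dsum_eq, Finset.sum_mul]
  calc _ ≤ ∑ Q ∈ (Finset.univ : Finset (Finset (Fin m))).filter (fun Q => Q.Nonempty), (1 - p) * ((n : ℝ) ^ dd A * p ^ m) := by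
        apply Finset.sum_le_sum
        intro Q hQ'
        rw [Fintype.card_fin]
        exact hQ Q (Finset.mem_filter.1 hQ').2
    _ ≤ ∑ Q : Finset (Fin m), (1 - p) * ((n : ℝ) ^ dd A * p ^ m) := 
        Finset.sum_le_sum_of_subset_of_nonneg (Finset.filter_subset _ _) (fun _ _ _ => h0)
    _ = _ := by
        rw [Finset.sum_const, Finset.card_univ, Fintype.card_finset, nsmul_eq_mul, Fintype.card_fin]; push_cast; rfl

theorem ratio_bound (q tri V M D L Ct κ E : ℝ) (hq : 0 < q) (hM : 0 < M) (hD : 0 < D) (hL : 0 < L)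
    (hκ : 0 < κ) (ht0 : 0 ≤ tri) (ht : tri ≤ Ct * M * D ^ 2) (hV : κ * (q * M * D) ≤ V)
    (hDL : D * L ≤ E * (q * M)) :
    q * tri / Real.sqrt V ^ 3 ≤ Real.sqrt (Ct ^ 2 * E / κ ^ 3 / L) := by
  have hx : 0 < κ * (q * M * D) := by positivity
  have hV0 : 0 < V := hx.trans_le hV
  apply Real.le_sqrt_of_sq_le
  have hs : (Real.sqrt V ^ 3) ^ 2 = V ^ 3 := by
    rw [← pow_mul, mul_comm, pow_mul, Real.sq_sqrt hV0.le]
  rw [div_pow, hs, div_div, div_le_div_iff₀ (by positivity) (by positivity)]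
  have h1 : (q * tri) ^ 2 ≤ q ^ 2 * (Ct * M * D ^ 2) ^ 2 := by
    rw [mul_pow]
    gcongr
  have h2 : (κ * (q * M * D)) ^ 3 ≤ V ^ 3 := pow_le_pow_left₀ hx.le hV 3
  have hE : 0 ≤ E := by
    by_contra hE
    push Not at hE
    have : E * (q * M) < 0 := mul_neg_of_neg_of_pos hE (by positivity)
    have : 0 < D * L := by positivity
    linarith
  calc (q * tri) ^ 2 * (κ ^ 3 * L) ≤ q ^ 2 * (Ct * M * D ^ 2) ^ 2 * (κ ^ 3 * L) := by gcongr
    _ = (Ct ^ 2 * κ ^ 3 * q ^ 2 * M ^ 2 * D ^ 3) * (D * L) := by ring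
    _ ≤ (Ct ^ 2 * κ ^ 3 * q ^ 2 * M ^ 2 * D ^ 3) * (E * (q * M)) := by gcongr
    _ = Ct ^ 2 * E * (κ * (q * M * D)) ^ 3 := by ring
    _ ≤ _ := by gcongr

end Fin1

section Fin2
set_option linter.unusedSectionVars false
variable {r m : ℕ}

theorem density_ge_one (A : Matrix (Fin r) (Fin m) ℤ) (hm : 0 < m) (hA : IsPositiveMat A) :
    1 ≤ matDensity A := by
  have hne : ({⟨0, hm⟩} : Finset (Fin m)).Nonempty := by simp
  have h := density_ge A _ hne
  have he1 := eQ_pos A hA _ hne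
  have he2 : eQ A {⟨0, hm⟩} ≤ 1 := by unfold eQ; simp
  have he : eQ A {⟨0, hm⟩} = 1 := le_antisymm he2 he1
  rw [he] at h
  simpa using h

theorem main_bound (A : Matrix (Fin r) (Fin m) ℤ) (hm : 0 < m) (hA : IsPositiveMat A)
    (hS : IsStrictlyBalanced A) (p : ℕ → ℝ≥0) (hp : ∀ n, p n ≤ 1)
    (h1 : Tendsto (fun n : ℕ => (n : ℝ) * (1 - (p n : ℝ))) atTop atTop)
    (h2 : Tendsto (fun n : ℕ => (n : ℝ) * (p n : ℝ) ^ (matDensity A)) atTop atTop) (t : ℝ) :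
    Tendsto (fun n : ℕ => ∫ ω, cexpI (t * ((∑ a, indS (imS A n a) ω -
        ∫ ω', ∑ a, indS (imS A n a) ω' ∂(prodBern n (p n) (hp n))) /
          Real.sqrt (variance (fun ω => ∑ a, indS (imS A n a) ω) (prodBern n (p n) (hp n)))))
            ∂(prodBern n (p n) (hp n))) atTop (𝓝 (Complex.exp (- (t : ℂ) ^ 2 / 2))) := by
  obtain ⟨c, hc, n0, hlow⟩ := sol_lower A hA
  have hc1 := density_ge_one A hm hA
  let L : ℕ → ℝ := fun n => min ((n : ℝ) * (1 - (p n : ℝ)) / 2 ^ m) ((n : ℝ) * (p n : ℝ) ^ (matDensity A) / 2)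
  have hL : Tendsto L atTop atTop := 
    tendsto_atTop.2 fun b => by
      filter_upwards [(h1.atTop_div_const (show (0:ℝ) < 2 ^ m by positivity)).eventually_ge_atTop b,
        (h2.atTop_div_const (show (0:ℝ) < 2 by norm_num)).eventually_ge_atTop b] with n a1 a2
      exact le_min a1 a2
  let Ct : ℝ := (1 + nS m) * cK m ^ 2
  let κ : ℝ := c ^ 2 / 2 ^ m
  have hκ : 0 < κ := by positivity
  have hlim : Tendsto (fun n => 3 * |t| ^ 3 * (cM m * Real.sqrt (Ct ^ 2 * 2 ^ m / κ ^ 3 / L n))) atTop (𝓝 0) := by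
    have a1 : Tendsto (fun n => Ct ^ 2 * 2 ^ m / κ ^ 3 / L n) atTop (𝓝 0) := hL.const_div_atTop _
    have a2 := ((Real.continuous_sqrt.tendsto 0).comp a1)
    rw [Real.sqrt_zero] at a2
    have a3 := (a2.const_mul (cM m)).const_mul (3 * |t| ^ 3)
    simpa using a3
  rw [tendsto_iff_norm_sub_tendsto_zero]
  refine squeeze_zero' (Eventually.of_forall fun n => norm_nonneg _) ?_ hlim
  filter_upwards [eventually_ge_atTop n0, eventually_gt_atTop 0, h1.eventually_ge_atTop 1,
    h2.eventually_ge_atTop 1, hL.eventually_gt_atTop 0] with n hn0 hn a1 a2 a3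
  have hp1 : (p n : ℝ) ≤ 1 := by exact_mod_cast hp n
  have hn' : (0 : ℝ) < n := by exact_mod_cast hn
  have hp0 : (0 : ℝ) < p n := by
    rcases (p n).coe_nonneg.lt_or_eq with h | h
    · exact h
    · rw [← h, Real.zero_rpow (by linarith)] at a2
      norm_num at a2
  have hq : (0 : ℝ) < 1 - p n := by
    by_contra hq
    push Not at hq
    nlinarith
  have hnp : 1 ≤ (n : ℝ) * p n := by
    refine a2.trans ?_
    apply mul_le_mul_of_nonneg_left _ hn'.le
    calc (p n : ℝ) ^ matDensity A ≤ (p n : ℝ) ^ (1 : ℝ) := Real.rpow_le_rpow_of_exponent_ge hp0 hp1 hc1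
      _ = _ := Real.rpow_one _
  obtain ⟨V, hV⟩ : ∃ V, V = variance (fun ω => ∑ a, indS (imS A n a) ω) (prodBern n (p n) (hp n)) := ⟨_, rfl⟩
  have hlow' : c * (n : ℝ) ^ dd A ≤ ((solF A n).card : ℝ) := hlow n hn0
  have hvl := variance_lower A n hn (p n) hp0 (hp n) c hc hlow'
  rw [← hV] at hvl ⊢
  have hM : 0 < (n : ℝ) ^ dd A * (p n : ℝ) ^ m := by positivity
  have hD : 0 < Dsum A n (p n) := by
    have hne : ({⟨0, hm⟩} : Finset (Fin m)).Nonempty := by simp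
    refine lt_of_lt_of_le ?_ (Dterm_le (B := A) (n := n) hp0.le hne)
    positivity
  have hVl : κ * ((1 - (p n : ℝ)) * ((n : ℝ) ^ dd A * (p n : ℝ) ^ m) * Dsum A n (p n)) ≤ V := by
    have h2m : (0 : ℝ) < 2 ^ m := by positivity
    simp only [κ]
    rw [div_mul_eq_mul_div, div_le_iff₀ h2m]
    linarith [hvl]
  have hV0 : 0 < V := lt_of_lt_of_le (by positivity) hVl
  have htri := triSum_le A hm hA hS n (p n) hp0 hp1 hnp a2
  have htri0 : 0 ≤ triSum (p n) (imS A n) := by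
    unfold triSum
    refine Finset.sum_nonneg fun a _ => Finset.sum_nonneg fun b _ => Finset.sum_nonneg fun c _ => ?_
    split_ifs <;> positivity
  have hDL := D_mul_L_le A hA n hn (p n) hp0 hp1 a2 (L n) (min_le_left _ _) (min_le_right _ _)
  have hrb := ratio_bound (1 - (p n : ℝ)) (triSum (p n) (imS A n)) V ((n : ℝ) ^ dd A * (p n : ℝ) ^ m)
    (Dsum A n (p n)) (L n) Ct κ (2 ^ m) hq hM hD a3 hκ htri0 htri hVl hDL
  have hb := clt_bound (p n) (hp n) (imS A n) m (imS_card_le A n) (Real.sqrt V) (Real.sqrt_pos.2 hV0)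
    (by rw [Real.sq_sqrt hV0.le, hV]) t
  refine hb.trans ?_
  have hcM : 0 ≤ cM m := by unfold cM; positivity
  have e : cM m * (1 - (p n : ℝ)) * triSum (p n) (imS A n) / Real.sqrt V ^ 3 =
    cM m * ((1 - (p n : ℝ)) * triSum (p n) (imS A n) / Real.sqrt V ^ 3) := by ring
  rw [e]
  gcongr

theorem clt_core (A : Matrix (Fin r) (Fin m) ℤ) (hm : 0 < m) (hA : IsPositiveMat A)
    (hS : IsStrictlyBalanced A) (p : ℕ → ℝ≥0) (hp : ∀ n, p n ≤ 1)
    (h1 : Tendsto (fun n : ℕ => (n : ℝ) * (1 - (p n : ℝ))) atTop atTop)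
    (h2 : Tendsto (fun n : ℕ => (n : ℝ) * (p n : ℝ) ^ (matDensity A)) atTop atTop) (f : ℝ →ᵇ ℝ) :
    Tendsto (fun n : ℕ => ∫ ω, f ((∑ a, indS (imS A n a) ω -
        ∫ ω', ∑ a, indS (imS A n a) ω' ∂(prodBern n (p n) (hp n))) /
          Real.sqrt (variance (fun ω => ∑ a, indS (imS A n a) ω) (prodBern n (p n) (hp n))))
            ∂(prodBern n (p n) (hp n))) atTop (𝓝 (∫ x, f x ∂ gaussianReal 0 1)) := by
  have hmb := main_bound A hm hA hS p hp h1 h2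
  obtain ⟨W, hW⟩ : ∃ W : (n : ℕ) → (Fin n → Bool) → ℝ, W = fun n ω => (∑ a, indS (imS A n a) ω -
        ∫ ω', ∑ a, indS (imS A n a) ω' ∂(prodBern n (p n) (hp n))) /
          Real.sqrt (variance (fun ω => ∑ a, indS (imS A n a) ω) (prodBern n (p n) (hp n))) := ⟨_, rfl⟩
  have hWm : ∀ n, AEMeasurable (W n) (prodBern n (p n) (hp n)) := fun n => Measurable.of_discrete.aemeasurable
  let μ : ℕ → ProbabilityMeasure ℝ := fun n =>
    ⟨(prodBern n (p n) (hp n)).map (W n), Measure.isProbabilityMeasure_map (hWm n)⟩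
  let μ0 : ProbabilityMeasure ℝ := ⟨gaussianReal 0 1, inferInstance⟩
  have hmb' : ∀ t, Tendsto (fun n => ∫ ω, cexpI (t * W n ω) ∂(prodBern n (p n) (hp n))) atTop
      (𝓝 (Complex.exp (- (t : ℂ) ^ 2 / 2))) := by
    rw [hW]; exact hmb
  have hconv : Tendsto μ atTop (𝓝 μ0) := by
    apply ProbabilityMeasure.tendsto_of_tendsto_charFun
    intro t
    have e0 : charFun (μ0 : Measure ℝ) t = Complex.exp (- (t : ℂ) ^ 2 / 2) := by
      show charFun (gaussianReal 0 1) t = _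
      rw [charFun_gaussianReal]
      congr 1
      simp
      ring
    have e1 : ∀ n, charFun (μ n : Measure ℝ) t = ∫ ω, cexpI (t * W n ω) ∂(prodBern n (p n) (hp n)) := by
      intro n
      show charFun ((prodBern n (p n) (hp n)).map (W n)) t = _
      rw [charFun_apply_real, integral_map (hWm n) (by fun_prop)]
      congr 1
      funext ω
      unfold cexpI
      push_cast
      ring_nf
    rw [e0]
    simp_rw [e1]
    exact hmb' t
  have := ProbabilityMeasure.tendsto_iff_forall_integral_tendsto.1 hconv f
  have e2 : ∀ n, ∫ x, f x ∂(μ n : Measure ℝ) = ∫ ω, f (W n ω) ∂(prodBern n (p n) (hp n)) := by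
    intro n
    show ∫ x, f x ∂((prodBern n (p n) (hp n)).map (W n)) = _
    rw [integral_map (hWm n) f.continuous.aestronglyMeasurable]
  simp_rw [e2, hW] at this
  exact this

end Fin2

/-- **Theorem (distribution of non-trivial solutions, strictly balanced homogeneous case).** -/
theorem nontrivialSolutions_clt {r m : ℕ} (hr : 0 < r) (hrm : r < m)
    (A : Matrix (Fin r) (Fin m) ℤ) (hApos : IsPositiveMat A) (hAab : IsAbundantMat A)
    (hAsb : IsStrictlyBalanced A)
    (hb : ∃ x : Fin m → ℤ, A.mulVec x = 0)
    (p : ℕ → ℝ≥0) (hp : ∀ n, p n ≤ 1)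
    (h1 : Tendsto (fun n : ℕ => (n : ℝ) * (1 - (p n : ℝ))) atTop atTop)
    (h2 : Tendsto (fun n : ℕ => (n : ℝ) * (p n : ℝ) ^ (matDensity A)) atTop atTop) :
    ∀ f : ℝ →ᵇ ℝ,
      Tendsto (fun n : ℕ =>
          ∫ ω, f (((solCount (nontrivialSols A 0) n ω : ℝ) -
              ∫ ω', (solCount (nontrivialSols A 0) n ω' : ℝ) ∂ prodBern n (p n) (hp n)) /
            Real.sqrt (variance (fun ω' => (solCount (nontrivialSols A 0) n ω' : ℝ))
              (prodBern n (p n) (hp n)))) ∂ prodBern n (p n) (hp n))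
        atTop (𝓝 (∫ x, f x ∂ gaussianReal 0 1)) := by
  intro f
  simp_rw [solCount_eq A]
  exact clt_core A (by omega) hApos hAsb p hp h1 h2 f
end

section
/- Let m > r be positive integers, A ∈ ℤ^{r×m} a positive and abundant matrix, b ∈ ℤ^r with S(A,b) ≠ ∅, and 𝔓 ⊆ 𝔓(A) a set of partitions of [m] containing the partition into singletons and such that every 𝔭 ∈ 𝔓 with S_0(A_𝔭,b) ≠ ∅ lies in 𝔓_0(A). Fix integers k ≥ 2 and 1 ≤ s ≤ ⌊k/2⌋, and let 𝔖'_{k,s}(n) be the set of k-tuples (x_1,…,x_k) of elements of S_𝔓(A,b) ∩ [n]^m for which there is a partition of [k] into s classes, each of size at least 2, such that {x_i} ∩ {x_j} = ∅ whenever i and j lie in different classes, and for each class there is a single element a with {x_i} ∩ {x_j} = {a} for all distinct i, j in that class (an s-milky way). Then |𝔖'_{k,s}(n)| = Θ(n^{k(m − rk(A) − 1) + s}) as n → ∞. -/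
open Matrix Finset MeasureTheory ProbabilityTheory Filter Topology
open scoped BoundedContinuousFunction NNReal ENNReal

attribute [local instance] Classical.propDecidable

/-- A `k`-tuple `χ` of solutions is an `s`-milky way if `[k]` can be split into `s`
classes, each of size at least two, such that solutions in different classes are
entry-disjoint and, within each class, any two distinct solutions share exactly one
common entry, the same for the whole class. -/
def IsMilkyWay {m : ℕ} (k s : ℕ) (χ : Fin k → (Fin m → ℤ)) : Prop :=
  ∃ f : Fin k → Fin s, Function.Surjective f ∧
    (∀ c : Fin s, 2 ≤ (Finset.univ.filter fun i => f i = c).card) ∧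
    (∀ i j : Fin k, f i ≠ f j →
      (Finset.image (χ i) Finset.univ) ∩ (Finset.image (χ j) Finset.univ) = ∅) ∧
    (∀ c : Fin s, ∃ a : ℤ, ∀ i j : Fin k, i ≠ j → f i = c → f j = c →
      (Finset.image (χ i) Finset.univ) ∩ (Finset.image (χ j) Finset.univ) = {a})

lemma mw_exists_coords {ι : Type} [Fintype ι] : ∀ (d : ℕ) (W : Submodule ℚ (ι → ℚ)),
    Module.finrank ℚ W ≤ d →
    ∃ F : Finset ι, F.card ≤ Module.finrank ℚ W ∧ ∀ w ∈ W, (∀ i ∈ F, w i = 0) → w = 0 := by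
  intro d
  induction d with
  | zero =>
    intro W hW
    have : W = ⊥ := Submodule.finrank_eq_zero.mp (by omega)
    subst this
    exact ⟨∅, by simp, fun w hw _ => by simpa using hw⟩
  | succ d ih =>
    intro W hW
    by_cases h : ∃ w ∈ W, ∃ i, w i ≠ 0
    · obtain ⟨w, hw, i, hi⟩ := h
      let W' : Submodule ℚ (ι → ℚ) := W ⊓ LinearMap.ker (LinearMap.proj (R := ℚ) (φ := fun _ : ι => ℚ) i)
      have hlt : W' < W := by
        refine lt_of_le_of_ne inf_le_left ?_
        intro he
        rw [← he] at hw
        exact hi (by simpa [W'] using hw.2)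
      have hf := Submodule.finrank_lt_finrank_of_lt hlt
      obtain ⟨F, hF, hF'⟩ := ih W' (by omega)
      refine ⟨insert i F, (Finset.card_insert_le _ _).trans (by omega), ?_⟩
      intro v hv hz
      apply hF' v
      · exact ⟨hv, by simpa using hz i (by simp)⟩
      · intro j hj
        exact hz j (by simp [hj])
    · push Not at h
      exact ⟨∅, by simp, fun w hw _ => funext (h w hw)⟩

def mwK {r m : ℕ} (A : Matrix (Fin r) (Fin m) ℤ) : Submodule ℚ (Fin m → ℚ) :=
  LinearMap.ker (A.map (Int.cast : ℤ → ℚ)).mulVecLin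

lemma mw_finrank_K {r m : ℕ} (A : Matrix (Fin r) (Fin m) ℤ) :
    Module.finrank ℚ (mwK A) = m - rkZ A := by
  have h := LinearMap.finrank_range_add_finrank_ker (A.map (Int.cast : ℤ → ℚ)).mulVecLin
  have h2 : Module.finrank ℚ (Fin m → ℚ) = m := by simp
  unfold rkZ mwK
  rw [Matrix.rank]
  omega

lemma mw_mem_K {r m : ℕ} (A : Matrix (Fin r) (Fin m) ℤ) (x : Fin m → ℤ) :
    (fun j => (x j : ℚ)) ∈ mwK A ↔ A.mulVec x = 0 := by
  unfold mwK
  rw [LinearMap.mem_ker, Matrix.mulVecLin_apply, funext_iff, funext_iff]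
  apply forall_congr'
  intro i
  simp only [Matrix.mulVec, dotProduct, Matrix.map_apply, Pi.zero_apply]
  exact_mod_cast Iff.rfl

def mwK0 {r m : ℕ} (A : Matrix (Fin r) (Fin m) ℤ) (p : Fin m) : Submodule ℚ (Fin m → ℚ) :=
  Submodule.map (mwK A).subtype
    (LinearMap.ker ((LinearMap.proj (R := ℚ) (φ := fun _ : Fin m => ℚ) p).domRestrict (mwK A)))

lemma mw_mem_K0 {r m : ℕ} (A : Matrix (Fin r) (Fin m) ℤ) (p : Fin m) (x : Fin m → ℚ) :
    x ∈ mwK0 A p ↔ x ∈ mwK A ∧ x p = 0 := by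
  simp [mwK0, and_comm]

lemma mw_finrank_K0 {r m : ℕ} (A : Matrix (Fin r) (Fin m) ℤ) (hA : IsPositiveMat A) (p : Fin m) :
    Module.finrank ℚ (mwK0 A p) + 1 = Module.finrank ℚ (mwK A) := by
  obtain ⟨⟨v, hv, hvp⟩, -⟩ := hA
  unfold mwK0
  rw [LinearEquiv.finrank_eq (Submodule.equivMapOfInjective _ (mwK A).injective_subtype _).symm]
  have : (LinearMap.proj (R := ℚ) (φ := fun _ : Fin m => ℚ) p).domRestrict (mwK A) ≠ 0 := by
    intro h
    have := LinearMap.congr_fun h ⟨fun j => (v j : ℚ), (mw_mem_K A v).2 hv⟩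
    have h3 := hvp p
    simp at this
    omega
  exact Module.Dual.finrank_ker_add_one_of_ne_zero this

lemma mw_clear {ι : Type} [Finite ι] (x : ι → ℚ) :
    ∃ (N : ℤ) (y : ι → ℤ), N ≠ 0 ∧ (fun j => (y j : ℚ)) = (N : ℚ) • x := by
  obtain ⟨b, hb⟩ := IsLocalization.exist_integer_multiples_of_finite (nonZeroDivisors ℤ) x
  choose y hy using hb
  refine ⟨b, y, nonZeroDivisors.coe_ne_zero b, ?_⟩
  funext j
  simpa using hy j

lemma mw_int_basis {m : ℕ} (W : Submodule ℚ (Fin m → ℚ)) (d : ℕ) (hd : Module.finrank ℚ W = d) :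
    ∃ y : Fin d → Fin m → ℤ, (∀ l, (fun j => (y l j : ℚ)) ∈ W) ∧
      ∀ t : Fin d → ℤ, (∀ p, ∑ l, t l * y l p = 0) → t = 0 := by
  let B := Module.finBasisOfFinrankEq ℚ W hd
  choose N y hN hy using fun l => mw_clear (B l : Fin m → ℚ)
  refine ⟨y, fun l => ?_, fun t ht => ?_⟩
  · rw [hy]
    exact W.smul_mem _ (B l).2
  · have h := Fintype.linearIndependent_iff.1 B.linearIndependent (fun l => (t l : ℚ) * N l) (by
      apply Subtype.ext
      funext p
      have h1 := ht p
      have h2 : ((∑ l, t l * y l p : ℤ) : ℚ) = 0 := by rw [h1]; simp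
      simp only [AddSubmonoidClass.coe_finsetSum, Finset.sum_apply, ZeroMemClass.coe_zero, Pi.zero_apply]
      rw [← h2]
      push_cast
      apply Finset.sum_congr rfl
      intro l _
      have := congrFun (hy l) p
      simp only [Pi.smul_apply, smul_eq_mul] at this
      rw [this]
      simp [mul_assoc])
    funext l
    have := h l
    simpa [hN l] using this

lemma mw_abundant {r m : ℕ} (A : Matrix (Fin r) (Fin m) ℤ) (hA : IsAbundantMat A)
    (o p : Fin m) (hop : p ≠ o) : ∃ w : Fin m → ℤ, A.mulVec w = 0 ∧ w o = 0 ∧ w p ≠ 0 := by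
  suffices h : ∃ w : Fin m → ℚ, w ∈ mwK A ∧ w o = 0 ∧ w p ≠ 0 by
    obtain ⟨w, hw, h0, h1⟩ := h
    obtain ⟨N, y, hN, hy⟩ := mw_clear w
    refine ⟨y, (mw_mem_K A y).1 (hy ▸ (mwK A).smul_mem _ hw), ?_, ?_⟩
    · have := congrFun hy o
      simpa [h0] using this
    · have := congrFun hy p
      intro h
      simp [h, hN] at this
      exact h1 this
  let Q : Finset (Fin m) := {o, p}ᶜ
  have hQ : Fintype.card (Fin m) - 2 ≤ Q.card := by
    rw [Finset.card_compl]
    have := Finset.card_le_two (a := o) (b := p)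
    omega
  have hr := hA.2 Q hQ
  let B := A.map (Int.cast : ℤ → ℚ)
  let C := (colSub A Q).map (Int.cast : ℤ → ℚ)
  have hsub : LinearMap.range C.mulVecLin ≤ LinearMap.range B.mulVecLin := by
    rw [Matrix.range_mulVecLin, Matrix.range_mulVecLin]
    apply Submodule.span_mono
    rintro _ ⟨j, rfl⟩
    exact ⟨j, rfl⟩
  have heq := Submodule.eq_of_le_of_finrank_eq hsub hr
  have hmem : B.mulVecLin (Pi.single p 1) ∈ LinearMap.range C.mulVecLin := by
    rw [heq]; exact ⟨_, rfl⟩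
  obtain ⟨c, hc⟩ := hmem
  let c' : Fin m → ℚ := fun j => if h : j ∈ Q then c ⟨j, h⟩ else 0
  have hc' : B.mulVecLin c' = C.mulVecLin c := by
    funext i
    simp only [Matrix.mulVecLin_apply, Matrix.mulVec, dotProduct]
    rw [← Finset.sum_subset (Finset.subset_univ Q)]
    · rw [← Finset.sum_coe_sort Q]
      apply Finset.sum_congr rfl
      intro j _
      simp [c', B, C, colSub]
    · intro j _ hj
      simp [c', hj]
  refine ⟨Pi.single p 1 - c', ?_, ?_, ?_⟩
  · show B.mulVecLin _ = 0
    rw [map_sub, hc', hc, sub_self]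
  · simp [c', Q, hop.symm]
  · simp [c', Q]

lemma mw_generic {ι V : Type} [AddCommGroup V] (E : Finset ι) (φ : ι → V →+ ℤ)
    (h : ∀ e ∈ E, ∃ w, φ e w ≠ 0) : ∃ w, ∀ e ∈ E, φ e w ≠ 0 := by
  induction E using Finset.induction_on with
  | empty => exact ⟨0, by simp⟩
  | insert a E ha ih =>
    obtain ⟨w, hw⟩ := ih fun e he => h e (by simp [he])
    obtain ⟨u, hu⟩ := h a (by simp)
    by_cases h0 : φ a w = 0
    · refine ⟨((∑ e ∈ E, |φ e u|) + 1) • w + u, ?_⟩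
      intro e he
      rw [map_add, map_zsmul, smul_eq_mul]
      rcases Finset.mem_insert.1 he with rfl | he
      · simpa [h0] using hu
      · have h1 : |φ e u| ≤ ∑ e ∈ E, |φ e u| :=
          Finset.single_le_sum (f := fun e => |φ e u|) (fun _ _ => abs_nonneg _) he
        intro hz
        have h2 : |φ e u| = (∑ e ∈ E, |φ e u| + 1) * |φ e w| := by
          rw [← abs_neg, ← eq_neg_of_add_eq_zero_left hz, abs_mul, abs_of_nonneg]
          have := abs_nonneg (φ e u)
          omega
        have h3 := Int.one_le_abs (hw e he)
        nlinarith [abs_nonneg (φ e u)]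
    · refine ⟨w, fun e he => ?_⟩
      rcases Finset.mem_insert.1 he with rfl | he
      · exact h0
      · exact hw e he

lemma mw_sub_mem {r m : ℕ} (A : Matrix (Fin r) (Fin m) ℤ) (b : Fin r → ℤ) (x y : Fin m → ℤ)
    (hx : A.mulVec x = b) (hy : A.mulVec y = b) :
    (fun j => (((x - y) j : ℤ) : ℚ)) ∈ mwK A := by
  rw [mw_mem_K, Matrix.mulVec_sub, hx, hy, sub_self]

lemma mw_upper_fix {r m : ℕ} (A : Matrix (Fin r) (Fin m) ℤ) (hA : IsPositiveMat A)
    (b : Fin r → ℤ) (k s n : ℕ) (hn : 1 ≤ n) (hm : 0 < m)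
    (f : Fin k → Fin s) (g : Fin s → Fin k) (p q : Fin k → Fin m)
    (Y : Finset (Fin k → Fin m → ℤ))
    (hY : ∀ χ ∈ Y, (∀ i, A.mulVec (χ i) = b) ∧ (∀ i j, 1 ≤ χ i j ∧ χ i j ≤ n) ∧
      (∀ c, f (g c) = c) ∧ ∀ i, i ≠ g (f i) → χ i (p i) = χ (g (f i)) (q i)) :
    Y.card ≤ n ^ (k * (m - rkZ A - 1) + s) := by
  have hdim := mw_finrank_K A
  obtain ⟨F, hF, hF'⟩ := mw_exists_coords _ (mwK A) le_rfl
  choose F0 hF0 hF0' using fun p => mw_exists_coords _ (mwK0 A p) le_rfl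
  have hd0 := fun p => mw_finrank_K0 A hA p
  let T : Fin k → Finset (Fin m) := fun i => if i = g (f i) then F else F0 (p i)
  have hT : ∀ i, (T i).card ≤ (m - rkZ A - 1) + if i = g (f i) then 1 else 0 := by
    intro i
    have h1 := hd0 (p i)
    have h2 := hF0 (p i)
    by_cases h : i = g (f i)
    · simp only [T, if_pos h]; omega
    · simp only [T, if_neg h]; omega
  have hsum : ∑ i, (T i).card ≤ k * (m - rkZ A - 1) + s := by
    refine (Finset.sum_le_sum fun i _ => hT i).trans ?_
    rw [Finset.sum_add_distrib]
    simp only [Finset.sum_const, Finset.card_univ, Fintype.card_fin, smul_eq_mul]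
    refine Nat.add_le_add_left ?_ _
    rw [← Finset.card_filter]
    calc _ ≤ (Finset.univ.image g).card := by
          apply Finset.card_le_card
          intro i hi
          simp only [Finset.mem_filter, Finset.mem_univ, true_and] at hi
          exact Finset.mem_image.2 ⟨f i, Finset.mem_univ _, hi.symm⟩
      _ ≤ (Finset.univ : Finset (Fin s)).card := Finset.card_image_le
      _ = s := by simp
  let Z : Finset ((i : Fin k) → T i → ℤ) :=
    Fintype.piFinset fun i => Fintype.piFinset fun _ => Finset.Icc (1 : ℤ) n
  have hZ : Z.card = n ^ (∑ i, (T i).card) := by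
    simp [Z, Fintype.card_piFinset, Finset.prod_pow_eq_pow_sum]
  refine le_trans ?_ (Nat.pow_le_pow_right hn hsum)
  rw [← hZ]
  apply Finset.card_le_card_of_injOn (fun χ i (j : T i) => χ i j)
  · intro χ hχ
    simp only [Z, Finset.mem_coe, Fintype.mem_piFinset, Finset.mem_Icc]
    intro i j
    exact (hY χ hχ).2.1 i j
  · intro χ hχ χ' hχ' he
    obtain ⟨h1, -, hfg, h3⟩ := hY χ hχ
    obtain ⟨h1', -, -, h3'⟩ := hY χ' hχ'
    have he' : ∀ i, ∀ j ∈ T i, χ i j = χ' i j := fun i j hj =>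
      congrFun (congrFun he i) ⟨j, hj⟩
    have hrep : ∀ i, i = g (f i) → χ i = χ' i := by
      intro i hi
      have := hF' _ (mw_sub_mem A b _ _ (h1 i) (h1' i)) (by
        intro j hj
        have := he' i j (by simp only [T, if_pos hi]; exact hj)
        simp [this])
      funext j
      have := congrFun this j
      simp only [Pi.sub_apply, Pi.zero_apply, Int.cast_eq_zero] at this
      omega
    funext i
    by_cases hi : i = g (f i)
    · exact hrep i hi
    · have hr : χ (g (f i)) = χ' (g (f i)) := hrep _ (by rw [hfg])
      have := hF0' (p i) _ ((mw_mem_K0 A (p i) _).2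
        ⟨mw_sub_mem A b _ _ (h1 i) (h1' i), by
          simp [h3 i hi, h3' i hi, hr]⟩) (by
        intro j hj
        have := he' i j (by simp only [T, if_neg hi]; exact hj)
        simp [this])
      funext j
      have := congrFun this j
      simp only [Pi.sub_apply, Pi.zero_apply, Int.cast_eq_zero] at this
      omega

lemma mw_upper {r m : ℕ} (A : Matrix (Fin r) (Fin m) ℤ) (hA : IsPositiveMat A)
    (b : Fin r → ℤ) (k s n : ℕ) (hn : 1 ≤ n) (hm : 0 < m)
    (X : Finset (Fin k → Fin m → ℤ))
    (hX : ∀ χ ∈ X, (∀ i, A.mulVec (χ i) = b) ∧ (∀ i j, 1 ≤ χ i j ∧ χ i j ≤ n) ∧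
      IsMilkyWay k s χ) :
    X.card ≤ Fintype.card ((Fin k → Fin s) × (Fin s → Fin k) × (Fin k → Fin m) × (Fin k → Fin m))
      * n ^ (k * (m - rkZ A - 1) + s) := by
  let Y := fun t : (Fin k → Fin s) × (Fin s → Fin k) × (Fin k → Fin m) × (Fin k → Fin m) =>
    X.filter (fun χ => (∀ c, t.1 (t.2.1 c) = c) ∧
      ∀ i, i ≠ t.2.1 (t.1 i) → χ i (t.2.2.1 i) = χ (t.2.1 (t.1 i)) (t.2.2.2 i))
  have hsub : X ⊆ Finset.univ.biUnion Y := by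
    intro χ hχ
    obtain ⟨-, -, f, hf, -, -, hcl⟩ := hX χ hχ
    obtain ⟨g, hg⟩ := hf.hasRightInverse
    have : ∀ i, ∃ p q : Fin m, i ≠ g (f i) → χ i p = χ (g (f i)) q := by
      intro i
      by_cases hi : i = g (f i)
      · exact ⟨⟨0, hm⟩, ⟨0, hm⟩, fun h => absurd hi h⟩
      · obtain ⟨a, ha⟩ := hcl (f i)
        have h := ha i (g (f i)) hi rfl (hg _)
        have h2 : a ∈ ({a} : Finset ℤ) := by simp
        rw [← h, Finset.mem_inter, Finset.mem_image, Finset.mem_image] at h2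
        obtain ⟨⟨p, -, hp⟩, ⟨q, -, hq⟩⟩ := h2
        exact ⟨p, q, fun _ => hp.trans hq.symm⟩
    choose p q hpq using this
    refine Finset.mem_biUnion.2 ⟨(f, g, p, q), Finset.mem_univ _, ?_⟩
    exact Finset.mem_filter.2 ⟨hχ, hg, hpq⟩
  refine (Finset.card_le_card hsub).trans ?_
  refine Finset.card_biUnion_le_card_mul _ _ _ ?_
  rintro ⟨f, g, p, q⟩ -
  apply mw_upper_fix A hA b k s n hn hm f g p q
  intro χ hχ
  obtain ⟨h1, h2, h3⟩ := Finset.mem_filter.1 hχ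
  exact ⟨(hX χ h1).1, (hX χ h1).2.1, h2, h3⟩

lemma mw_exists_f (k s : ℕ) (hs : 1 ≤ s) (hsk : s ≤ k / 2) :
    ∃ f : Fin k → Fin s, Function.Surjective f ∧
    (∀ c : Fin s, 2 ≤ (Finset.univ.filter fun i => f i = c).card) := by
  refine ⟨fun i => ⟨i % s, Nat.mod_lt _ hs⟩, ?_, ?_⟩
  · intro c
    have := c.2
    exact ⟨⟨c, by omega⟩, Fin.ext (Nat.mod_eq_of_lt this)⟩
  · intro c
    have := c.2
    apply Finset.one_lt_card.2
    refine ⟨⟨c, by omega⟩, ?_, ⟨c + s, by omega⟩, ?_, ?_⟩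
    · simp [Nat.mod_eq_of_lt this]
    · simp [Nat.mod_eq_of_lt this]
    · intro h
      have := Fin.mk.inj_iff.1 h
      omega

lemma mw_w {r m : ℕ} (A : Matrix (Fin r) (Fin m) ℤ) (hA : IsPositiveMat A)
    (hAb : IsAbundantMat A) (k s : ℕ) (o : Fin m) (f : Fin k → Fin s) :
    ∃ w : Fin k → Fin m → ℤ, (∀ i, A.mulVec (w i) = 0) ∧
      (∀ i j, f i = f j → w i o = w j o) ∧ (∀ i p, 0 < w i p) ∧
      ∀ i p j q, ¬ (i = j ∧ p = q) → ¬ (f i = f j ∧ p = o ∧ q = o) → w i p ≠ w j q := by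
  obtain ⟨⟨v, hv, hvp⟩, hdist⟩ := hA
  let W : AddSubgroup (Fin k → Fin m → ℤ) :=
    { carrier := {w | (∀ i, A.mulVec (w i) = 0) ∧ ∀ i j, f i = f j → w i o = w j o}
      add_mem' := by
        rintro a b ⟨h1, h2⟩ ⟨h3, h4⟩
        refine ⟨fun i => ?_, fun i j h => ?_⟩
        · rw [Pi.add_apply, Matrix.mulVec_add, h1, h3, add_zero]
        · simp [h2 i j h, h4 i j h]
      zero_mem' := ⟨fun i => by simp, fun i j h => rfl⟩
      neg_mem' := by
        rintro a ⟨h1, h2⟩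
        refine ⟨fun i => ?_, fun i j h => ?_⟩
        · rw [Pi.neg_apply, Matrix.mulVec_neg, h1, neg_zero]
        · simp [h2 i j h] }
  let φ : (Fin k × Fin m) × (Fin k × Fin m) → W →+ ℤ := fun e =>
    { toFun := fun w => w.1 e.1.1 e.1.2 - w.1 e.2.1 e.2.2
      map_zero' := by simp
      map_add' := by intro a b; simp; ring }
  let E : Finset ((Fin k × Fin m) × (Fin k × Fin m)) := Finset.univ.filter fun e =>
    ¬ (e.1.1 = e.2.1 ∧ e.1.2 = e.2.2) ∧ ¬ (f e.1.1 = f e.2.1 ∧ e.1.2 = o ∧ e.2.2 = o)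
  -- vectors supported on a single index and vanishing at the common coordinate
  have hone : ∀ (i : Fin k) (p : Fin m), p ≠ o → ∃ u : W, u.1 i p ≠ 0 ∧
      ∀ j, j ≠ i → ∀ q, u.1 j q = 0 := by
    intro i p hp
    obtain ⟨u, hu, hu0, hup⟩ := mw_abundant A hAb o p hp
    refine ⟨⟨fun j => if j = i then u else 0, ⟨fun j => ?_, fun j j' _ => ?_⟩⟩, ?_, ?_⟩
    · by_cases h : j = i <;> simp [h, hu]
    · by_cases h : j = i <;> by_cases h' : j' = i <;> simp [h, h', hu0]
    · simpa using hup
    · intro j hj q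
      simp [hj]
  have hE : ∀ e ∈ E, ∃ w, φ e w ≠ 0 := by
    rintro ⟨⟨i, p⟩, ⟨j, q⟩⟩ he
    simp only [E, Finset.mem_filter, Finset.mem_univ, true_and] at he
    obtain ⟨h1, h2⟩ := he
    show ∃ w : W, w.1 i p - w.1 j q ≠ 0
    by_cases hij : i = j
    · subst hij
      have hpq : p ≠ q := fun h => h1 ⟨rfl, h⟩
      obtain ⟨u, hu, hne⟩ := hdist p q hpq
      exact ⟨⟨fun _ => u, fun _ => hu, fun _ _ _ => rfl⟩, sub_ne_zero.2 hne⟩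
    · by_cases hf : f i = f j
      · by_cases hp : p = o
        · have hq : q ≠ o := fun h => h2 ⟨hf, hp, h⟩
          obtain ⟨u, hu, hu'⟩ := hone j q hq
          refine ⟨u, ?_⟩
          rw [hu' i hij]
          simpa using hu
        · obtain ⟨u, hu, hu'⟩ := hone i p hp
          refine ⟨u, ?_⟩
          rw [hu' j (Ne.symm hij)]
          simpa using hu
      · refine ⟨⟨fun l => if f l = f i then v else 0, fun l => ?_, fun l l' h => ?_⟩, ?_⟩
        · by_cases h : f l = f i <;> simp [h, hv]
        · simp [h]
        · have := hvp p
          simp [Ne.symm hf]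
          omega
  obtain ⟨w, hw⟩ := mw_generic E φ hE
  let M : ℤ := (∑ i, ∑ p, |w.1 i p|) + (∑ e, |φ e w|) + 1
  have hM1 : ∀ i p, |w.1 i p| < M := by
    intro i p
    have h1 : |w.1 i p| ≤ ∑ p, |w.1 i p| :=
      Finset.single_le_sum (f := fun p => |w.1 i p|) (fun _ _ => abs_nonneg _) (Finset.mem_univ p)
    have h2 : ∑ p, |w.1 i p| ≤ ∑ i, ∑ p, |w.1 i p| :=
      Finset.single_le_sum (f := fun i => ∑ p, |w.1 i p|)
        (fun _ _ => Finset.sum_nonneg fun _ _ => abs_nonneg _) (Finset.mem_univ i)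
    have h3 : 0 ≤ ∑ e, |φ e w| := Finset.sum_nonneg fun _ _ => abs_nonneg _
    simp only [M]
    omega
  have hM2 : ∀ e, |φ e w| < M := by
    intro e
    have h1 : |φ e w| ≤ ∑ e, |φ e w| :=
      Finset.single_le_sum (f := fun e => |φ e w|) (fun _ _ => abs_nonneg _) (Finset.mem_univ e)
    have h3 : 0 ≤ ∑ i, ∑ p, |w.1 i p| :=
      Finset.sum_nonneg fun _ _ => Finset.sum_nonneg fun _ _ => abs_nonneg _
    simp only [M]
    omega
  refine ⟨fun i => w.1 i + M • v, ?_, ?_, ?_, ?_⟩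
  · intro i
    rw [Matrix.mulVec_add, Matrix.mulVec_smul, hv, w.2.1 i]
    simp
  · intro i j h
    simp [w.2.2 i j h]
  · intro i p
    have h1 := (abs_lt.1 (hM1 i p)).1
    have h2 := hvp p
    have h3 := (abs_nonneg _).trans_lt (hM1 i p)
    simp only [Pi.add_apply, Pi.smul_apply, smul_eq_mul]
    nlinarith
  · intro i p j q h1 h2
    have he : ((i, p), (j, q)) ∈ E := by
      simp only [E, Finset.mem_filter, Finset.mem_univ, true_and]
      exact ⟨h1, h2⟩
    have h3 := hw _ he
    have h4 := hM2 ((i, p), (j, q))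
    have h5 : φ ((i, p), (j, q)) w = w.1 i p - w.1 j q := rfl
    rw [h5] at h3 h4
    simp only [Pi.add_apply, Pi.smul_apply, smul_eq_mul]
    intro hcon
    by_cases hvv : v p = v q
    · rw [hvv] at hcon
      omega
    · have h6 : w.1 i p - w.1 j q = M * (v q - v p) := by linarith
      rw [h6, abs_mul] at h4
      have h7 := Int.one_le_abs (sub_ne_zero.2 (Ne.symm hvv))
      have h8 : M ≤ |M| := le_abs_self M
      have h9 := abs_nonneg M
      nlinarith

lemma mw_lower {r m : ℕ} (A : Matrix (Fin r) (Fin m) ℤ) (hA : IsPositiveMat A)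
    (hAb : IsAbundantMat A) (b : Fin r → ℤ) (hb : ∃ x : Fin m → ℤ, A.mulVec x = b)
    (hm : 0 < m) (k s : ℕ) (hs : 1 ≤ s) (hsk : s ≤ k / 2) :
    ∃ R : ℕ, 0 < R ∧ ∀ M n : ℕ, 1 ≤ M → R * M ≤ n → ∀ X : Finset (Fin k → Fin m → ℤ),
      (∀ χ : Fin k → Fin m → ℤ, (∀ i, A.mulVec (χ i) = b) → (∀ i, Function.Injective (χ i)) →
        (∀ i j, 1 ≤ χ i j ∧ χ i j ≤ n) → IsMilkyWay k s χ → χ ∈ X) →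
      M ^ (k * (m - rkZ A - 1) + s) ≤ X.card := by
  obtain ⟨f, hf, hcard⟩ := mw_exists_f k s hs hsk
  let o : Fin m := ⟨0, hm⟩
  obtain ⟨w, hwA, hwo, hwpos, hwne⟩ := mw_w A hA hAb k s o f
  obtain ⟨x0, hx0⟩ := hb
  have hd : Module.finrank ℚ (mwK0 A o) = m - rkZ A - 1 := by
    have h1 := mw_finrank_K0 A hA o
    have h2 := mw_finrank_K A
    omega
  obtain ⟨y, hyW, hyind⟩ := mw_int_basis (mwK0 A o) _ hd
  generalize m - rkZ A - 1 = D at y hyW hyind ⊢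
  have hyA : ∀ l, A.mulVec (y l) = 0 := fun l =>
    (mw_mem_K A _).1 ((mw_mem_K0 A o _).1 (hyW l)).1
  have hyo : ∀ l, y l o = 0 := fun l => by
    have := ((mw_mem_K0 A o _).1 (hyW l)).2
    exact_mod_cast this
  obtain ⟨⟨v, hvA, hvpos⟩, -⟩ := hA
  -- a common bound
  let B : ℤ := ∑ p, (|x0 p| + v p + ∑ l, |y l p|)
  let Wb : ℤ := ∑ i, ∑ p, w i p
  have hB : ∀ p, |x0 p| + v p + ∑ l, |y l p| ≤ B := fun p =>
    Finset.single_le_sum (f := fun p => |x0 p| + v p + ∑ l, |y l p|)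
      (fun p _ => add_nonneg (add_nonneg (abs_nonneg _) (hvpos p).le)
        (Finset.sum_nonneg fun _ _ => abs_nonneg _)) (Finset.mem_univ p)
  have hWb : ∀ i p, w i p ≤ Wb := by
    intro i p
    have h1 : w i p ≤ ∑ p, w i p :=
      Finset.single_le_sum (f := fun p => w i p) (fun p _ => (hwpos i p).le) (Finset.mem_univ p)
    have h2 : ∑ p, w i p ≤ ∑ i, ∑ p, w i p :=
      Finset.single_le_sum (f := fun i => ∑ p, w i p)
        (fun i _ => Finset.sum_nonneg fun p _ => (hwpos i p).le) (Finset.mem_univ i)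
    exact h1.trans h2
  have hB0 : 0 ≤ B := Finset.sum_nonneg fun p _ => add_nonneg (add_nonneg (abs_nonneg _)
    (hvpos p).le) (Finset.sum_nonneg fun _ _ => abs_nonneg _)
  have hWb0 : 0 ≤ Wb := Finset.sum_nonneg fun i _ => Finset.sum_nonneg fun p _ => (hwpos i p).le
  obtain ⟨L, hL⟩ : ∃ L : ℤ, L = 2 * B + 1 := ⟨_, rfl⟩
  have hR0 : 0 < L * Wb + B + 1 := by subst hL; positivity
  refine ⟨(L * Wb + B + 1).toNat, by omega, ?_⟩
  intro M n hM hn X hX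
  have hn' : (L * Wb + B + 1) * M ≤ n := by
    have : (((L * Wb + B + 1).toNat * M : ℕ) : ℤ) ≤ n := by exact_mod_cast hn
    rwa [Nat.cast_mul, Int.toNat_of_nonneg hR0.le] at this
  have hM' : (1 : ℤ) ≤ M := by exact_mod_cast hM
  let pert : (Fin s → Fin M) × (Fin k → Fin D → Fin M) → Fin k → Fin m → ℤ := fun θ i p =>
    x0 p + ((θ.1 (f i) : ℕ) : ℤ) * v p + ∑ l, ((θ.2 i l : ℕ) : ℤ) * y l p
  have hpert : ∀ θ i p, |pert θ i p| ≤ B * M := by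
    intro θ i p
    have hlt : ∀ a : Fin M, |((a : ℕ) : ℤ)| ≤ M := by
      intro a
      rw [Nat.abs_cast]
      exact_mod_cast a.2.le
    have h1 : |∑ l, ((θ.2 i l : ℕ) : ℤ) * y l p| ≤ (∑ l, |y l p|) * M := by
      refine (Finset.abs_sum_le_sum_abs _ _).trans ?_
      rw [Finset.sum_mul]
      refine Finset.sum_le_sum fun l _ => ?_
      rw [abs_mul, mul_comm]
      exact mul_le_mul_of_nonneg_left (hlt _) (abs_nonneg _)
    have h2 : |((θ.1 (f i) : ℕ) : ℤ) * v p| ≤ v p * M := by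
      rw [abs_mul, mul_comm, abs_of_pos (hvpos p)]
      exact mul_le_mul_of_nonneg_left (hlt _) (hvpos p).le
    have h3 : |x0 p| ≤ |x0 p| * M := le_mul_of_one_le_right (abs_nonneg _) hM'
    calc |pert θ i p| ≤ |x0 p| + |((θ.1 (f i) : ℕ) : ℤ) * v p| +
          |∑ l, ((θ.2 i l : ℕ) : ℤ) * y l p| := abs_add_three _ _ _
      _ ≤ (|x0 p| + v p + ∑ l, |y l p|) * M := by rw [add_mul, add_mul]; gcongr
      _ ≤ B * M := mul_le_mul_of_nonneg_right (hB p) (by omega)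
  let Φ : (Fin s → Fin M) × (Fin k → Fin D → Fin M) → Fin k → Fin m → ℤ := fun θ i p =>
    pert θ i p + L * M * w i p
  have hpo : ∀ θ i, pert θ i o = x0 o + ((θ.1 (f i) : ℕ) : ℤ) * v o := by
    intro θ i
    simp [pert, hyo]
  have hΦne : ∀ θ i p j q, ¬ (i = j ∧ p = q) → ¬ (f i = f j ∧ p = o ∧ q = o) →
      Φ θ i p ≠ Φ θ j q := by
    intro θ i p j q h1 h2 h
    have h3 := sub_ne_zero.2 (hwne i p j q h1 h2)
    have h4 := Int.one_le_abs h3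
    have h5 : L * M * (w i p - w j q) = pert θ j q - pert θ i p := by
      simp only [Φ] at h
      linarith
    have h6 : |L * M * (w i p - w j q)| ≤ 2 * (B * M) := by
      rw [h5]
      have := abs_sub (pert θ j q) (pert θ i p)
      have := hpert θ j q
      have := hpert θ i p
      linarith
    have h7 : 0 ≤ L * M := by subst hL; positivity
    rw [abs_mul, abs_of_nonneg h7] at h6
    have h8 : L * M * 1 ≤ L * M * |w i p - w j q| := mul_le_mul_of_nonneg_left h4 h7
    subst hL
    nlinarith
  have hΦX : ∀ θ, Φ θ ∈ X := by
    intro θ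
    apply hX
    · intro i
      have : Φ θ i = x0 + ((θ.1 (f i) : ℕ) : ℤ) • v + ∑ l, ((θ.2 i l : ℕ) : ℤ) • y l
          + (L * M) • w i := by
        funext p
        simp [Φ, pert]
      rw [this, Matrix.mulVec_add, Matrix.mulVec_add, Matrix.mulVec_add, Matrix.mulVec_smul,
        Matrix.mulVec_smul, hx0, hvA, hwA, Matrix.mulVec_sum]
      simp only [Matrix.mulVec_smul, hyA, smul_zero, Finset.sum_const_zero, add_zero]
    · intro i p q h
      by_contra hpq
      exact hΦne θ i p i q (fun h' => hpq h'.2) (fun h' => hpq (h'.2.1.trans h'.2.2.symm)) h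
    · intro i p
      have h1 := abs_le.1 (hpert θ i p)
      have h2 := hwpos i p
      have h3 := hWb i p
      have h7 : 0 ≤ L * M := by subst hL; positivity
      have h8 : L * M * 1 ≤ L * M * w i p := mul_le_mul_of_nonneg_left (by omega) h7
      have h9 : L * M * w i p ≤ L * M * Wb := mul_le_mul_of_nonneg_left h3 h7
      simp only [Φ]
      constructor
      · subst hL
        nlinarith
      · nlinarith
    · refine ⟨f, hf, hcard, ?_, ?_⟩
      · intro i j hij
        apply Finset.eq_empty_of_forall_notMem
        intro a ha
        rw [Finset.mem_inter, Finset.mem_image, Finset.mem_image] at ha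
        obtain ⟨⟨p, -, hp⟩, ⟨q, -, hq⟩⟩ := ha
        exact hΦne θ i p j q (fun h => hij (by rw [h.1])) (fun h => hij h.1) (hp.trans hq.symm)
      · intro c
        obtain ⟨i0, hi0⟩ := hf c
        have hcom : ∀ i, f i = c → Φ θ i o = Φ θ i0 o := by
          intro i hi
          simp only [Φ]
          rw [hpo, hpo, hi, hi0, hwo i i0 (hi.trans hi0.symm)]
        refine ⟨Φ θ i0 o, ?_⟩
        intro i j hij hi hj
        ext a
        rw [Finset.mem_inter, Finset.mem_image, Finset.mem_image, Finset.mem_singleton]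
        constructor
        · rintro ⟨⟨p, -, hp⟩, ⟨q, -, hq⟩⟩
          by_contra hne
          refine hΦne θ i p j q (fun h => hij h.1) (fun h => hne ?_) (hp.trans hq.symm)
          rw [← hp, h.2.1, hcom i hi]
        · rintro rfl
          exact ⟨⟨o, Finset.mem_univ _, hcom i hi⟩, ⟨o, Finset.mem_univ _, hcom j hj⟩⟩
  have hinj : Function.Injective Φ := by
    rintro ⟨T, t⟩ ⟨T', t'⟩ h
    have h0 : ∀ i p, pert (T, t) i p = pert (T', t') i p := by
      intro i p
      have := congrFun (congrFun h i) p
      simp only [Φ] at this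
      linarith
    have hT : T = T' := by
      funext c
      obtain ⟨i, rfl⟩ := hf c
      have h1 := h0 i o
      rw [hpo, hpo] at h1
      have h2 := mul_right_cancel₀ (hvpos o).ne' (add_left_cancel h1)
      exact Fin.ext (by exact_mod_cast h2)
    subst hT
    have ht : t = t' := by
      funext i
      have h1 := hyind (fun l => ((t i l : ℕ) : ℤ) - ((t' i l : ℕ) : ℤ)) (by
        intro p
        have h2 := h0 i p
        simp only [pert] at h2
        simp only [sub_mul, Finset.sum_sub_distrib]
        linarith)
      funext l
      have h3 := congrFun h1 l
      simp only [Pi.zero_apply] at h3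
      exact Fin.ext (by omega)
    rw [ht]
  have := Finset.card_le_card_of_injOn (s := Finset.univ) (t := X) Φ (fun θ _ => hΦX θ) hinj.injOn
  rw [Finset.card_univ] at this
  refine le_trans (le_of_eq ?_) this
  simp
  ring

/-- **Lemma (count of `s`-milky ways).** -/
theorem milkyWay_count {r m : ℕ} (hr : 0 < r) (hrm : r < m)
    (A : Matrix (Fin r) (Fin m) ℤ) (hApos : IsPositiveMat A) (hAab : IsAbundantMat A)
    (b : Fin r → ℤ) (hb : ∃ x : Fin m → ℤ, A.mulVec x = b)
    (P : Set (Setoid (Fin m))) (hPsub : P ⊆ partitionFamily A)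
    (hPsing : singletonSetoid (Fin m) ∈ P)
    (hPpos : ∀ s ∈ P,
      (∃ y : Quotient s → ℤ, (contract A s).mulVec y = b ∧ Function.Injective y) →
        IsPositiveMat (contract A s))
    (k s : ℕ) (hk : 2 ≤ k) (hs : 1 ≤ s) (hsk : s ≤ k / 2) :
    ∃ c C : ℝ, 0 < c ∧ 0 < C ∧ ∃ n₀ : ℕ, ∀ n ≥ n₀,
      c * (n : ℝ) ^ (k * (m - rkZ A - 1) + s) ≤
        (Nat.card {χ : Fin k → (Fin m → ℤ) //
          (∀ i, A.mulVec (χ i) = b ∧ Setoid.ker (χ i) ∈ P ∧ ∀ j, 1 ≤ χ i j ∧ χ i j ≤ n) ∧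
          IsMilkyWay k s χ} : ℝ) ∧
      (Nat.card {χ : Fin k → (Fin m → ℤ) //
          (∀ i, A.mulVec (χ i) = b ∧ Setoid.ker (χ i) ∈ P ∧ ∀ j, 1 ≤ χ i j ∧ χ i j ≤ n) ∧
          IsMilkyWay k s χ} : ℝ) ≤
        C * (n : ℝ) ^ (k * (m - rkZ A - 1) + s) := by
  have hm : 0 < m := by omega
  obtain ⟨R, hR, hlow⟩ := mw_lower A hApos hAab b hb hm k s hs hsk
  let D := k * (m - rkZ A - 1) + s
  let C : ℕ := Fintype.card
    ((Fin k → Fin s) × (Fin s → Fin k) × (Fin k → Fin m) × (Fin k → Fin m))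
  refine ⟨(1 / (2 * R : ℝ)) ^ D, C + 1, by positivity, by positivity, R, ?_⟩
  intro n hn
  let X : Finset (Fin k → Fin m → ℤ) :=
    (Fintype.piFinset fun _ => Fintype.piFinset fun _ => Finset.Icc (1 : ℤ) n).filter fun χ =>
      (∀ i, A.mulVec (χ i) = b ∧ Setoid.ker (χ i) ∈ P ∧ ∀ j, 1 ≤ χ i j ∧ χ i j ≤ n) ∧
          IsMilkyWay k s χ
  have hX : ∀ χ, χ ∈ X ↔
      (∀ i, A.mulVec (χ i) = b ∧ Setoid.ker (χ i) ∈ P ∧ ∀ j, 1 ≤ χ i j ∧ χ i j ≤ n) ∧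
          IsMilkyWay k s χ := by
    intro χ
    simp only [X, Finset.mem_filter, Fintype.mem_piFinset, Finset.mem_Icc, and_iff_right_iff_imp]
    intro h i j
    exact (h.1 i).2.2 j
  rw [Nat.subtype_card X hX]
  constructor
  · have hM : 1 ≤ n / R := (Nat.one_le_div_iff hR).2 hn
    have h1 := hlow (n / R) n hM (Nat.mul_div_le n R) X (by
      intro χ h1 h2 h3 h4
      refine (hX χ).2 ⟨fun i => ⟨h1 i, ?_, h3 i⟩, h4⟩
      have : Setoid.ker (χ i) = singletonSetoid (Fin m) := by
        ext p q
        exact (h2 i).eq_iff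
      rw [this]
      exact hPsing)
    have h2 : (((n / R) ^ D : ℕ) : ℝ) ≤ X.card := by exact_mod_cast h1
    refine le_trans ?_ h2
    rw [← mul_pow, Nat.cast_pow]
    refine pow_le_pow_left₀ (by positivity) ?_ _
    have h3 : n < 2 * R * (n / R) := by
      have := Nat.lt_mul_div_succ n hR
      nlinarith
    have h4 : (n : ℝ) ≤ 2 * R * ((n / R : ℕ) : ℝ) := by exact_mod_cast h3.le
    have hR' : (0 : ℝ) < R := by exact_mod_cast hR
    rw [one_div, inv_mul_le_iff₀ (by positivity)]
    exact h4
  · have h1 := mw_upper A hApos b k s n (by omega) hm X (by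
      intro χ hχ
      have h := (hX χ).1 hχ
      exact ⟨fun i => (h.1 i).1, fun i => (h.1 i).2.2, h.2⟩)
    have h2 : (X.card : ℝ) ≤ C * (n : ℝ) ^ D := by exact_mod_cast h1
    refine h2.trans ?_
    exact mul_le_mul_of_nonneg_right (by linarith) (by positivity)
end
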